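/- Let P ⊂ ℝ² be a lattice polygon with P ⊂ [0,∞)² that contains a lattice translate of 5Δ. Then for a generic polynomial f ∈ ℂ^{P∩ℤ²}, the set of inflection points of the curve {f=0} in the torus T is finite, and its cardinality equals 6·vol(P) − 2·(len(P^↓) + len(P^↗) + len(P^←)) − (len(P^↑) + len(P^↙) + len(P^→)). -/

import Mathlib

open scoped Pointwise
open MvPolynomial

noncomputable section

/-- The torus `(ℂ ∖ {0})²`. -/
def Torus : Set (ℂ × ℂ) := {p | p.1 ≠ 0 ∧ p.2 ≠ 0}

/-- Evaluation of a bivariate polynomial at a point of `ℂ²`. -/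
def evalP (f : MvPolynomial (Fin 2) ℂ) (p : ℂ × ℂ) : ℂ :=
  MvPolynomial.eval (fun i => if i = 0 then p.1 else p.2) f

/-- The affine line through `p` with direction `w`, as a subset of `ℂ²`. -/
def lineThrough (p w : ℂ × ℂ) : Set (ℂ × ℂ) :=
  {q | ∃ t : ℂ, q = (p.1 + t * w.1, p.2 + t * w.2)}

/-- The univariate polynomial `t ↦ f (p + t • w)`. -/
def lineRestrict (f : MvPolynomial (Fin 2) ℂ) (p w : ℂ × ℂ) : Polynomial ℂ :=
  MvPolynomial.aeval
    (fun i => if i = 0 then Polynomial.C p.1 + Polynomial.C w.1 * Polynomial.X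
              else Polynomial.C p.2 + Polynomial.C w.2 * Polynomial.X) f

/-- Intersection multiplicity at `p` of the curve `{f = 0}` and the line through `p`
with direction `w` (as `ℕ∞`; it is `⊤` if the line lies inside the curve). -/
def interMult (f : MvPolynomial (Fin 2) ℂ) (p w : ℂ × ℂ) : ℕ∞ :=
  if lineRestrict f p w = 0 then ⊤
  else (Polynomial.rootMultiplicity 0 (lineRestrict f p w) : ℕ∞)

/-- The point of `ℝ²` corresponding to a lattice point. -/
def rpt (k : ℤ × ℤ) : ℝ × ℝ := ((k.1 : ℝ), (k.2 : ℝ))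

/-- The support of `f` is contained in `S ⊆ ℤ²`. -/
def SuppIn (f : MvPolynomial (Fin 2) ℂ) (S : Set (ℤ × ℤ)) : Prop :=
  ∀ m ∈ f.support, ((m 0 : ℤ), (m 1 : ℤ)) ∈ S

/-- The coefficient of `f` at the exponent `k ∈ ℤ²`. -/
def coeffAt (f : MvPolynomial (Fin 2) ℂ) (k : ℤ × ℤ) : ℂ :=
  if 0 ≤ k.1 ∧ 0 ≤ k.2 then
    f.coeff (Finsupp.single (0 : Fin 2) k.1.toNat + Finsupp.single (1 : Fin 2) k.2.toNat)
  else 0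

/-- A property `Q` holds for a generic polynomial supported in `S`: there is a nonzero
polynomial `D` in variables indexed by `S` such that `Q f` holds for every `f` with
support in `S` whose coefficient tuple is not annihilated by `D`. -/
def GenericOn (S : Set (ℤ × ℤ)) (Q : MvPolynomial (Fin 2) ℂ → Prop) : Prop :=
  ∃ D : MvPolynomial S ℂ, D ≠ 0 ∧
    ∀ f : MvPolynomial (Fin 2) ℂ, SuppIn f S →
      MvPolynomial.eval (fun k => coeffAt f k.1) D ≠ 0 → Q f

/-- `P` is a lattice polygon: the convex hull of finitely many lattice points. -/
def IsLatticePolygon (P : Set (ℝ × ℝ)) : Prop :=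
  ∃ V : Finset (ℤ × ℤ), V.Nonempty ∧ P = convexHull ℝ (rpt '' (V : Set (ℤ × ℤ)))

/-- The standard triangle `Δ = conv {(0,0), (1,0), (0,1)}`. -/
def stdTriangle : Set (ℝ × ℝ) := convexHull ℝ {(0, 0), (1, 0), (0, 1)}

/-- The lattice points of a subset of `ℝ²`. -/
def latticePts (P : Set (ℝ × ℝ)) : Set (ℤ × ℤ) := {k | rpt k ∈ P}

/-- The support set (face) of `P` in the direction of the covector `γ`. -/
def face (P : Set (ℝ × ℝ)) (γ : ℤ × ℤ) : Set (ℝ × ℝ) :=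
  {p ∈ P | ∀ q ∈ P, (γ.1 : ℝ) * q.1 + (γ.2 : ℝ) * q.2 ≤ (γ.1 : ℝ) * p.1 + (γ.2 : ℝ) * p.2}

/-- The lattice length of the face of `P` in direction `γ`. -/
def lenFace (P : Set (ℝ × ℝ)) (γ : ℤ × ℤ) : ℕ := (latticePts (face P γ)).ncard - 1

/-- The Euclidean area of a subset of `ℝ²`. -/
def areaOf (P : Set (ℝ × ℝ)) : ℝ := (MeasureTheory.volume P).toReal

/-- The set of inflection points of `{f = 0}` in the torus. -/
def inflPts (f : MvPolynomial (Fin 2) ℂ) : Set (ℂ × ℂ) :=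
  {p | p ∈ Torus ∧ evalP f p = 0 ∧ ∃ w : ℂ × ℂ, w ≠ 0 ∧ 3 ≤ interMult f p w}

/-- The set of lines (as subsets of `ℂ²`) tangent to `{f = 0}` at two distinct
points of the torus. -/
def bitangentLines (f : MvPolynomial (Fin 2) ℂ) : Set (Set (ℂ × ℂ)) :=
  {l | ∃ p w q₁ q₂ : ℂ × ℂ, w ≠ 0 ∧ l = lineThrough p w ∧
    q₁ ∈ lineThrough p w ∩ Torus ∧ q₂ ∈ lineThrough p w ∩ Torus ∧ q₁ ≠ q₂ ∧
    2 ≤ interMult f q₁ w ∧ 2 ≤ interMult f q₂ w}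

/-- `P` contains a lattice translate of `5Δ`. -/
def Contains5Delta (P : Set (ℝ × ℝ)) : Prop :=
  ∃ t : ℤ × ℤ, rpt t +ᵥ ((5 : ℝ) • stdTriangle) ⊆ P

/-- The tuple `a` satisfies `Q` as soon as some fixed nonzero polynomial does not vanish at `a`. -/
def GenericTuple {ι : Type*} (Q : (ι → ℂ) → Prop) : Prop :=
  ∃ D : MvPolynomial ι ℂ, D ≠ 0 ∧ ∀ a : ι → ℂ, eval a D ≠ 0 → Q a

theorem GenericTuple.mono {ι : Type*} {Q R : (ι → ℂ) → Prop} (h : GenericTuple Q)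
    (hQR : ∀ a, Q a → R a) : GenericTuple R := by
  obtain ⟨D, hD, h⟩ := h
  exact ⟨D, hD, fun a ha => hQR a (h a ha)⟩

theorem GenericTuple.of_forall {ι : Type*} {Q : (ι → ℂ) → Prop} (h : ∀ a, Q a) :
    GenericTuple Q := ⟨1, one_ne_zero, fun a _ => h a⟩

theorem GenericTuple.and {ι : Type*} {Q R : (ι → ℂ) → Prop} (hQ : GenericTuple Q)
    (hR : GenericTuple R) : GenericTuple (fun a => Q a ∧ R a) := by
  obtain ⟨D, hD, hQ⟩ := hQ
  obtain ⟨E, hE, hR⟩ := hR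
  refine ⟨D * E, mul_ne_zero hD hE, fun a ha => ?_⟩
  rw [map_mul] at ha
  exact ⟨hQ a (left_ne_zero_of_mul ha), hR a (right_ne_zero_of_mul ha)⟩

theorem GenericTuple.forall {ι σ : Type*} [Finite σ] {Q : σ → (ι → ℂ) → Prop}
    (h : ∀ s, GenericTuple (Q s)) : GenericTuple (fun a => ∀ s, Q s a) := by
  classical
  have := Fintype.ofFinite σ
  choose D hD h using h
  refine ⟨∏ s, D s, Finset.prod_ne_zero_iff.2 fun s _ => hD s, fun a ha s => h s a ?_⟩
  rw [map_prod] at ha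
  exact Finset.prod_ne_zero_iff.1 ha s (Finset.mem_univ s)

theorem GenericTuple.coord_ne_zero {ι : Type*} (k : ι) : GenericTuple (fun a => a k ≠ 0) :=
  ⟨X k, X_ne_zero k, fun a ha => by simpa using ha⟩

/-- A family of polynomials with more members than variables is algebraically dependent. -/
theorem exists_aeval_eq_zero_of_card_lt {ι κ : Type*} [Fintype ι] [Fintype κ]
    (h : Fintype.card κ < Fintype.card ι) (φ : ι → MvPolynomial κ ℂ) :
    ∃ D : MvPolynomial ι ℂ, D ≠ 0 ∧ aeval φ D = 0 := by
  by_contra! hc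
  have hind : AlgebraicIndependent ℂ φ := by
    rw [algebraicIndependent_iff]
    intro p hp
    by_contra hp0
    exact hc p hp0 hp
  have h1 := hind.lift_cardinalMk_le_trdeg
  have h2 : Algebra.trdeg ℂ (MvPolynomial κ ℂ) = Cardinal.lift (Cardinal.mk κ) := by
    rw [MvPolynomial.trdeg_of_isDomain]
    simp
  rw [h2] at h1
  simp at h1
  omega

/-- If a system of `r` linear conditions on `a`, depending polynomially on fewer than `r`
parameters `z`, is satisfied, then generically in `a` every maximal minor vanishes at `z`. -/
theorem GenericTuple.linear {ι τ ρ : Type*} [Fintype ι] [Fintype τ] [Fintype ρ] [DecidableEq ρ]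
    (h : Fintype.card τ < Fintype.card ρ) (M : ρ → ι → MvPolynomial τ ℂ) (c : ρ ↪ ι) :
    GenericTuple (fun a => ∀ z : τ → ℂ, (∀ r, ∑ k, eval z (M r k) * a k = 0) →
      (Matrix.of fun r s => eval z (M r (c s))).det = 0) := by
  classical
  let Mc : Matrix ρ ρ (MvPolynomial τ ℂ) := Matrix.of fun r s => M r (c s)
  let κ := {k : ι // k ∉ Set.range c}
  let i : MvPolynomial τ ℂ →ₐ[ℂ] MvPolynomial (τ ⊕ κ) ℂ := rename Sum.inl
  let φ : ι → MvPolynomial (τ ⊕ κ) ℂ := fun k =>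
    if hk : k ∈ Set.range c then
      - ∑ r, i (Mc.adjugate hk.choose r) * ∑ k' : κ, i (M r k') * X (Sum.inr k')
    else i Mc.det * X (Sum.inr ⟨k, hk⟩)
  have hcard : Fintype.card (τ ⊕ κ) < Fintype.card ι := by
    have h1 : Fintype.card κ = Fintype.card ι - Fintype.card (Set.range c) :=
      Fintype.card_subtype_compl (fun k => k ∈ Set.range c)
    have h2 : Fintype.card (Set.range c) = Fintype.card ρ :=
      Set.card_range_of_injective c.injective
    have h3 : Fintype.card ρ ≤ Fintype.card ι := Fintype.card_le_of_embedding c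
    rw [Fintype.card_sum, h1, h2]
    omega
  obtain ⟨D, hD0, hD⟩ := exists_aeval_eq_zero_of_card_lt hcard φ
  refine ⟨D, hD0, fun a ha z hz => ?_⟩
  by_contra hdet
  apply ha
  have hq : (Matrix.of fun r s => eval z (M r (c s))).det = eval z Mc.det := by
    rw [RingHom.map_det]
    rfl
  set q := eval z Mc.det with hqdef
  rw [hq] at hdet
  let z' : τ ⊕ κ → ℂ := Sum.elim z (fun k => a k / q)
  have hev (p : MvPolynomial τ ℂ) : eval z' (i p) = eval z p := by
    simp only [i, eval_rename]
    rfl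
  have hsplit (g : ι → ℂ) : ∑ k, g k = ∑ s, g (c s) + ∑ k : κ, g k := by
    rw [← Fintype.sum_subtype_add_sum_subtype (fun k => k ∈ Set.range c) g]
    congr 1
    convert (Fintype.sum_equiv (Equiv.ofInjective c c.injective) (fun s => g (c s))
      (fun k : Set.range c => g k) fun _ => rfl).symm
  have key (k : ι) : eval z' (φ k) = a k := by
    by_cases hk : k ∈ Set.range c
    · have hs := hk.choose_spec
      set s := hk.choose with hsdef
      have : φ k = - ∑ r, i (Mc.adjugate s r) * ∑ k' : κ, i (M r k') * X (Sum.inr k') := by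
        simp only [φ]
        rw [dif_pos hk]
      rw [this, ← hs]
      simp only [map_neg, map_sum, map_mul, hev, eval_X]
      have h1 (r : ρ) : ∑ k' : κ, eval z (M r k') * z' (Sum.inr k') =
          - (∑ s, eval z (M r (c s)) * a (c s)) / q := by
        have := hz r
        rw [hsplit] at this
        rw [eq_div_iff hdet, Finset.sum_mul, ← eq_neg_of_add_eq_zero_right this]
        refine Finset.sum_congr rfl fun k' _ => ?_
        simp only [z', Sum.elim_inr]
        field_simp
      simp only [h1]
      have h2 : ∀ s', ∑ r, eval z (Mc.adjugate s r) * eval z (M r (c s')) =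
          if s = s' then q else 0 := by
        intro s'
        have := congrFun (congrFun (Matrix.adjugate_mul Mc) s) s'
        rw [Matrix.mul_apply] at this
        have h3 := congrArg (eval z) this
        simp only [map_sum, map_mul, Matrix.smul_apply, Matrix.one_apply, smul_eq_mul] at h3
        simp only [Mc, Matrix.of_apply] at h3 ⊢
        rw [h3]
        split_ifs <;> simp [hqdef, Mc]
      calc -∑ r, eval z (Mc.adjugate s r) * (-(∑ s', eval z (M r (c s')) * a (c s')) / q)
          = ∑ r, ∑ s', (eval z (Mc.adjugate s r) * eval z (M r (c s'))) * (a (c s') / q) := by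
            rw [← Finset.sum_neg_distrib]
            refine Finset.sum_congr rfl fun r _ => ?_
            rw [neg_div, mul_neg, neg_neg, Finset.sum_div, Finset.mul_sum]
            refine Finset.sum_congr rfl fun s' _ => by ring
        _ = a (c s) := by
            rw [Finset.sum_comm]
            simp only [← Finset.sum_mul, h2]
            simp [mul_div_cancel₀ _ hdet]
    · have : φ k = i Mc.det * X (Sum.inr ⟨k, hk⟩) := by
        simp only [φ]
        rw [dif_neg hk]
      rw [this, map_mul, hev, eval_X, ← hqdef]
      simp only [z', Sum.elim_inr]
      field_simp
  have h1 : eval z' (aeval φ D) = eval (fun k => eval z' (φ k)) D := by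
    have h2 := comp_aeval_apply φ (aeval z' : MvPolynomial (τ ⊕ κ) ℂ →ₐ[ℂ] ℂ) D
    exact h2
  rw [hD, map_zero] at h1
  simp only [key] at h1
  exact h1.symm

open PowerSeries in
/-- The Euler derivation `τ d/dτ` on power series in `τ`. -/
def eulerDer : Derivation ℂ (PowerSeries ℂ) (PowerSeries ℂ) :=
  (PowerSeries.X : PowerSeries ℂ) • PowerSeries.derivative ℂ

theorem eulerDer_apply (f : PowerSeries ℂ) :
    eulerDer f = PowerSeries.X * PowerSeries.derivative ℂ f := rfl

theorem coeff_eulerDer (f : PowerSeries ℂ) (n : ℕ) :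
    PowerSeries.coeff n (eulerDer f) = n * PowerSeries.coeff n f := by
  rw [eulerDer_apply]
  cases n with
  | zero => simp
  | succ n =>
    rw [PowerSeries.coeff_succ_X_mul, PowerSeries.coeff_derivative]
    push_cast
    ring

theorem constantCoeff_eulerDer (f : PowerSeries ℂ) :
    PowerSeries.constantCoeff (eulerDer f) = 0 := by
  simp [eulerDer_apply]

theorem eulerDer_C (c : ℂ) : eulerDer (PowerSeries.C c) = 0 := by
  ext n
  rw [coeff_eulerDer, PowerSeries.coeff_C]
  split_ifs with h <;> simp [h]

theorem eulerDer_X_pow (m : ℕ) :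
    eulerDer ((PowerSeries.X : PowerSeries ℂ) ^ m) = PowerSeries.C (m : ℂ) * PowerSeries.X ^ m := by
  ext n
  rw [coeff_eulerDer, PowerSeries.coeff_C_mul, PowerSeries.coeff_X_pow]
  split_ifs with h <;> simp [h]

/-- The monomial `c τⁿ Uˡ`. -/
def psTerm (c : ℂ) (n l : ℕ) (U : PowerSeries ℂ) : PowerSeries ℂ :=
  PowerSeries.C c * PowerSeries.X ^ n * U ^ l

theorem eulerDer_psTerm (c : ℂ) (n l : ℕ) {U u : PowerSeries ℂ} (hu : eulerDer U = u * U) :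
    eulerDer (psTerm c n l U) =
      (PowerSeries.C (n : ℂ) + PowerSeries.C (l : ℂ) * u) * psTerm c n l U := by
  have h1 : eulerDer (U ^ l) = PowerSeries.C (l : ℂ) * u * U ^ l := by
    induction l with
    | zero => simp [eulerDer.map_one_eq_zero]
    | succ l ih =>
      rw [pow_succ, Derivation.leibniz, ih, hu]
      simp only [smul_eq_mul, Nat.cast_succ, map_add, map_one]
      ring
  simp only [psTerm, Derivation.leibniz, smul_eq_mul, h1, eulerDer_C, eulerDer_X_pow]
  ring

section Hessian

variable {ι : Type*} [Fintype ι]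

/-- The form `e₂₀ e₀₁² - 2 e₁₁ e₁₀ e₀₁ + e₀₂ e₁₀²`, where `e` are the factorial moments of the
family `t` with exponents `(i, j)`; it cuts out the inflection points. -/
def flexForm {S : Type*} [CommRing S] (i j : ι → ℕ) (t : ι → S) : S :=
  (∑ k, (i k : S) * ((i k : S) - 1) * t k) * (∑ k, (j k : S) * t k) ^ 2
    - 2 * (∑ k, (i k : S) * (j k : S) * t k) * (∑ k, (i k : S) * t k) * (∑ k, (j k : S) * t k)
    + (∑ k, (j k : S) * ((j k : S) - 1) * t k) * (∑ k, (i k : S) * t k) ^ 2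

theorem flexForm_map {S S' : Type*} [CommRing S] [CommRing S'] (φ : S →+* S') (i j : ι → ℕ)
    (t : ι → S) : flexForm i j (fun k => φ (t k)) = φ (flexForm i j t) := by
  simp [flexForm, map_ofNat φ 2]

theorem flexForm_mul {S : Type*} [CommRing S] (c : S) (i j : ι → ℕ)
    (t : ι → S) : flexForm i j (fun k => c * t k) = c ^ 3 * flexForm i j t := by
  have h (g : ι → S) : ∑ k, g k * (c * t k) = c * ∑ k, g k * t k := by
    rw [Finset.mul_sum]
    exact Finset.sum_congr rfl fun k _ => by ring
  simp only [flexForm, h]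
  ring

/-- The flex form along a branch: it is determined by the logarithmic derivatives of the
coordinates. -/
theorem flexForm_branch {R S : Type*} [CommRing R] [CommRing S] [Algebra R S]
    (θ : Derivation R S S) (i j : ι → ℕ) (t : ι → S)
    (s : ℕ) (μ u A B γ : S) (hμ : θ μ = 0) (hA : θ A = 0) (hB : θ B = 0) (hAB : A = μ + s * B)
    (hθ : ∀ k, θ (t k) = ((A + s * u) * i k + (B + u) * j k - γ) * t k)
    (ht : ∑ k, t k = 0) :
    μ ^ 3 * flexForm i j t = - (∑ k, ((s * i k + j k : ℕ) : S) * t k) ^ 3 *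
      ((A + s * u) * (B + u) * (B - A + (1 - s) * u) + μ * θ u) := by
  set a := A + s * u with ha
  set b := B + u with hb
  have hn (n : ℕ) : θ (n : S) = 0 := by simp
  have hcast (n : ℕ) (x : S) : θ (n * x) = n * θ x := by
    rw [Derivation.leibniz, hn]; simp
  set m10 := ∑ k, (i k : S) * t k with hm10
  set m01 := ∑ k, (j k : S) * t k with hm01
  set m20 := ∑ k, (i k : S) * (i k : S) * t k with hm20
  set m11 := ∑ k, (i k : S) * (j k : S) * t k with hm11
  set m02 := ∑ k, (j k : S) * (j k : S) * t k with hm02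
  set L := ∑ k, ((s * i k + j k : ℕ) : S) * t k with hL
  have e20 : ∑ k, (i k : S) * ((i k : S) - 1) * t k = m20 - m10 := by
    rw [hm20, hm10, ← Finset.sum_sub_distrib]
    exact Finset.sum_congr rfl fun k _ => by ring
  have e02 : ∑ k, (j k : S) * ((j k : S) - 1) * t k = m02 - m01 := by
    rw [hm02, hm01, ← Finset.sum_sub_distrib]
    exact Finset.sum_congr rfl fun k _ => by ring
  have hLe : L = s * m10 + m01 := by
    rw [hL, hm10, hm01, Finset.mul_sum, ← Finset.sum_add_distrib]
    exact Finset.sum_congr rfl fun k _ => by push_cast; ring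
  have h0 : a * m10 + b * m01 = 0 := by
    have := congrArg θ ht
    rw [map_zero, map_sum] at this
    rw [← this, ← sub_zero (a * m10 + b * m01), ← mul_zero γ, ← ht, hm10, hm01, Finset.mul_sum,
      Finset.mul_sum, Finset.mul_sum, ← Finset.sum_add_distrib, ← Finset.sum_sub_distrib]
    exact Finset.sum_congr rfl fun k _ => by rw [hθ]; ring
  have h1 : θ m10 = a * m20 + b * m11 - γ * m10 := by
    rw [hm10, map_sum, hm20, hm11, Finset.mul_sum, Finset.mul_sum, Finset.mul_sum,
      ← Finset.sum_add_distrib, ← Finset.sum_sub_distrib]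
    exact Finset.sum_congr rfl fun k _ => by rw [hcast, hθ]; ring
  have h2 : θ m01 = a * m11 + b * m02 - γ * m01 := by
    rw [hm01, map_sum, hm02, hm11, Finset.mul_sum, Finset.mul_sum, Finset.mul_sum,
      ← Finset.sum_add_distrib, ← Finset.sum_sub_distrib]
    exact Finset.sum_congr rfl fun k _ => by rw [hcast, hθ]; ring
  have hab : a = μ + s * b := by rw [ha, hb, hAB]; ring
  have k10 : μ * m10 = - (b * L) := by
    rw [hLe]; linear_combination h0 - hab * m10
  have k01 : μ * m01 = a * L := by
    rw [hLe]; linear_combination (-s) * h0 - hab * m01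
  have d10 : μ * θ m10 = - (b * θ L + L * θ b) := by
    have := congrArg θ k10
    simpa [Derivation.leibniz, hμ] using this
  have d01 : μ * θ m01 = a * θ L + L * θ a := by
    have := congrArg θ k01
    simpa [Derivation.leibniz, hμ] using this
  have da : θ a = s * θ u := by rw [ha, map_add, hA, hcast]; ring
  have db : θ b = θ u := by rw [hb, map_add, hB]; ring
  have hω : B - A + (1 - s) * u = b - a := by rw [ha, hb]; ring
  rw [hω, flexForm, e20, e02, ← hm10, ← hm01, ← hm11]
  have step1 : μ ^ 3 * ((m20 - m10) * m01 ^ 2 - 2 * m11 * m10 * m01 + (m02 - m01) * m10 ^ 2)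
      = L ^ 2 * (a * (μ * θ m10) + b * (μ * θ m01) - a ^ 2 * (μ * m10) - b ^ 2 * (μ * m01)) := by
    have : μ ^ 3 * ((m20 - m10) * m01 ^ 2 - 2 * m11 * m10 * m01 + (m02 - m01) * m10 ^ 2) =
      μ * ((m20 - m10) * (μ * m01) ^ 2 - 2 * m11 * (μ * m10) * (μ * m01)
        + (m02 - m01) * (μ * m10) ^ 2) := by ring
    rw [this, k10, k01, h1, h2]
    linear_combination (-L ^ 2 * a ^ 2) * k10 + (-L ^ 2 * b ^ 2) * k01 + L ^ 2 * μ * γ * h0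
  rw [step1, d10, d01, k10, k01, da, db]
  linear_combination (L ^ 3 * θ u) * (-hab)

end Hessian

section Branch

/-- A unit power series. -/
theorem exists_mul_eq_one_of_constantCoeff_ne_zero {L : PowerSeries ℂ}
    (h : PowerSeries.constantCoeff L ≠ 0) : ∃ L', L * L' = 1 :=
  ⟨L⁻¹, PowerSeries.mul_inv_cancel L h⟩

theorem pow_sub_pow_linear_dvd (ζ α : ℂ) (m : ℕ) (hm : 0 < m) {U : PowerSeries ℂ}
    (hU : PowerSeries.X ^ (m + 1) ∣
      U - PowerSeries.C ζ * (1 + PowerSeries.C α * PowerSeries.X ^ m)) (l : ℕ) :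
    PowerSeries.X ^ (m + 1) ∣
      U ^ l - PowerSeries.C (ζ ^ l) * (1 + PowerSeries.C (l * α) * PowerSeries.X ^ m) := by
  induction l with
  | zero => simp
  | succ l ih =>
    obtain ⟨R, hR⟩ := ih
    obtain ⟨R', hR'⟩ := hU
    obtain ⟨m, rfl⟩ : ∃ m', m = m' + 1 := ⟨m - 1, by omega⟩
    refine ⟨U * R + PowerSeries.C (ζ ^ l) *
      (1 + PowerSeries.C (l * α) * PowerSeries.X ^ (m + 1)) * R'
      + PowerSeries.C (ζ ^ (l + 1) * l * α * α) * PowerSeries.X ^ m, ?_⟩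
    simp only [map_mul, map_pow, Nat.cast_succ, map_add, map_one] at hR hR' ⊢
    linear_combination U * hR + PowerSeries.C ζ ^ l *
      (1 + PowerSeries.C (l : ℂ) * PowerSeries.C α * PowerSeries.X ^ (m + 1)) * hR'

variable {ι : Type*} [Fintype ι]

theorem psTerm_dvd (a ζ α : ℂ) (m : ℕ) (hm : 0 < m) {U : PowerSeries ℂ}
    (hU : PowerSeries.X ^ (m + 1) ∣
      U - PowerSeries.C ζ * (1 + PowerSeries.C α * PowerSeries.X ^ m)) (d l : ℕ) :
    PowerSeries.X ^ (m + 1) ∣ psTerm a (m * d) l U -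
      (PowerSeries.C (if d = 0 then a * ζ ^ l else 0) + PowerSeries.C
        ((if d = 0 then l * α * (a * ζ ^ l) else 0) + (if d = 1 then a * ζ ^ l else 0)) *
          PowerSeries.X ^ m) := by
  obtain ⟨R, hR⟩ := pow_sub_pow_linear_dvd ζ α m hm hU l
  obtain ⟨m, rfl⟩ : ∃ m', m = m' + 1 := ⟨m - 1, by omega⟩
  rcases d with - | - | d
  · refine ⟨PowerSeries.C a * R, ?_⟩
    simp only [psTerm, if_true, map_mul, map_pow, map_add] at hR ⊢
    simp only [mul_zero, pow_zero, mul_one, zero_ne_one, if_false, map_zero, add_zero]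
    linear_combination PowerSeries.C a * hR
  · refine ⟨PowerSeries.C a * R * PowerSeries.X ^ (m + 1) +
      PowerSeries.C (a * l * α * ζ ^ l) * PowerSeries.X ^ m, ?_⟩
    simp only [psTerm, zero_add, if_true, map_mul, map_pow, one_ne_zero, if_false,
      mul_one, map_zero] at hR ⊢
    linear_combination PowerSeries.C a * PowerSeries.X ^ (m + 1) * hR
  · refine ⟨PowerSeries.C a * U ^ l * PowerSeries.X ^ (m + (m + 1) * d), ?_⟩
    have : d + 1 + 1 ≠ 1 := by omega
    simp only [psTerm, this, if_false, Nat.add_eq_zero_iff, one_ne_zero, and_false, map_zero,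
      add_zero, zero_mul, sub_zero]
    ring

/-- The expansion of the logarithmic derivative `u` of a branch `U` all of whose exponents are
multiples of `m`. -/
theorem logDeriv_expansion (a : ι → ℂ) (d l : ι → ℕ) (m : ℕ) (hm : 0 < m) {U u : PowerSeries ℂ}
    (hu : eulerDer U = u * U) (h0 : ∑ k, psTerm (a k) (m * d k) (l k) U = 0) {ζ : ℂ}
    (hζ : PowerSeries.constantCoeff U = ζ)
    (hs : ∑ k, (if d k = 0 then l k * (a k * ζ ^ l k) else 0) ≠ 0) :
    ∃ (α v₁ : ℂ) (R : PowerSeries ℂ),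
      u = PowerSeries.X ^ m * (PowerSeries.C (m * α) + PowerSeries.X ^ m * R) ∧
      PowerSeries.constantCoeff R = v₁ ∧
      (∑ k, (if d k = 0 then l k * (a k * ζ ^ l k) else 0)) * α
        + (∑ k, if d k = 1 then a k * ζ ^ l k else 0) = 0 ∧
      v₁ * (∑ k, (if d k = 0 then l k * (a k * ζ ^ l k) else 0)) =
        - m * (α * α * (∑ k, (if d k = 0 then l k * l k * (a k * ζ ^ l k) else 0))
          + 2 * α * (∑ k, (if d k = 1 then l k * (a k * ζ ^ l k) else 0))
          + 2 * (∑ k, if d k = 2 then a k * ζ ^ l k else 0)) := by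
  set s01 := ∑ k, (if d k = 0 then l k * (a k * ζ ^ l k) else 0) with hs01
  set s10 := ∑ k, (if d k = 1 then a k * ζ ^ l k else 0) with hs10
  set s02 := ∑ k, (if d k = 0 then l k * l k * (a k * ζ ^ l k) else 0) with hs02
  set s11 := ∑ k, (if d k = 1 then l k * (a k * ζ ^ l k) else 0) with hs11
  set s20 := ∑ k, (if d k = 2 then a k * ζ ^ l k else 0) with hs20
  have hm0 : (m : ℂ) ≠ 0 := by exact_mod_cast hm.ne'
  set L := ∑ k, PowerSeries.C (l k : ℂ) * psTerm (a k) (m * d k) (l k) U with hL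
  set Q := ∑ k, PowerSeries.C (d k : ℂ) * psTerm (a k) (m * (d k - 1)) (l k) U with hQ
  have e1 : u * L = - PowerSeries.C (m : ℂ) * PowerSeries.X ^ m * Q := by
    have h := congrArg eulerDer h0
    rw [map_zero, map_sum] at h
    rw [eq_comm, ← sub_eq_zero, hL, hQ, Finset.mul_sum, Finset.mul_sum,
      ← Finset.sum_sub_distrib, ← neg_eq_zero, ← h, ← Finset.sum_neg_distrib]
    refine Finset.sum_congr rfl fun k _ => ?_
    rw [eulerDer_psTerm _ _ _ hu]
    rcases hd : d k with - | e
    · simp; ring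
    · simp only [psTerm, Nat.add_sub_cancel, Nat.cast_mul, map_mul, Nat.cast_succ, map_add, map_one]
      ring
  have hL0 : PowerSeries.constantCoeff L = s01 := by
    rw [hL, hs01, map_sum]
    refine Finset.sum_congr rfl fun k _ => ?_
    split_ifs with h
    · simp [psTerm, h, hζ]
    · simp [psTerm, h, hm.ne']
  have hQ0 : PowerSeries.constantCoeff Q = s10 := by
    rw [hQ, hs10, map_sum]
    refine Finset.sum_congr rfl fun k _ => ?_
    split_ifs with h
    · simp [psTerm, h, hζ]
    · rcases hd : d k with - | - | e
      · simp
      · omega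
      · simp [psTerm, hm.ne']
  obtain ⟨L', hL'⟩ := exists_mul_eq_one_of_constantCoeff_ne_zero (L := L) (by rwa [hL0])
  set v := - PowerSeries.C (m : ℂ) * Q * L' with hv
  have huv : u = PowerSeries.X ^ m * v := by
    rw [hv]
    linear_combination (-u) * hL' + L' * e1
  have hvL : v * L = - PowerSeries.C (m : ℂ) * Q := by
    rw [hv]
    linear_combination (- PowerSeries.C (m : ℂ) * Q) * hL'
  set α := PowerSeries.constantCoeff v / m with hα
  have hv0 : PowerSeries.constantCoeff v = m * α := by rw [hα]; field_simp
  have e2 : s01 * α + s10 = 0 := by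
    have := congrArg PowerSeries.constantCoeff hvL
    simp only [map_mul, map_neg, hv0, hL0, hQ0, PowerSeries.constantCoeff_C] at this
    apply mul_left_cancel₀ hm0
    linear_combination this
  have hUα : PowerSeries.X ^ (m + 1) ∣
      U - PowerSeries.C ζ * (1 + PowerSeries.C α * PowerSeries.X ^ m) := by
    rw [PowerSeries.X_pow_dvd_iff]
    intro n hn
    have hco := congrArg (PowerSeries.coeff n) hu
    rw [coeff_eulerDer, huv, mul_assoc, PowerSeries.coeff_X_pow_mul'] at hco
    have h1 : PowerSeries.coeff n (PowerSeries.C ζ * (1 + PowerSeries.C α * PowerSeries.X ^ m)) =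
        (if n = 0 then ζ else 0) + (if n = m then ζ * α else 0) := by
      rw [mul_add, mul_one, ← mul_assoc, ← map_mul, map_add, PowerSeries.coeff_C,
        PowerSeries.coeff_C_mul_X_pow]
    rw [map_sub, h1]
    rcases Nat.eq_zero_or_pos n with rfl | hn0
    · simp [hm.ne, hζ]
    · have hn0' : (n : ℂ) ≠ 0 := by exact_mod_cast hn0.ne'
      rcases lt_or_eq_of_le (Nat.lt_succ_iff.1 hn) with hlt | rfl
      · rw [if_neg (by omega)] at hco
        have : PowerSeries.coeff n U = 0 := by
          rcases mul_eq_zero.1 hco with h | h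
          · exact absurd h hn0'
          · exact h
        rw [this, if_neg hn0.ne', if_neg hlt.ne]; simp
      · simp only [le_refl, if_true, Nat.sub_self, PowerSeries.coeff_zero_eq_constantCoeff, map_mul,
          hv0, hζ] at hco
        rw [if_neg hn0.ne', if_pos rfl]
        have : PowerSeries.coeff n U = ζ * α := by
          apply mul_left_cancel₀ hn0'
          linear_combination hco
        rw [this]; ring
  -- expansions of `L` and `Q` modulo `X ^ (m + 1)`
  have hLexp : PowerSeries.X ^ (m + 1) ∣ L - (PowerSeries.C s01 +
      PowerSeries.C (α * s02 + s11) * PowerSeries.X ^ m) := by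
    have : L - (PowerSeries.C s01 + PowerSeries.C (α * s02 + s11) * PowerSeries.X ^ m) =
        ∑ k, PowerSeries.C (l k : ℂ) * (psTerm (a k) (m * d k) (l k) U -
      (PowerSeries.C (if d k = 0 then a k * ζ ^ l k else 0) + PowerSeries.C
        ((if d k = 0 then l k * α * (a k * ζ ^ l k) else 0) +
          (if d k = 1 then a k * ζ ^ l k else 0)) * PowerSeries.X ^ m)) := by
      simp only [mul_sub, Finset.sum_sub_distrib, ← hL, mul_add, Finset.sum_add_distrib]
      congr 1
      rw [hs01, hs02, hs11]
      simp only [← mul_assoc, ← Finset.sum_mul, ← map_mul, ← map_sum]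
      congr 2
      · congr 1
        funext k
        split_ifs <;> ring
      · congr 1
        rw [Finset.mul_sum, ← Finset.sum_add_distrib]
        exact Finset.sum_congr rfl fun k _ => by split_ifs <;> ring
    rw [this]
    exact Finset.dvd_sum fun k _ => Dvd.dvd.mul_left (psTerm_dvd _ _ _ _ hm hUα _ _) _
  have hQexp : PowerSeries.X ^ (m + 1) ∣ Q - (PowerSeries.C s10 +
      PowerSeries.C (α * s11 + 2 * s20) * PowerSeries.X ^ m) := by
    have : Q - (PowerSeries.C s10 + PowerSeries.C (α * s11 + 2 * s20) * PowerSeries.X ^ m) =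
        ∑ k, PowerSeries.C (d k : ℂ) * (psTerm (a k) (m * (d k - 1)) (l k) U -
      (PowerSeries.C (if d k - 1 = 0 then a k * ζ ^ l k else 0) + PowerSeries.C
        ((if d k - 1 = 0 then l k * α * (a k * ζ ^ l k) else 0) +
          (if d k - 1 = 1 then a k * ζ ^ l k else 0)) * PowerSeries.X ^ m)) := by
      simp only [mul_sub, Finset.sum_sub_distrib, ← hQ, mul_add, Finset.sum_add_distrib]
      congr 1
      rw [hs10, hs20, hs11]
      simp only [← mul_assoc, ← Finset.sum_mul, ← map_mul, ← map_sum]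
      have key (k : ι) : (d k : ℂ) * (if d k - 1 = 0 then a k * ζ ^ l k else 0) =
          if d k = 1 then a k * ζ ^ l k else 0 := by
        rcases d k with - | - | e <;> simp
      have key2 (k : ι) : (d k : ℂ) * ((if d k - 1 = 0 then l k * α * (a k * ζ ^ l k) else 0) +
          (if d k - 1 = 1 then a k * ζ ^ l k else 0)) =
          α * (if d k = 1 then l k * (a k * ζ ^ l k) else 0) +
            2 * if d k = 2 then a k * ζ ^ l k else 0 := by
        rcases d k with - | - | - | e <;> simp
        ring
      simp only [mul_assoc, mul_add] at key key2 ⊢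
      simp only [key, ← Finset.sum_add_distrib, key2, Finset.mul_sum]
    rw [this]
    exact Finset.dvd_sum fun k _ => Dvd.dvd.mul_left (psTerm_dvd _ _ _ _ hm hUα _ _) _
  have hXm : (PowerSeries.X : PowerSeries ℂ) ^ m ≠ 0 := pow_ne_zero _ PowerSeries.X_ne_zero
  obtain ⟨RL, hRL⟩ := hLexp
  obtain ⟨RQ, hRQ⟩ := hQexp
  rw [sub_eq_iff_eq_add] at hRL hRQ
  have e2C : PowerSeries.C s01 * PowerSeries.C α + PowerSeries.C s10 = 0 := by
    rw [← map_mul, ← map_add, e2, map_zero]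
  set W : PowerSeries ℂ := - PowerSeries.C (m : ℂ) *
    (PowerSeries.X * RQ + PowerSeries.C (α * s11 + 2 * s20)) -
    PowerSeries.C (m * α) * (PowerSeries.X * RL + PowerSeries.C (α * s02 + s11)) with hW
  have hRW : v = PowerSeries.C (m * α) + PowerSeries.X ^ m * (L' * W) := by
    have h1 : (v - PowerSeries.C (m * α)) * L = PowerSeries.X ^ m * W := by
      rw [sub_mul, hvL, hW]
      nth_rewrite 1 [hRQ]
      nth_rewrite 1 [hRL]
      simp only [map_mul]
      linear_combination (-PowerSeries.C (m : ℂ)) * e2C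
    linear_combination (-(v - PowerSeries.C (m * α))) * hL' + L' * h1
  refine ⟨α, PowerSeries.constantCoeff (L' * W), L' * W, by rw [huv, hRW], rfl, e2, ?_⟩
  have h2 : L' * W * L = W := by linear_combination W * hL'
  have h3 := congrArg PowerSeries.constantCoeff h2
  rw [map_mul, hL0] at h3
  rw [h3, hW]
  simp
  ring

end Branch

section Local

variable {ι : Type*} [Fintype ι]

theorem eulerDer_eq_logDeriv_mul {U : PowerSeries ℂ} (h : PowerSeries.constantCoeff U ≠ 0) :
    eulerDer U = (eulerDer U * U⁻¹) * U := by
  rw [mul_assoc, PowerSeries.inv_mul_cancel U h, mul_one]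

/-- The flex form along a branch, expressed by the logarithmic derivative of the branch. -/
theorem flexForm_psTerm (a : ι → ℂ) (i j n : ι → ℕ) (s : ℕ) (e B g : ℤ)
    (hn : ∀ k, (n k : ℤ) = e * i k + B * (s * i k + j k : ℕ) - g) {U u : PowerSeries ℂ}
    (hu : eulerDer U = u * U)
    (h0 : ∑ k, psTerm (a k) (n k) (s * i k + j k) U = 0) :
    PowerSeries.C (e : ℂ) ^ 3 * flexForm i j (fun k => psTerm (a k) (n k) (s * i k + j k) U) =
      - (∑ k, ((s * i k + j k : ℕ) : PowerSeries ℂ) * psTerm (a k) (n k) (s * i k + j k) U) ^ 3 *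
      ((PowerSeries.C ((e + s * B : ℤ) : ℂ) + (s : PowerSeries ℂ) * u) *
          (PowerSeries.C (B : ℂ) + u) *
        (PowerSeries.C (B : ℂ) - PowerSeries.C ((e + s * B : ℤ) : ℂ) +
            (1 - (s : PowerSeries ℂ)) * u) +
        PowerSeries.C (e : ℂ) * eulerDer u) := by
  have hA : PowerSeries.C ((e + s * B : ℤ) : ℂ) =
      PowerSeries.C (e : ℂ) + (s : PowerSeries ℂ) * PowerSeries.C (B : ℂ) := by
    push_cast
    simp only [map_add, map_mul, map_natCast]
  have hC (c : ℂ) : eulerDer (PowerSeries.C c) = 0 := eulerDer_C c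
  refine flexForm_branch eulerDer i j
    (fun k => psTerm (a k) (n k) (s * i k + j k) U) s (PowerSeries.C (e : ℂ)) u
    (PowerSeries.C ((e + s * B : ℤ) : ℂ)) (PowerSeries.C (B : ℂ)) (PowerSeries.C (g : ℂ))
    (hC _) (hC _) (hC _) hA (fun k => ?_) h0
  refine (eulerDer_psTerm (a k) (n k) (s * i k + j k) hu).trans ?_
  have h1 : ((n k : ℕ) : ℂ) = e * i k + B * (s * i k + j k) - g := by
    have := congrArg (Int.cast : ℤ → ℂ) (hn k)
    push_cast at this
    exact this
  rw [h1]
  push_cast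
  simp only [map_add, map_sub, map_mul, map_natCast]
  ring

theorem constantCoeff_weighted_sum (a : ι → ℂ) (n l : ι → ℕ) (U : PowerSeries ℂ) :
    PowerSeries.constantCoeff (∑ k, (l k : PowerSeries ℂ) * psTerm (a k) (n k) (l k) U) =
      ∑ k, if n k = 0 then l k * (a k * PowerSeries.constantCoeff U ^ l k) else 0 := by
  rw [map_sum]
  refine Finset.sum_congr rfl fun k _ => ?_
  split_ifs with h <;> simp [psTerm, h]

/-- If the logarithmic form `ω` of a branch is `τ ^ r` times a unit, then so is the flex form. -/
theorem flexForm_psTerm_eq_of_form (a : ι → ℂ) (i j n : ι → ℕ) (s : ℕ) (e B g : ℤ) (he : e ≠ 0)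
    (hn : ∀ k, (n k : ℤ) = e * i k + B * (s * i k + j k : ℕ) - g) {U u : PowerSeries ℂ}
    (hu : eulerDer U = u * U)
    (h0 : ∑ k, psTerm (a k) (n k) (s * i k + j k) U = 0)
    (hs : ∑ k, (if n k = 0 then ((s * i k + j k : ℕ) : ℂ) *
      (a k * PowerSeries.constantCoeff U ^ (s * i k + j k)) else 0) ≠ 0) (r : ℕ)
    (V : PowerSeries ℂ) (hV : PowerSeries.constantCoeff V ≠ 0)
    (hω : (PowerSeries.C ((e + s * B : ℤ) : ℂ) + (s : PowerSeries ℂ) * u) *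
        (PowerSeries.C (B : ℂ) + u) *
        (PowerSeries.C (B : ℂ) - PowerSeries.C ((e + s * B : ℤ) : ℂ) +
            (1 - (s : PowerSeries ℂ)) * u) +
        PowerSeries.C (e : ℂ) * eulerDer u = PowerSeries.X ^ r * V) :
    ∃ W : PowerSeries ℂ, PowerSeries.constantCoeff W ≠ 0 ∧
      flexForm i j (fun k => psTerm (a k) (n k) (s * i k + j k) U) = PowerSeries.X ^ r * W := by
  have h := flexForm_psTerm a i j n s e B g hn hu h0
  rw [hω] at h
  set L := ∑ k, ((s * i k + j k : ℕ) : PowerSeries ℂ) * psTerm (a k) (n k) (s * i k + j k) U with hL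
  have hLc : PowerSeries.constantCoeff L ≠ 0 := by
    rw [hL, constantCoeff_weighted_sum a n (fun k => s * i k + j k)]
    exact hs
  have he' : (e : ℂ) ≠ 0 := by exact_mod_cast he
  refine ⟨- (PowerSeries.C ((e : ℂ)⁻¹)) ^ 3 * L ^ 3 * V, ?_, ?_⟩
  · simp only [map_mul, map_neg, map_pow, PowerSeries.constantCoeff_C]
    exact mul_ne_zero (mul_ne_zero (neg_ne_zero.2 (pow_ne_zero _ (inv_ne_zero he')))
      (pow_ne_zero _ hLc)) hV
  · have h1 : PowerSeries.C ((e : ℂ)⁻¹) * PowerSeries.C (e : ℂ) = 1 := by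
      rw [← map_mul, inv_mul_cancel₀ he', map_one]
    have h2 : PowerSeries.C ((e : ℂ)⁻¹) ^ 3 * PowerSeries.C (e : ℂ) ^ 3 = 1 := by
      rw [← mul_pow, h1, one_pow]
    linear_combination (PowerSeries.C ((e : ℂ)⁻¹)) ^ 3 * h - flexForm i j
      (fun k => psTerm (a k) (n k) (s * i k + j k) U) * h2

theorem flexForm_psTerm_ordinary (a : ι → ℂ) (i j n : ι → ℕ) (s : ℕ) (e B g : ℤ) (he : e ≠ 0)
    (hn : ∀ k, (n k : ℤ) = e * i k + B * (s * i k + j k : ℕ) - g) {U : PowerSeries ℂ}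
    (hU : PowerSeries.constantCoeff U ≠ 0)
    (h0 : ∑ k, psTerm (a k) (n k) (s * i k + j k) U = 0)
    (hs : ∑ k, (if n k = 0 then ((s * i k + j k : ℕ) : ℂ) *
      (a k * PowerSeries.constantCoeff U ^ (s * i k + j k)) else 0) ≠ 0)
    (h1 : B ≠ 0) (h2 : e + s * B ≠ 0) (h3 : e + s * B ≠ B) :
    ∃ W : PowerSeries ℂ, PowerSeries.constantCoeff W ≠ 0 ∧
      flexForm i j (fun k => psTerm (a k) (n k) (s * i k + j k) U) = W := by
  have hu := eulerDer_eq_logDeriv_mul hU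
  set u := eulerDer U * U⁻¹
  have huc : PowerSeries.constantCoeff u = 0 := by
    simp [u, constantCoeff_eulerDer]
  refine (flexForm_psTerm_eq_of_form a i j n s e B g he hn hu h0 hs 0 _ ?_
    (by rw [pow_zero, one_mul])).imp fun W h => ⟨h.1, by rw [h.2, pow_zero, one_mul]⟩
  simp only [map_add, map_mul, map_sub, PowerSeries.constantCoeff_C, huc, map_natCast, mul_zero,
    add_zero, constantCoeff_eulerDer]
  have hsub : B - (e + s * B) ≠ 0 := sub_ne_zero.2 h3.symm
  exact_mod_cast mul_ne_zero (mul_ne_zero h2 h1) hsub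

/-- A branch along an edge one of whose neighbouring levels contributes to first order. -/
theorem flexForm_psTerm_first_order (a : ι → ℂ) (i j d : ι → ℕ) (s m : ℕ) (e B g : ℤ)
    (he : e ≠ 0) (hm : 0 < m)
    (hn : ∀ k, ((m * d k : ℕ) : ℤ) = e * i k + B * (s * i k + j k : ℕ) - g) {U : PowerSeries ℂ}
    (hU : PowerSeries.constantCoeff U ≠ 0)
    (h0 : ∑ k, psTerm (a k) (m * d k) (s * i k + j k) U = 0)
    (hs : ∑ k, (if d k = 0 then ((s * i k + j k : ℕ) : ℂ) *
      (a k * PowerSeries.constantCoeff U ^ (s * i k + j k)) else 0) ≠ 0)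
    (N c c' : ℂ) (hN : N ≠ 0)
    (hω : ∀ u w : PowerSeries ℂ,
      (PowerSeries.C ((e + s * B : ℤ) : ℂ) + (s : PowerSeries ℂ) * u) *
          (PowerSeries.C (B : ℂ) + u) *
        (PowerSeries.C (B : ℂ) - PowerSeries.C ((e + s * B : ℤ) : ℂ) +
            (1 - (s : PowerSeries ℂ)) * u) +
        PowerSeries.C (e : ℂ) * w =
      PowerSeries.C N * (w + PowerSeries.C (m : ℂ) * u + PowerSeries.C c * u ^ 2)
        + PowerSeries.C c' * u ^ 3)
    (hg : ∑ k, (if d k = 1 then a k * PowerSeries.constantCoeff U ^ (s * i k + j k) else 0) ≠ 0) :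
    ∃ W : PowerSeries ℂ, PowerSeries.constantCoeff W ≠ 0 ∧
      flexForm i j (fun k => psTerm (a k) (m * d k) (s * i k + j k) U) = PowerSeries.X ^ m * W := by
  have hu := eulerDer_eq_logDeriv_mul hU
  set u := eulerDer U * U⁻¹
  obtain ⟨α, v₁, R, huR, hR, hα, -⟩ := logDeriv_expansion a d (fun k => s * i k + j k) m hm hu h0
    rfl hs
  have hm0 : (m : ℂ) ≠ 0 := by exact_mod_cast hm.ne'
  refine flexForm_psTerm_eq_of_form a i j (fun k => m * d k) s e B g he hn hu h0 ?_ m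
    (V := PowerSeries.C N * (PowerSeries.C (2 * m * (m * α)) +
      PowerSeries.X ^ m * (3 * PowerSeries.C (m : ℂ) * R + eulerDer R +
        PowerSeries.C c * (PowerSeries.C (m * α) + PowerSeries.X ^ m * R) ^ 2))
      + PowerSeries.C c' * PowerSeries.X ^ (2 * m) *
        (PowerSeries.C (m * α) + PowerSeries.X ^ m * R) ^ 3) ?_ ?_
  · simpa [hm.ne'] using hs
  · have hα0 : α ≠ 0 := by
      rintro rfl
      simp only [mul_zero, zero_add] at hα
      exact hg hα
    simp [hm.ne', hN, hα0]
  · rw [hω, huR]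
    simp only [Derivation.leibniz, map_add, eulerDer_C, eulerDer_X_pow, smul_eq_mul, map_mul,
      map_ofNat]
    ring

/-- A branch along an edge two of whose neighbouring levels contribute to second order. -/
theorem flexForm_psTerm_second_order (a : ι → ℂ) (i j d : ι → ℕ) (s m : ℕ) (e B g : ℤ)
    (he : e ≠ 0) (hm : 0 < m)
    (hn : ∀ k, ((m * d k : ℕ) : ℤ) = e * i k + B * (s * i k + j k : ℕ) - g) {U : PowerSeries ℂ}
    (hU : PowerSeries.constantCoeff U ≠ 0)
    (h0 : ∑ k, psTerm (a k) (m * d k) (s * i k + j k) U = 0)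
    (hs : ∑ k, (if d k = 0 then ((s * i k + j k : ℕ) : ℂ) *
      (a k * PowerSeries.constantCoeff U ^ (s * i k + j k)) else 0) ≠ 0)
    (N c c' : ℂ) (hN : N ≠ 0)
    (hω : ∀ u w : PowerSeries ℂ,
      (PowerSeries.C ((e + s * B : ℤ) : ℂ) + (s : PowerSeries ℂ) * u) *
          (PowerSeries.C (B : ℂ) + u) *
        (PowerSeries.C (B : ℂ) - PowerSeries.C ((e + s * B : ℤ) : ℂ) +
            (1 - (s : PowerSeries ℂ)) * u) +
        PowerSeries.C (e : ℂ) * w =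
      PowerSeries.C N * (w - PowerSeries.C (m : ℂ) * u + PowerSeries.C c * u ^ 2)
        + PowerSeries.C c' * u ^ 3)
    (hg : ∀ α : ℂ,
      (∑ k, (if d k = 0 then ((s * i k + j k : ℕ) : ℂ) *
        (a k * PowerSeries.constantCoeff U ^ (s * i k + j k)) else 0)) * α +
        (∑ k, (if d k = 1 then a k * PowerSeries.constantCoeff U ^ (s * i k + j k) else 0)) = 0 →
      α * α * (∑ k, (if d k = 0 then
          ((s * i k + j k : ℕ) : ℂ) * ((s * i k + j k : ℕ) : ℂ) *
            (a k * PowerSeries.constantCoeff U ^ (s * i k + j k)) else 0))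
        - c * α * α * (∑ k, (if d k = 0 then ((s * i k + j k : ℕ) : ℂ) *
            (a k * PowerSeries.constantCoeff U ^ (s * i k + j k)) else 0))
        + 2 * α * (∑ k, (if d k = 1 then ((s * i k + j k : ℕ) : ℂ) *
            (a k * PowerSeries.constantCoeff U ^ (s * i k + j k)) else 0))
        + 2 * (∑ k, (if d k = 2 then a k * PowerSeries.constantCoeff U ^ (s * i k + j k) else 0))
          ≠ 0) :
    ∃ W : PowerSeries ℂ, PowerSeries.constantCoeff W ≠ 0 ∧
      flexForm i j (fun k => psTerm (a k) (m * d k) (s * i k + j k) U) =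
        PowerSeries.X ^ (2 * m) * W := by
  have hu := eulerDer_eq_logDeriv_mul hU
  set u := eulerDer U * U⁻¹
  obtain ⟨α, v₁, R, huR, hR, hα, hv₁⟩ := logDeriv_expansion a d (fun k => s * i k + j k) m hm hu h0
    rfl hs
  have hm0 : (m : ℂ) ≠ 0 := by exact_mod_cast hm.ne'
  refine flexForm_psTerm_eq_of_form a i j (fun k => m * d k) s e B g he hn hu h0 ?_ (2 * m)
    (V := PowerSeries.C N * (PowerSeries.C (m : ℂ) * R + eulerDer R +
        PowerSeries.C c * (PowerSeries.C (m * α) + PowerSeries.X ^ m * R) ^ 2)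
      + PowerSeries.C c' * PowerSeries.X ^ m *
        (PowerSeries.C (m * α) + PowerSeries.X ^ m * R) ^ 3) ?_ ?_
  · simpa [hm.ne'] using hs
  · simp only [map_add, map_mul, map_pow, PowerSeries.constantCoeff_C, PowerSeries.constantCoeff_X,
      zero_pow hm.ne', zero_mul, mul_zero, add_zero, constantCoeff_eulerDer, hR]
    refine mul_ne_zero hN fun h => hg α hα ?_
    set s01 := ∑ k, (if d k = 0 then ((s * i k + j k : ℕ) : ℂ) *
        (a k * PowerSeries.constantCoeff U ^ (s * i k + j k)) else 0)
    have h' := congrArg (· * s01) h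
    simp only [zero_mul] at h'
    apply mul_left_cancel₀ (mul_ne_zero hm0 hm0)
    linear_combination -h' + m * hv₁
  · rw [hω, huR]
    simp only [Derivation.leibniz, map_add, eulerDer_C, eulerDer_X_pow, smul_eq_mul, map_mul]
    ring

end Local

section Hensel

open PowerSeries in
/-- Hensel's lemma for a polynomial over `ℂ⟦τ⟧` that need not be monic. -/
theorem exists_root_of_simple_root (p : Polynomial (PowerSeries ℂ)) (ζ : ℂ)
    (h0 : constantCoeff (p.eval (PowerSeries.C ζ)) = 0)
    (h1 : constantCoeff (p.derivative.eval (PowerSeries.C ζ)) ≠ 0) :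
    ∃ U : PowerSeries ℂ, constantCoeff U = ζ ∧ p.eval U = 0 := by
  set δ := constantCoeff (p.derivative.eval (PowerSeries.C ζ)) with hδ
  let c : ℕ → PowerSeries ℂ := fun n =>
    Nat.rec (PowerSeries.C ζ) (fun _ b => b - p.eval b * PowerSeries.C δ⁻¹) n
  have hc (n : ℕ) : c (n + 1) = c n - p.eval (c n) * PowerSeries.C δ⁻¹ := rfl
  have hinv (n : ℕ) : (X : PowerSeries ℂ) ^ (n + 1) ∣ p.eval (c n) ∧ constantCoeff (c n) = ζ := by
    induction n with
    | zero => exact ⟨by rw [zero_add, pow_one, X_dvd_iff]; exact h0, by simp [c]⟩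
    | succ n ih =>
      obtain ⟨hd, hcc⟩ := ih
      have hpc : constantCoeff (p.eval (c n)) = 0 := by
        rw [← X_dvd_iff]
        exact (dvd_pow_self _ (Nat.succ_ne_zero n)).trans hd
      refine ⟨?_, by rw [hc, map_sub, map_mul, hpc, hcc, zero_mul, sub_zero]⟩
      obtain ⟨k, hk⟩ := p.binomExpansion (c n) (- (p.eval (c n) * PowerSeries.C δ⁻¹))
      rw [hc, sub_eq_add_neg, hk]
      have hX : (X : PowerSeries ℂ) ∣ 1 - p.derivative.eval (c n) * PowerSeries.C δ⁻¹ := by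
        have h2 : (X : PowerSeries ℂ) ∣ p.derivative.eval (c n) -
            p.derivative.eval (PowerSeries.C ζ) := by
          refine dvd_trans ?_ (p.derivative.sub_dvd_eval_sub (c n) (PowerSeries.C ζ))
          rw [X_dvd_iff]
          simp [hcc]
        rw [X_dvd_iff] at h2 ⊢
        rw [map_sub, sub_eq_zero] at h2
        rw [map_sub, map_mul, h2, ← hδ, map_one, PowerSeries.constantCoeff_C, mul_inv_cancel₀ h1,
          sub_self]
      have e : p.eval (c n) + p.derivative.eval (c n) * -(p.eval (c n) * PowerSeries.C δ⁻¹) +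
          k * (-(p.eval (c n) * PowerSeries.C δ⁻¹)) ^ 2 =
          p.eval (c n) * (1 - p.derivative.eval (c n) * PowerSeries.C δ⁻¹) +
          p.eval (c n) * p.eval (c n) * (k * PowerSeries.C δ⁻¹ ^ 2) := by ring
      rw [e, pow_succ (X : PowerSeries ℂ) (n + 1)]
      refine dvd_add (mul_dvd_mul hd hX) (Dvd.dvd.mul_right (mul_dvd_mul hd ?_) _)
      rwa [X_dvd_iff]
  have hstep (n r : ℕ) : (X : PowerSeries ℂ) ^ (n + 1) ∣ c (n + r) - c n := by
    induction r with
    | zero => simp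
    | succ r ih =>
      have : c (n + (r + 1)) - c n =
          (c (n + r) - c n) - p.eval (c (n + r)) * PowerSeries.C δ⁻¹ := by
        rw [← add_assoc, hc]; ring
      rw [this]
      exact dvd_sub ih (((pow_dvd_pow _ (by omega)).trans (hinv (n + r)).1).mul_right _)
  let U : PowerSeries ℂ := PowerSeries.mk fun n => coeff n (c n)
  have hU (n : ℕ) : (X : PowerSeries ℂ) ^ (n + 1) ∣ U - c n := by
    rw [X_pow_dvd_iff]
    intro r hr
    obtain ⟨q, rfl⟩ := Nat.exists_eq_add_of_le (Nat.lt_succ_iff.1 hr)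
    have := X_pow_dvd_iff.1 (hstep r q) r (by omega)
    rw [map_sub, sub_eq_zero] at this ⊢
    rw [this, coeff_mk]
  refine ⟨U, ?_, ?_⟩
  · have := hU 0
    rw [zero_add, pow_one, X_dvd_iff, map_sub, (hinv 0).2, sub_eq_zero] at this
    exact this
  · ext n
    have h2 : (X : PowerSeries ℂ) ^ (n + 1) ∣ p.eval U := by
      have := dvd_add ((hU n).trans (p.sub_dvd_eval_sub U (c n))) (hinv n).1
      rwa [sub_add_cancel] at this
    rw [map_zero]
    exact X_pow_dvd_iff.1 h2 n (by omega)

/-- A simple nonzero root of the initial form lifts to a branch. -/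
theorem exists_branch {ι : Type*} [Fintype ι] (a : ι → ℂ) (n l : ι → ℕ) (ζ : ℂ)
    (h0 : ∑ k, (if n k = 0 then a k * ζ ^ l k else 0) = 0)
    (h1 : ∑ k, (if n k = 0 then l k * (a k * ζ ^ l k) else 0) ≠ 0) :
    ∃ U : PowerSeries ℂ, PowerSeries.constantCoeff U = ζ ∧
      ∑ k, psTerm (a k) (n k) (l k) U = 0 := by
  let p : Polynomial (PowerSeries ℂ) := ∑ k, Polynomial.C (PowerSeries.C (a k) *
    PowerSeries.X ^ n k) * Polynomial.X ^ l k
  have hp (U : PowerSeries ℂ) : p.eval U = ∑ k, psTerm (a k) (n k) (l k) U := by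
    simp [p, Polynomial.eval_finsetSum, psTerm]
  have h0' : PowerSeries.constantCoeff (p.eval (PowerSeries.C ζ)) = 0 := by
    rw [hp, map_sum, ← h0]
    refine Finset.sum_congr rfl fun k _ => ?_
    split_ifs with h <;> simp [psTerm, h]
  have h1' : ζ * PowerSeries.constantCoeff (p.derivative.eval (PowerSeries.C ζ)) =
      ∑ k, (if n k = 0 then l k * (a k * ζ ^ l k) else 0) := by
    simp only [p, map_sum, Polynomial.eval_finsetSum, Finset.mul_sum, Polynomial.derivative_C_mul,
      Polynomial.derivative_X_pow, Polynomial.eval_mul, Polynomial.eval_C, Polynomial.eval_pow,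
      Polynomial.eval_X]
    refine Finset.sum_congr rfl fun k _ => ?_
    split_ifs with h
    · rcases hl : l k with - | e
      · simp
      · simp [h]
        ring
    · simp [h]
  obtain ⟨U, hU, hpU⟩ := exists_root_of_simple_root p ζ h0'
    (right_ne_zero_of_mul (h1'.symm ▸ h1 : ζ * _ ≠ 0))
  exact ⟨U, hU, by rw [← hp, hpU]⟩

end Hensel

/-- The norm of an element of a free algebra is the product of its conjugates. -/
theorem map_norm_eq_prod {R A K ν : Type*} [CommRing R] [CommRing A] [Algebra R A] [Field K]
    [Fintype ν] [DecidableEq ν] (b : Module.Basis ν R A) (φ : R →+* K) (ev : ν → A →+* K)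
    (hev : ∀ z r, ev z (algebraMap R A r) = φ r)
    (hdet : (Matrix.of fun z j => ev z (b j)).det ≠ 0) (g : A) :
    φ (Algebra.norm R g) = ∏ z, ev z g := by
  rw [Algebra.norm_eq_matrix_det b, RingHom.map_det]
  set V : Matrix ν ν K := Matrix.of fun z j => ev z (b j) with hV
  have key : V * φ.mapMatrix (Algebra.leftMulMatrix b g) =
      Matrix.diagonal (fun z => ev z g) * V := by
    ext z j
    rw [Matrix.mul_apply, Matrix.diagonal_mul]
    simp only [hV, Matrix.of_apply, RingHom.mapMatrix_apply, Matrix.map_apply,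
      Algebra.leftMulMatrix_eq_repr_mul]
    have h1 : ev z g * ev z (b j) = ev z (∑ i, b.repr (g * b j) i • b i) := by
      rw [b.sum_repr, map_mul]
    rw [h1, map_sum]
    refine Finset.sum_congr rfl fun i _ => ?_
    rw [Algebra.smul_def, RingHom.map_mul, hev, mul_comm]
  have h2 := congrArg Matrix.det key
  rw [Matrix.det_mul, Matrix.det_mul, Matrix.det_diagonal, mul_comm] at h2
  exact mul_right_cancel₀ hdet h2

/-- The colength of an injective endomorphism of a free module over a principal ideal domain is
that of its determinant, for any additive function computing colengths of elements. -/
theorem finrank_quotient_range {k R M ν : Type*} [Field k] [CommRing R] [IsDomain R]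
    [IsPrincipalIdealRing R] [Algebra k R] [AddCommGroup M] [Module R M] [Module k M]
    [IsScalarTower k R M] [Fintype ν] (b : Module.Basis ν R M) (c : ℤ) (d : R → ℤ)
    (hmul : ∀ x y : R, x ≠ 0 → y ≠ 0 → d (x * y) = d x + d y)
    (hfin : ∀ x : R, x ≠ 0 → Module.Finite k (R ⧸ Ideal.span {x}))
    (hd : ∀ x : R, x ≠ 0 → c * Module.finrank k (R ⧸ Ideal.span {x}) = d x)
    (φ : M →ₗ[R] M) (hφ : Function.Injective φ) :
    Module.Finite k (M ⧸ LinearMap.range φ) ∧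
      c * Module.finrank k (M ⧸ LinearMap.range φ) = d (LinearMap.det φ) := by
  classical
  have h : Module.finrank R (LinearMap.range φ) = Module.finrank R M :=
    LinearMap.finrank_range_of_inj hφ
  let a := Submodule.smithNormalFormCoeffs b h
  let b' := Submodule.smithNormalFormTopBasis b h
  let bN := Submodule.smithNormalFormBotBasis b h
  have hb (i : ν) : (bN i : M) = a i • b' i := Submodule.smithNormalFormBotBasis_def b h i
  have ha (i : ν) : a i ≠ 0 := Submodule.smithNormalFormCoeffs_ne_zero b h i
  have hfin' (i : ν) := hfin (a i) (ha i)
  have h1 : d 1 = 0 := by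
    have := hmul 1 1 one_ne_zero one_ne_zero
    rw [mul_one] at this
    omega
  have hunit (u : R) (hu : IsUnit u) : d u = 0 := by
    rw [← hd u hu.ne_zero, Ideal.span_singleton_eq_top.2 hu]
    have : Subsingleton (R ⧸ (⊤ : Ideal R)) := Ideal.Quotient.subsingleton_iff.2 rfl
    rw [Module.finrank_zero_of_subsingleton]
    simp
  refine ⟨?_, ?_⟩
  · have e := Submodule.quotientEquivDirectSum k b h
    have : ∀ i, Module.Finite k (R ⧸ Ideal.span {Submodule.smithNormalFormCoeffs b h i}) := hfin'
    have : Module.Finite k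
        (DirectSum ν fun i => R ⧸ Ideal.span {Submodule.smithNormalFormCoeffs b h i}) :=
      Module.Finite.equiv (DirectSum.linearEquivFunOnFintype k ν _).symm
    exact Module.Finite.equiv e.symm
  · rw [Submodule.finrank_quotient_eq_sum k b h]
    let e : M ≃ₗ[R] M := (b'.equiv bN (Equiv.refl _)).trans (LinearEquiv.ofInjective φ hφ).symm
    have hassoc := LinearMap.associated_det_of_eq_comp e (Matrix.toLin b' b' (Matrix.diagonal a)) φ
      (by
        suffices h3 : Matrix.toLin b' b' (Matrix.diagonal a) = φ ∘ₗ e.toLinearMap from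
          fun x => by rw [h3]; rfl
        refine b'.ext fun i => ?_
        have h2 : φ ((LinearEquiv.ofInjective φ hφ).symm (bN i)) = bN i := by
          conv_rhs => rw [← LinearEquiv.apply_symm_apply (LinearEquiv.ofInjective φ hφ) (bN i)]
          rfl
        simp only [LinearMap.comp_apply, LinearEquiv.coe_toLinearMap, e, LinearEquiv.trans_apply,
          Module.Basis.equiv_apply, Equiv.refl_apply, h2, hb]
        rw [Matrix.toLin_self]
        simp [Matrix.diagonal_apply])
    rw [LinearMap.det_toLin, Matrix.det_diagonal] at hassoc
    obtain ⟨u, hu⟩ := hassoc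
    have hprod : ∏ i, a i ≠ 0 := Finset.prod_ne_zero_iff.2 fun i _ => ha i
    have hdprod (S : Finset ν) : d (∏ i ∈ S, a i) = ∑ i ∈ S, d (a i) := by
      induction S using Finset.induction_on with
      | empty => simpa using h1
      | insert i S hi ih =>
        rw [Finset.prod_insert hi, Finset.sum_insert hi,
          hmul _ _ (ha i) (Finset.prod_ne_zero_iff.2 fun i _ => ha i), ih]
    rw [← hu, hmul _ _ hprod u.ne_zero, hunit _ u.isUnit, add_zero, hdprod]
    push_cast
    rw [Finset.mul_sum]
    exact Finset.sum_congr rfl fun i _ => hd (a i) (ha i)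

/-- `x` is `τ ^ k` times a unit of `ℂ⟦τ⟧`. -/
def HasOrd (x : LaurentSeries ℂ) (k : ℤ) : Prop :=
  ∃ W : PowerSeries ℂ, PowerSeries.constantCoeff W ≠ 0 ∧
    x = HahnSeries.single k 1 * (W : LaurentSeries ℂ)

theorem HasOrd.mul {x y : LaurentSeries ℂ} {k l : ℤ} (hx : HasOrd x k) (hy : HasOrd y l) :
    HasOrd (x * y) (k + l) := by
  obtain ⟨V, hV, rfl⟩ := hx
  obtain ⟨W, hW, rfl⟩ := hy
  refine ⟨V * W, by rw [map_mul]; exact mul_ne_zero hV hW, ?_⟩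
  rw [PowerSeries.coe_mul, mul_mul_mul_comm, HahnSeries.single_mul_single, mul_one]

theorem hasOrd_coe {W : PowerSeries ℂ} (hW : PowerSeries.constantCoeff W ≠ 0) :
    HasOrd (W : LaurentSeries ℂ) 0 :=
  ⟨W, hW, by rw [HahnSeries.single_zero_one, one_mul]⟩

theorem hasOrd_single (k : ℤ) {c : ℂ} (hc : c ≠ 0) : HasOrd (HahnSeries.single k c) k :=
  ⟨PowerSeries.C c, by simpa using hc, by
    rw [PowerSeries.coe_C, HahnSeries.C_apply, HahnSeries.single_mul_single]; simp⟩

theorem HasOrd.coeff {x : LaurentSeries ℂ} {k : ℤ} (h : HasOrd x k) :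
    x.coeff k ≠ 0 ∧ ∀ l < k, x.coeff l = 0 := by
  obtain ⟨W, hW, rfl⟩ := h
  refine ⟨?_, fun l hl => ?_⟩
  · have := HahnSeries.coeff_single_mul_add (x := (W : LaurentSeries ℂ)) (r := (1 : ℂ)) (a := 0)
      (b := k)
    rw [zero_add] at this
    rw [this, one_mul]
    have h2 := PowerSeries.coeff_coe W 0
    rw [h2]
    simpa using hW
  · have := HahnSeries.coeff_single_mul_add (x := (W : LaurentSeries ℂ)) (r := (1 : ℂ)) (a := l - k)
      (b := k)
    rw [sub_add_cancel] at this
    rw [this, one_mul, PowerSeries.coeff_coe, if_pos (by omega)]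

theorem HasOrd.ne_zero {x : LaurentSeries ℂ} {k : ℤ} (h : HasOrd x k) : x ≠ 0 := by
  rintro rfl
  exact h.coeff.1 (by simp)

theorem HasOrd.unique {x : LaurentSeries ℂ} {k l : ℤ} (h : HasOrd x k) (h' : HasOrd x l) :
    k = l := by
  rcases lt_trichotomy k l with hkl | hkl | hkl
  · exact absurd (h'.coeff.2 k hkl) h.coeff.1
  · exact hkl
  · exact absurd (h.coeff.2 l hkl) h'.coeff.1

theorem HasOrd.prod {ν : Type*} (S : Finset ν) {x : ν → LaurentSeries ℂ} {o : ν → ℤ}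
    (h : ∀ z ∈ S, HasOrd (x z) (o z)) : HasOrd (∏ z ∈ S, x z) (∑ z ∈ S, o z) := by
  classical
  induction S using Finset.induction_on with
  | empty => simpa using hasOrd_single 0 (one_ne_zero (α := ℂ))
  | insert i S hi ih =>
    rw [Finset.prod_insert hi, Finset.sum_insert hi]
    exact (h i (Finset.mem_insert_self i S)).mul (ih fun z hz => h z (Finset.mem_insert_of_mem hz))

/-- Substitution `T ↦ τ ^ e`. -/
def laurentSubst (e : ℤ) : LaurentPolynomial ℂ →+* LaurentSeries ℂ :=
  LaurentPolynomial.eval₂ (HahnSeries.C : ℂ →+* LaurentSeries ℂ)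
    (⟨HahnSeries.single e 1, HahnSeries.single (-e) 1, by simp, by simp⟩ : (LaurentSeries ℂ)ˣ)

theorem laurentSubst_C (e : ℤ) (c : ℂ) :
    laurentSubst e (LaurentPolynomial.C c) = HahnSeries.C c := by
  rw [laurentSubst, LaurentPolynomial.eval₂_C]

theorem laurentSubst_T (e n : ℤ) :
    laurentSubst e (LaurentPolynomial.T n) = HahnSeries.single (e * n) 1 := by
  rw [laurentSubst, LaurentPolynomial.eval₂_T]
  induction n using Int.induction_on with
  | zero => simp
  | succ n ih =>
    rw [zpow_add_one, Units.val_mul, ih]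
    simp [mul_add]
  | pred n ih =>
    rw [zpow_sub_one, Units.val_mul, ih]
    change _ * HahnSeries.single (-e) 1 = _
    rw [HahnSeries.single_mul_single]
    rw [mul_one, show e * -(n : ℤ) + -e = e * (-n - 1) by ring]

instance : IsPrincipalIdealRing (LaurentPolynomial ℂ) := by
  refine ⟨fun I => ?_⟩
  have h := IsLocalization.map_under (Submonoid.powers (Polynomial.X : Polynomial ℂ))
    (LaurentPolynomial ℂ) I
  rw [← h]
  exact Submodule.IsPrincipal.map_ringHom _ (IsPrincipalIdealRing.principal _)

theorem hasOrd_laurentSubst_toLaurent_pos (M : ℕ) (hM : 0 < M) (p : Polynomial ℂ)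
    (hp : p.coeff 0 ≠ 0) : HasOrd (laurentSubst M (Polynomial.toLaurent p)) 0 := by
  have : laurentSubst M (Polynomial.toLaurent p) =
      ((Polynomial.aeval ((PowerSeries.X : PowerSeries ℂ) ^ M) p : PowerSeries ℂ) :
          LaurentSeries ℂ) := by
    rw [laurentSubst, LaurentPolynomial.eval₂_toLaurent, Polynomial.aeval_def,
      Polynomial.hom_eval₂]
    congr 1
    · ext c
      simp
    · simp
  rw [this]
  refine hasOrd_coe ?_
  have : PowerSeries.constantCoeff (Polynomial.aeval ((PowerSeries.X : PowerSeries ℂ) ^ M) p) =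
      p.coeff 0 := by
    rw [Polynomial.aeval_def, Polynomial.hom_eval₂, Polynomial.coeff_zero_eq_eval_zero,
      Polynomial.eval]
    congr 1
    simp [hM.ne']
  rwa [this]

theorem laurentSubst_neg (e : ℤ) (a : LaurentPolynomial ℂ) :
    laurentSubst (-e) a = laurentSubst e (LaurentPolynomial.invert a) := by
  induction a using LaurentPolynomial.induction_on' with
  | add p q hp hq => rw [map_add, map_add, map_add, hp, hq]
  | C_mul_T n c =>
    rw [map_mul, map_mul, map_mul, LaurentPolynomial.invert_C, LaurentPolynomial.invert_T,
      laurentSubst_C, laurentSubst_C, laurentSubst_T, laurentSubst_T]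
    simp

theorem hasOrd_laurentSubst_toLaurent_neg (M : ℕ) (hM : 0 < M) (p : Polynomial ℂ)
    (hp : p ≠ 0) :
    HasOrd (laurentSubst (-M) (Polynomial.toLaurent p)) (-(M * p.natDegree)) := by
  have h := LaurentPolynomial.toLaurent_reverse p
  have h2 := hasOrd_laurentSubst_toLaurent_pos M hM p.reverse (by
    rw [Polynomial.coeff_zero_reverse]; exact Polynomial.leadingCoeff_ne_zero.2 hp)
  have h3 : HasOrd (laurentSubst M (LaurentPolynomial.T (-(p.natDegree : ℤ))))
      (-(M * p.natDegree)) := by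
    rw [laurentSubst_T, mul_neg]
    exact hasOrd_single _ one_ne_zero
  have h4 := h2.mul h3
  rw [zero_add, ← map_mul, h, LaurentPolynomial.mul_T_assoc, add_neg_cancel,
    LaurentPolynomial.T_zero, mul_one, ← laurentSubst_neg] at h4
  exact h4

/-- A nonzero Laurent polynomial is a monomial times a polynomial with nonzero constant term. -/
theorem LaurentPolynomial.exists_eq_mul_T {a : LaurentPolynomial ℂ} (ha : a ≠ 0) :
    ∃ (p : Polynomial ℂ) (n : ℤ), p.coeff 0 ≠ 0 ∧
      a = Polynomial.toLaurent p * LaurentPolynomial.T n := by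
  obtain ⟨n, f, hf⟩ := LaurentPolynomial.exists_T_pow a
  have hf0 : f ≠ 0 := by
    rintro rfl
    rw [map_zero] at hf
    exact ha ((LaurentPolynomial.isUnit_T n).mul_left_eq_zero.1 hf.symm)
  obtain ⟨q, hq, hq2⟩ := Polynomial.exists_eq_pow_rootMultiplicity_mul_and_not_dvd f hf0 0
  rw [Polynomial.C_0, sub_zero] at hq hq2
  generalize f.rootMultiplicity 0 = r at hq
  refine ⟨q, (r : ℤ) - n, ?_, ?_⟩
  · rwa [Polynomial.X_dvd_iff] at hq2
  · have h1 : a = Polynomial.toLaurent f * LaurentPolynomial.T (-n) := by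
      rw [hf, LaurentPolynomial.mul_T_assoc, add_neg_cancel, LaurentPolynomial.T_zero, mul_one]
    rw [h1, hq, map_mul, Polynomial.toLaurent_X_pow, LaurentPolynomial.T_sub]
    ring

theorem finrank_laurent_quotient (M : ℕ) (hM : 0 < M) {a : LaurentPolynomial ℂ} (ha : a ≠ 0) :
    Module.Finite ℂ (LaurentPolynomial ℂ ⧸ Ideal.span {a}) ∧
    ∃ o₁ o₂ : ℤ, HasOrd (laurentSubst M a) o₁ ∧ HasOrd (laurentSubst (-M) a) o₂ ∧
      (M : ℤ) * Module.finrank ℂ (LaurentPolynomial ℂ ⧸ Ideal.span {a}) = -(o₁ + o₂) := by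
  obtain ⟨p, n, hp, rfl⟩ := LaurentPolynomial.exists_eq_mul_T ha
  have hp0 : p ≠ 0 := by rintro rfl; simp at hp
  rw [Ideal.span_singleton_mul_right_unit (LaurentPolynomial.isUnit_T n)]
  have hcop (r : ℕ) : IsCoprime (Polynomial.X ^ r : Polynomial ℂ) p := by
    refine IsCoprime.pow_left ?_
    rw [Polynomial.irreducible_X.coprime_iff_not_dvd, Polynomial.X_dvd_iff]
    exact hp
  let q : Polynomial ℂ →ₐ[ℂ] (LaurentPolynomial ℂ ⧸ Ideal.span {Polynomial.toLaurent p}) :=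
    (Ideal.Quotient.mkₐ ℂ _).comp Polynomial.toLaurentAlg
  have hq (f : Polynomial ℂ) : q f = Ideal.Quotient.mk _ (Polynomial.toLaurent f) := rfl
  have hsurj : Function.Surjective q := by
    intro y
    obtain ⟨y, rfl⟩ := Ideal.Quotient.mk_surjective y
    obtain ⟨r, f, hf⟩ := LaurentPolynomial.exists_T_pow y
    obtain ⟨u, v, huv⟩ := hcop r
    refine ⟨u * f, ?_⟩
    rw [hq, Ideal.Quotient.mk_eq_mk_iff_sub_mem, Ideal.mem_span_singleton, map_mul, hf]
    have h2 := congrArg Polynomial.toLaurent huv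
    rw [map_add, map_mul, map_mul, Polynomial.toLaurent_X_pow, map_one] at h2
    refine ⟨-(Polynomial.toLaurent v * y), ?_⟩
    clear hf hq
    linear_combination y * h2
  have hker : RingHom.ker q = Ideal.span {p} := by
    ext f
    rw [RingHom.mem_ker, hq, Ideal.Quotient.eq_zero_iff_mem, Ideal.mem_span_singleton,
      Ideal.mem_span_singleton]
    constructor
    · rintro ⟨g, hg⟩
      obtain ⟨r, g', hg'⟩ := LaurentPolynomial.exists_T_pow g
      have : Polynomial.X ^ r * f = p * g' := by
        apply Polynomial.toLaurent_injective
        rw [map_mul, map_mul, hg, hg', Polynomial.toLaurent_X_pow]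
        ring
      exact (hcop r).symm.dvd_of_dvd_mul_left ⟨g', this⟩
    · rintro ⟨g, rfl⟩
      exact ⟨Polynomial.toLaurent g, by rw [map_mul]⟩
  let e := Ideal.quotientKerAlgEquivOfSurjective hsurj
  have hfin : Module.Finite ℂ (Polynomial ℂ ⧸ RingHom.ker q) := by
    rw [hker]
    exact PowerBasis.finite (AdjoinRoot.powerBasis hp0)
  refine ⟨Module.Finite.equiv e.toLinearEquiv, 0 + M * n, -(M * p.natDegree) + -M * n, ?_, ?_, ?_⟩
  · rw [map_mul, laurentSubst_T]
    exact (hasOrd_laurentSubst_toLaurent_pos M hM p hp).mul (hasOrd_single _ one_ne_zero)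
  · rw [map_mul, laurentSubst_T]
    exact (hasOrd_laurentSubst_toLaurent_neg M hM p hp0).mul (hasOrd_single _ one_ne_zero)
  · have e2 := (Ideal.quotientEquivAlgOfEq ℂ hker).toLinearEquiv
    rw [← e.toLinearEquiv.finrank_eq, e2.finrank_eq, finrank_quotient_span_eq_natDegree]
    ring

/-- The colength of an element of a finite free algebra over the Laurent polynomials is determined
by the orders of its conjugates at the two ends. -/
theorem finrank_quotient_span_eq_orders {A ν : Type*} [CommRing A] [Algebra (LaurentPolynomial ℂ) A]
    [Algebra ℂ A] [IsScalarTower ℂ (LaurentPolynomial ℂ) A] [Fintype ν] [DecidableEq ν]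
    (b : Module.Basis ν (LaurentPolynomial ℂ) A) (M : ℕ) (hM : 0 < M)
    (ev₁ ev₂ : ν → A →+* LaurentSeries ℂ)
    (h₁ : ∀ z r, ev₁ z (algebraMap _ A r) = laurentSubst M r)
    (h₂ : ∀ z r, ev₂ z (algebraMap _ A r) = laurentSubst (-M) r)
    (hd₁ : (Matrix.of fun z j => ev₁ z (b j)).det ≠ 0)
    (hd₂ : (Matrix.of fun z j => ev₂ z (b j)).det ≠ 0) (g : A) (o₁ o₂ : ν → ℤ)
    (ho₁ : ∀ z, HasOrd (ev₁ z g) (o₁ z)) (ho₂ : ∀ z, HasOrd (ev₂ z g) (o₂ z)) :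
    Module.Finite ℂ (A ⧸ Ideal.span {g}) ∧
      (M : ℤ) * Module.finrank ℂ (A ⧸ Ideal.span {g}) = -(∑ z, o₁ z + ∑ z, o₂ z) := by
  have hn₁ : HasOrd (laurentSubst M (Algebra.norm (LaurentPolynomial ℂ) g)) (∑ z, o₁ z) := by
    rw [map_norm_eq_prod b _ ev₁ h₁ hd₁]
    exact HasOrd.prod _ fun z _ => ho₁ z
  have hn₂ : HasOrd (laurentSubst (-M) (Algebra.norm (LaurentPolynomial ℂ) g)) (∑ z, o₂ z) := by
    rw [map_norm_eq_prod b _ ev₂ h₂ hd₂]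
    exact HasOrd.prod _ fun z _ => ho₂ z
  have hne : Algebra.norm (LaurentPolynomial ℂ) g ≠ 0 := by
    intro h
    rw [h, map_zero] at hn₁
    exact hn₁.ne_zero rfl
  have hfin (a : LaurentPolynomial ℂ) (ha : a ≠ 0) := finrank_laurent_quotient M hM ha
  classical
  let d : LaurentPolynomial ℂ → ℤ := fun a =>
    M * Module.finrank ℂ (LaurentPolynomial ℂ ⧸ Ideal.span {a})
  have hd (a : LaurentPolynomial ℂ) (ha : a ≠ 0) (o o' : ℤ) (ho : HasOrd (laurentSubst M a) o)
      (ho' : HasOrd (laurentSubst (-M) a) o') : d a = -(o + o') := by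
    obtain ⟨_, p, p', hp, hp', h⟩ := hfin a ha
    rw [ho.unique hp, ho'.unique hp', ← h]
  have hinj : Function.Injective (Algebra.lmul (LaurentPolynomial ℂ) A g) := by
    have : Module.Free (LaurentPolynomial ℂ) A := Module.Free.of_basis b
    have : Module.Finite (LaurentPolynomial ℂ) A := Module.Finite.of_basis b
    rw [← LinearMap.ker_eq_bot]
    by_contra hker
    exact hne (LinearMap.det_eq_zero_iff_ker_ne_bot.2 hker)
  have key := finrank_quotient_range (k := ℂ) b M d (fun x y hx hy => by
      obtain ⟨_, p, p', hp, hp', h⟩ := hfin x hx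
      obtain ⟨_, r, r', hr, hr', h'⟩ := hfin y hy
      rw [hd x hx _ _ hp hp', hd y hy _ _ hr hr', hd _ (mul_ne_zero hx hy) (p + r) (p' + r')]
      · ring
      · rw [map_mul]; exact hp.mul hr
      · rw [map_mul]; exact hp'.mul hr')
    (fun x hx => (hfin x hx).1) (fun x _ => rfl) (Algebra.lmul (LaurentPolynomial ℂ) A g) hinj
  have hrange : LinearMap.range (Algebra.lmul (LaurentPolynomial ℂ) A g) =
      (Ideal.span {g}).restrictScalars (LaurentPolynomial ℂ) := by
    ext x
    rw [LinearMap.mem_range, Submodule.restrictScalars_mem, Ideal.mem_span_singleton]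
    exact ⟨fun ⟨y, hy⟩ => ⟨y, hy.symm⟩, fun ⟨y, hy⟩ => ⟨y, hy.symm⟩⟩
  let e' : (A ⧸ LinearMap.range (Algebra.lmul (LaurentPolynomial ℂ) A g)) ≃ₗ[LaurentPolynomial ℂ]
      A ⧸ Ideal.span {g} := (Submodule.quotEquivOfEq _ _ hrange).trans
        ((Submodule.Quotient.restrictScalarsEquiv (LaurentPolynomial ℂ) (Ideal.span {g})))
  let e : (A ⧸ LinearMap.range (Algebra.lmul (LaurentPolynomial ℂ) A g)) ≃ₗ[ℂ] A ⧸ Ideal.span {g} :=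
    e'.restrictScalars ℂ
  rw [← hd _ hne _ _ hn₁ hn₂, ← e.finrank_eq]
  have := key.1
  exact ⟨Module.Finite.equiv e, key.2⟩

section FlexAlgebra

variable {ι : Type*} [Fintype ι] (a : ι → ℂ) (i j l : ι → ℕ) (p q : ι)

/-- The equation `∑ aₖ T ^ iₖ w ^ lₖ`, divided by its lowest term in `w` and made monic. -/
def torusPoly : Polynomial (LaurentPolynomial ℂ) :=
  ∑ k, Polynomial.C (LaurentPolynomial.C (a k * (a q)⁻¹) * LaurentPolynomial.T ((i k : ℤ) - i q)) *
    Polynomial.X ^ (l k - l p)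

variable {a i j l p q}

theorem eval₂_torusPoly {S : Type*} [CommRing S] (φ : LaurentPolynomial ℂ →+* S) (z : S)
    (haq : a q ≠ 0) (hp : ∀ k, l p ≤ l k) :
    φ (LaurentPolynomial.C (a q) * LaurentPolynomial.T (i q)) * z ^ l p *
      Polynomial.eval₂ φ z (torusPoly a i l p q) =
    ∑ k, φ (LaurentPolynomial.C (a k) * LaurentPolynomial.T (i k)) * z ^ l k := by
  rw [torusPoly, Polynomial.eval₂_finsetSum, Finset.mul_sum]
  refine Finset.sum_congr rfl fun k _ => ?_
  rw [Polynomial.eval₂_mul, Polynomial.eval₂_C, Polynomial.eval₂_X_pow]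
  have h1 : (LaurentPolynomial.C (a q) * LaurentPolynomial.T (i q)) *
      (LaurentPolynomial.C (a k * (a q)⁻¹) * LaurentPolynomial.T ((i k : ℤ) - i q)) =
      LaurentPolynomial.C (a k) * LaurentPolynomial.T (i k) := by
    rw [mul_mul_mul_comm, ← map_mul, ← LaurentPolynomial.T_add]
    congr 2
    · field_simp
    · ring
  rw [← h1, map_mul φ (_ * _) (_ * _), ← Nat.add_sub_of_le (hp k), pow_add, Nat.add_sub_cancel_left]
  ring

theorem natDegree_torusPoly_le (hq : ∀ k, l k ≤ l q) :
    (torusPoly a i l p q).natDegree ≤ l q - l p := by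
  refine Polynomial.natDegree_sum_le_of_forall_le _ _ fun k _ => ?_
  refine (Polynomial.natDegree_C_mul_X_pow_le _ _).trans ?_
  have := hq k
  omega

theorem coeff_torusPoly_top (haq : a q ≠ 0) (hp : ∀ k, l p ≤ l k) (hq : ∀ k, k ≠ q → l k < l q) :
    (torusPoly a i l p q).coeff (l q - l p) = 1 := by
  rw [torusPoly, Polynomial.finsetSum_coeff, Finset.sum_eq_single q]
  · rw [Polynomial.coeff_C_mul_X_pow, if_pos rfl, mul_inv_cancel₀ haq]
    simp
  · intro k _ hk
    rw [Polynomial.coeff_C_mul_X_pow, if_neg]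
    have := hq k hk
    have := hp k
    omega
  · simp

theorem monic_torusPoly (haq : a q ≠ 0) (hp : ∀ k, l p ≤ l k) (hq : ∀ k, k ≠ q → l k < l q) :
    (torusPoly a i l p q).Monic :=
  Polynomial.monic_of_natDegree_le_of_coeff_eq_one _
    (natDegree_torusPoly_le fun k => (eq_or_ne k q).elim (fun h => h ▸ le_rfl) fun h => (hq k h).le)
    (coeff_torusPoly_top haq hp hq)

theorem natDegree_torusPoly (haq : a q ≠ 0) (hp : ∀ k, l p ≤ l k) (hq : ∀ k, k ≠ q → l k < l q) :
    (torusPoly a i l p q).natDegree = l q - l p := by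
  refine le_antisymm (natDegree_torusPoly_le fun k =>
    (eq_or_ne k q).elim (fun h => h ▸ le_rfl) fun h => (hq k h).le) ?_
  refine Polynomial.le_natDegree_of_ne_zero ?_
  rw [coeff_torusPoly_top haq hp hq]
  exact one_ne_zero

theorem isUnit_coeff_torusPoly_zero (haq : a q ≠ 0) (hap : a p ≠ 0) (hp : ∀ k, k ≠ p → l p < l k) :
    IsUnit ((torusPoly a i l p q).coeff 0) := by
  rw [torusPoly, Polynomial.finsetSum_coeff, Finset.sum_eq_single p]
  · rw [Polynomial.coeff_C_mul_X_pow, if_pos (by simp)]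
    exact ((isUnit_iff_ne_zero.2 (mul_ne_zero hap (inv_ne_zero haq))).map _).mul
      (LaurentPolynomial.isUnit_T _)
  · intro k _ hk
    rw [Polynomial.coeff_C_mul_X_pow, if_neg]
    have := hp k hk
    omega
  · simp

variable (a i j l p q)

/-- The monomial `aₖ T ^ iₖ w ^ lₖ` in the coordinate ring of the curve. -/
def torusTerm (k : ι) : AdjoinRoot (torusPoly a i l p q) :=
  AdjoinRoot.of _ (LaurentPolynomial.C (a k) * LaurentPolynomial.T (i k)) *
    AdjoinRoot.root _ ^ l k

/-- The coordinate ring of the scheme of flexes in the torus. -/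
abbrev FlexAlgebra : Type _ :=
  AdjoinRoot (torusPoly a i l p q) ⧸ Ideal.span {flexForm i j (torusTerm a i l p q)}

variable {a i j l p q}

theorem sum_torusTerm (haq : a q ≠ 0) (hp : ∀ k, l p ≤ l k) : ∑ k, torusTerm a i l p q k = 0 := by
  have h := eval₂_torusPoly (i := i) (AdjoinRoot.of (torusPoly a i l p q))
      (AdjoinRoot.root _) haq hp
  rw [AdjoinRoot.eval₂_root, mul_zero] at h
  exact h.symm

theorem finrank_flexAlgebra (haq : a q ≠ 0) (hp : ∀ k, l p ≤ l k) (hq : ∀ k, k ≠ q → l k < l q)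
    (M : ℕ) (hM : 0 < M) (z₁ z₂ : Fin (l q - l p) → LaurentSeries ℂ)
    (hz₁ : Function.Injective z₁) (hz₂ : Function.Injective z₂)
    (hz₁' : ∀ r, z₁ r ≠ 0) (hz₂' : ∀ r, z₂ r ≠ 0)
    (h₁ : ∀ r, ∑ k, laurentSubst M (LaurentPolynomial.C (a k) * LaurentPolynomial.T (i k)) *
      z₁ r ^ l k = 0)
    (h₂ : ∀ r, ∑ k, laurentSubst (-M) (LaurentPolynomial.C (a k) * LaurentPolynomial.T (i k)) *
      z₂ r ^ l k = 0) (o₁ o₂ : Fin (l q - l p) → ℤ)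
    (ho₁ : ∀ r, HasOrd (flexForm i j fun k =>
      laurentSubst M (LaurentPolynomial.C (a k) * LaurentPolynomial.T (i k)) * z₁ r ^ l k) (o₁ r))
    (ho₂ : ∀ r, HasOrd (flexForm i j fun k =>
      laurentSubst (-M) (LaurentPolynomial.C (a k) * LaurentPolynomial.T (i k)) * z₂ r ^ l k)
        (o₂ r)) :
    Module.Finite ℂ (FlexAlgebra a i j l p q) ∧
      (M : ℤ) * Module.finrank ℂ (FlexAlgebra a i j l p q) = -(∑ r, o₁ r + ∑ r, o₂ r) := by
  have hunit (φ : LaurentPolynomial ℂ →+* LaurentSeries ℂ) :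
      φ (LaurentPolynomial.C (a q) * LaurentPolynomial.T (i q)) ≠ 0 :=
    (((((isUnit_iff_ne_zero.2 haq).map _).mul (LaurentPolynomial.isUnit_T _))).map φ).ne_zero
  have hroot (φ : LaurentPolynomial ℂ →+* LaurentSeries ℂ) (z : LaurentSeries ℂ) (hz : z ≠ 0)
      (h : ∑ k, φ (LaurentPolynomial.C (a k) * LaurentPolynomial.T (i k)) * z ^ l k = 0) :
      (torusPoly a i l p q).eval₂ φ z = 0 := by
    rw [← eval₂_torusPoly φ z haq hp] at h
    exact (mul_eq_zero.1 h).resolve_left (mul_ne_zero (hunit φ) (pow_ne_zero _ hz))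
  let b := (AdjoinRoot.powerBasis' (monic_torusPoly (i := i) haq hp hq)).basis.reindex
    (finCongr (natDegree_torusPoly (i := i) haq hp hq))
  have hb (r : Fin (l q - l p)) : b r = AdjoinRoot.root _ ^ (r : ℕ) := by
    simp [b, PowerBasis.coe_basis]
    rfl
  have hdet (φ : LaurentPolynomial ℂ →+* LaurentSeries ℂ) (z : Fin (l q - l p) → LaurentSeries ℂ)
      (hz : Function.Injective z) (h : ∀ r, (torusPoly a i l p q).eval₂ φ (z r) = 0) :
      (Matrix.of fun r c => AdjoinRoot.lift φ (z r) (h r) (b c)).det ≠ 0 := by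
    have : (Matrix.of fun r c => AdjoinRoot.lift φ (z r) (h r) (b c)) = Matrix.vandermonde z := by
      ext r c
      rw [Matrix.of_apply, hb, map_pow, AdjoinRoot.lift_root, Matrix.vandermonde_apply]
    rw [this]
    exact Matrix.det_vandermonde_ne_zero_iff.2 hz
  have hflex (φ : LaurentPolynomial ℂ →+* LaurentSeries ℂ) (z : LaurentSeries ℂ)
      (h : (torusPoly a i l p q).eval₂ φ z = 0) :
      AdjoinRoot.lift φ z h (flexForm i j (torusTerm a i l p q)) = flexForm i j fun k =>
        φ (LaurentPolynomial.C (a k) * LaurentPolynomial.T (i k)) * z ^ l k := by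
    rw [← flexForm_map]
    congr 1
    ext k : 1
    rw [torusTerm, RingHom.map_mul, map_pow, AdjoinRoot.lift_root, AdjoinRoot.lift_of]
  refine finrank_quotient_span_eq_orders b M hM
    (fun r => AdjoinRoot.lift (laurentSubst M) (z₁ r) (hroot _ _ (hz₁' r) (h₁ r)))
    (fun r => AdjoinRoot.lift (laurentSubst (-M)) (z₂ r) (hroot _ _ (hz₂' r) (h₂ r)))
    (fun r x => AdjoinRoot.lift_of _) (fun r x => AdjoinRoot.lift_of _)
    (hdet _ _ hz₁ _) (hdet _ _ hz₂ _) _ o₁ o₂ (fun r => ?_) (fun r => ?_)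
  · rw [hflex]; exact ho₁ r
  · rw [hflex]; exact ho₂ r

end FlexAlgebra

/-- A reduced finite-dimensional algebra over `ℂ` has as many points as its dimension. -/
theorem natCard_algHom_eq_finrank {B : Type*} [CommRing B] [Algebra ℂ B] [Module.Finite ℂ B]
    [IsReduced B] : Finite (B →ₐ[ℂ] ℂ) ∧ Nat.card (B →ₐ[ℂ] ℂ) = Module.finrank ℂ B := by
  have hli : LinearIndependent ℂ (fun f : B →ₐ[ℂ] ℂ => f.toLinearMap) := by
    have h := linearIndependent_algHom_toLinearMap ℂ B ℂ
    exact h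
  have hfin : Finite (B →ₐ[ℂ] ℂ) := hli.finite
  have := Fintype.ofFinite (B →ₐ[ℂ] ℂ)
  refine ⟨hfin, le_antisymm ?_ ?_⟩
  · rw [Nat.card_eq_fintype_card]
    have h := hli.fintype_card_le_finrank
    rwa [Subspace.dual_finrank_eq] at h
  · let Φ : B →ₗ[ℂ] ((B →ₐ[ℂ] ℂ) → ℂ) := LinearMap.pi fun f => f.toLinearMap
    have hinj : Function.Injective Φ := by
      rw [injective_iff_map_eq_zero]
      intro x hx
      by_contra hne
      have hnil : ¬ IsNilpotent x := fun h => hne h.eq_zero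
      have : ∃ P : Ideal B, P.IsPrime ∧ x ∉ P := by
        by_contra! hall
        apply hnil
        rw [← mem_nilradical, nilradical_eq_sInf, Ideal.mem_sInf]
        exact fun {I} hI => hall I hI
      obtain ⟨P, hP, hxP⟩ := this
      have : IsArtinianRing B := IsArtinianRing.of_finite ℂ B
      have hmax : P.IsMaximal := IsArtinianRing.isMaximal_of_isPrime P
      let _ : Field (B ⧸ P) := Ideal.Quotient.field P
      have : Algebra.IsAlgebraic ℂ (B ⧸ P) := Algebra.IsAlgebraic.of_finite ℂ (B ⧸ P)
      let ψ : (B ⧸ P) →ₐ[ℂ] ℂ := IsAlgClosed.lift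
      have h0 : ψ (Ideal.Quotient.mk P x) = 0 := congrFun hx (ψ.comp (Ideal.Quotient.mkₐ ℂ P))
      rw [map_eq_zero, Ideal.Quotient.eq_zero_iff_mem] at h0
      exact hxP h0
    have := LinearMap.finrank_le_finrank_of_injective hinj
    rwa [Module.finrank_fintype_fun_eq_card, ← Nat.card_eq_fintype_card] at this

section

variable {ι : Type*} [Fintype ι]

/-- The third order form measuring the contact of a curve with its flex tangent. -/
def contactForm {S : Type*} [CommRing S] (i j : ι → ℕ) (t : ι → S) : S :=
  (∑ k, (i k : S) * (i k - 1) * (i k - 2) * t k) * (∑ k, (j k : S) * t k) ^ 3 -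
    3 * (∑ k, (i k : S) * (i k - 1) * j k * t k) * (∑ k, (j k : S) * t k) ^ 2 *
      (∑ k, (i k : S) * t k) +
    3 * (∑ k, (i k : S) * (j k * (j k - 1)) * t k) * (∑ k, (j k : S) * t k) *
      (∑ k, (i k : S) * t k) ^ 2 -
    (∑ k, (j k : S) * (j k - 1) * (j k - 2) * t k) * (∑ k, (i k : S) * t k) ^ 3

theorem contactForm_map {S S' : Type*} [CommRing S] [CommRing S'] (φ : S →+* S') (i j : ι → ℕ)
    (t : ι → S) : contactForm i j (fun k => φ (t k)) = φ (contactForm i j t) := by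
  simp only [contactForm, map_sub, map_add, map_mul, map_pow, map_sum, map_natCast, map_ofNat,
    map_one]

/-- If `D` is a derivation of the curve vanishing on its flexes and the contact form is invertible
there, then `D` kills the coordinates. -/
theorem derivation_eq_zero_of_contactForm {S Ω : Type*} [CommRing S] [Algebra ℂ S]
    [AddCommGroup Ω] [Module ℂ Ω] [Module S Ω] [IsScalarTower ℂ S Ω] (D : Derivation ℂ S Ω)
    (i j : ι → ℕ) (t : ι → S) (ξ η : Ω)
    (hD : ∀ k, D (t k) = t k • ((i k : S) • ξ + (j k : S) • η)) (h0 : ∑ k, t k = 0)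
    (h1 : flexForm i j t = 0) (h2 : IsUnit (contactForm i j t)) : ξ = 0 ∧ η = 0 := by
  have hE (w : ι → S) (hw : ∀ k, D (w k) = 0) : D (∑ k, w k * t k) =
      (∑ k, w k * i k * t k) • ξ + (∑ k, w k * j k * t k) • η := by
    rw [map_sum, Finset.sum_smul, Finset.sum_smul, ← Finset.sum_add_distrib]
    refine Finset.sum_congr rfl fun k _ => ?_
    rw [Derivation.leibniz, hw, hD, smul_zero, add_zero]
    module
  have hnat (n : ℕ) : D (n : S) = 0 := D.map_natCast n
  set e10 := ∑ k, (i k : S) * t k with he10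
  set e01 := ∑ k, (j k : S) * t k with he01
  set e20 := ∑ k, (i k : S) * (i k - 1) * t k with he20
  set e11 := ∑ k, (i k : S) * j k * t k with he11
  set e02 := ∑ k, (j k : S) * (j k - 1) * t k with he02
  set e30 := ∑ k, (i k : S) * (i k - 1) * (i k - 2) * t k with he30
  set e21 := ∑ k, (i k : S) * (i k - 1) * j k * t k with he21
  set e12 := ∑ k, (i k : S) * (j k * (j k - 1)) * t k with he12
  set e03 := ∑ k, (j k : S) * (j k - 1) * (j k - 2) * t k with he03
  have d00 : (0 : Ω) = e10 • ξ + e01 • η := by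
    have := hE (fun _ => 1) (fun _ => D.map_one_eq_zero)
    simpa only [one_mul, h0, map_zero] using this
  have d10 : D e10 = (e20 + e10) • ξ + e11 • η := by
    rw [he10, hE _ fun k => hnat _, he20, he11, ← Finset.sum_add_distrib]
    congr 2
    exact Finset.sum_congr rfl fun k _ => by ring
  have d01 : D e01 = e11 • ξ + (e02 + e01) • η := by
    rw [he01, hE _ fun k => hnat _, he02, he11, ← Finset.sum_add_distrib]
    congr 2
    · exact Finset.sum_congr rfl fun k _ => by ring
    · exact Finset.sum_congr rfl fun k _ => by ring
  have d20 : D e20 = (e30 + 2 * e20) • ξ + e21 • η := by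
    rw [he20, hE _ fun k => by simp [Derivation.leibniz, hnat], he30, he21, Finset.mul_sum,
      ← Finset.sum_add_distrib]
    congr 2
    exact Finset.sum_congr rfl fun k _ => by ring
  have d11 : D e11 = (e21 + e11) • ξ + (e12 + e11) • η := by
    rw [he11, hE _ fun k => by simp [Derivation.leibniz, hnat], he12, he21,
      ← Finset.sum_add_distrib, ← Finset.sum_add_distrib]
    congr 2
    · exact Finset.sum_congr rfl fun k _ => by ring
    · exact Finset.sum_congr rfl fun k _ => by ring
  have d02 : D e02 = e12 • ξ + (e03 + 2 * e02) • η := by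
    rw [he02, hE _ fun k => by simp [Derivation.leibniz, hnat], he03, he12, Finset.mul_sum,
      ← Finset.sum_add_distrib]
    congr 2
    · exact Finset.sum_congr rfl fun k _ => by ring
    · exact Finset.sum_congr rfl fun k _ => by ring
  have hh : e20 * e01 ^ 2 - 2 * e11 * e10 * e01 + e02 * e10 ^ 2 = 0 := h1
  have hC : IsUnit (e30 * e01 ^ 3 - 3 * e21 * e01 ^ 2 * e10 + 3 * e12 * e01 * e10 ^ 2 -
    e03 * e10 ^ 3) := h2
  set H1 := (e30 + 2 * e20) * e01 ^ 2 + 2 * e20 * e01 * e11 - 2 * (e21 + e11) * e10 * e01 -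
    2 * e11 * (e20 + e10) * e01 - 2 * e11 * e10 * e11 + e12 * e10 ^ 2 +
    2 * e02 * e10 * (e20 + e10) with hH1
  set H2 := e21 * e01 ^ 2 + 2 * e20 * e01 * (e02 + e01) - 2 * (e12 + e11) * e10 * e01 -
    2 * e11 * e11 * e01 - 2 * e11 * e10 * (e02 + e01) + (e03 + 2 * e02) * e10 ^ 2 +
    2 * e02 * e10 * e11 with hH2
  have hDh : (0 : Ω) = H1 • ξ + H2 • η := by
    have h := congrArg D hh
    have h2' : D (2 : S) = 0 := by simpa using hnat 2
    simp only [map_sub, map_add, Derivation.leibniz, Derivation.leibniz_pow, map_zero, d20, d11,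
      d02, d10, d01, h2'] at h
    rw [← h, hH1, hH2]
    simp only [smul_zero]
    module
  have hJ : e01 * H1 - e10 * H2 = e30 * e01 ^ 3 - 3 * e21 * e01 ^ 2 * e10 +
      3 * e12 * e01 * e10 ^ 2 - e03 * e10 ^ 3 := by
    rw [hH1, hH2]
    linear_combination 2 * (e01 - e10) * hh
  rw [← hJ] at hC
  constructor
  · rw [← hC.smul_eq_zero]
    have : (e01 * H1 - e10 * H2) • ξ = e01 • (H1 • ξ + H2 • η) - H2 • (e10 • ξ + e01 • η) := by
      module
    rw [this, ← hDh, ← d00, smul_zero, smul_zero, sub_zero]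
  · rw [← hC.smul_eq_zero]
    have : (e01 * H1 - e10 * H2) • η = H1 • (e10 • ξ + e01 • η) - e10 • (H1 • ξ + H2 • η) := by
      module
    rw [this, ← hDh, ← d00, smul_zero, smul_zero, sub_zero]

variable (a : ι → ℂ) (i j l : ι → ℕ) (p q : ι)

/-- The flexes of `∑ aₖ x ^ iₖ y ^ jₖ` in the torus, as solutions of two equations. -/
def flexSet : Set (ℂ × ℂ) :=
  {z | (z.1 ≠ 0 ∧ z.2 ≠ 0) ∧ ∑ k, a k * z.1 ^ i k * z.2 ^ j k = 0 ∧
    flexForm i j (fun k => a k * z.1 ^ i k * z.2 ^ j k) = 0}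

variable {a i j l p q}

/-- The class of `w` in the flex algebra. -/
def flexRoot : FlexAlgebra a i j l p q := Ideal.Quotient.mk _ (AdjoinRoot.root _)

/-- The class of a Laurent polynomial in the flex algebra. -/
def flexOf : LaurentPolynomial ℂ →ₐ[ℂ] FlexAlgebra a i j l p q :=
  (Ideal.Quotient.mkₐ ℂ _).comp (IsScalarTower.toAlgHom ℂ _ (AdjoinRoot (torusPoly a i l p q)))

theorem flexOf_torusTerm (k : ι) :
    Ideal.Quotient.mk (Ideal.span {flexForm i j (torusTerm a i l p q)}) (torusTerm a i l p q k) =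
      flexOf (LaurentPolynomial.C (a k) * LaurentPolynomial.T (i k)) * flexRoot ^ l k := by
  rw [torusTerm, RingHom.map_mul, map_pow]
  rfl

theorem isUnit_flexRoot (haq : a q ≠ 0) (hap : a p ≠ 0) (hp : ∀ k, k ≠ p → l p < l k) :
    IsUnit (flexRoot : FlexAlgebra a i j l p q) := by
  have h : IsUnit (AdjoinRoot.root (torusPoly a i l p q)) := by
    have h1 : AdjoinRoot.mk (torusPoly a i l p q) ((torusPoly a i l p q).divX * Polynomial.X +
        Polynomial.C ((torusPoly a i l p q).coeff 0)) = 0 := by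
      rw [Polynomial.divX_mul_X_add, AdjoinRoot.mk_self]
    rw [RingHom.map_add, RingHom.map_mul, AdjoinRoot.mk_X, AdjoinRoot.mk_C] at h1
    have h2 : IsUnit (-(AdjoinRoot.of (torusPoly a i l p q)) ((torusPoly a i l p q).coeff 0)) :=
      ((isUnit_coeff_torusPoly_zero haq hap hp).map _).neg
    rw [← eq_neg_of_add_eq_zero_left h1] at h2
    exact isUnit_of_mul_isUnit_right h2
  exact h.map (Ideal.Quotient.mk _)

theorem algHom_flexOf (ψ : FlexAlgebra a i j l p q →ₐ[ℂ] ℂ) (k : ι) :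
    ψ (flexOf (LaurentPolynomial.C (a k) * LaurentPolynomial.T (i k))) =
      a k * ψ (flexOf (LaurentPolynomial.T 1)) ^ i k := by
  have h1 : (LaurentPolynomial.T (i k) : LaurentPolynomial ℂ) = LaurentPolynomial.T 1 ^ i k := by
    rw [LaurentPolynomial.T_pow, mul_one]
  rw [h1, map_mul, map_mul, map_pow, map_pow]
  congr 1
  have h2 : (LaurentPolynomial.C (a k) : LaurentPolynomial ℂ) = algebraMap ℂ _ (a k) := rfl
  rw [h2, AlgHom.commutes, AlgHom.commutes]
  rfl

theorem sum_flexOf (haq : a q ≠ 0) (hp : ∀ k, l p ≤ l k) :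
    ∑ k, flexOf (LaurentPolynomial.C (a k) * LaurentPolynomial.T (i k)) *
      (flexRoot : FlexAlgebra a i j l p q) ^ l k = 0 := by
  have h := congrArg (Ideal.Quotient.mk (Ideal.span {flexForm i j (torusTerm a i l p q)}))
    (sum_torusTerm (i := i) haq hp)
  rw [map_sum, map_zero] at h
  rw [← h]
  exact Finset.sum_congr rfl fun k _ => (flexOf_torusTerm k).symm

theorem flexForm_flexOf : flexForm i j (fun k =>
    flexOf (LaurentPolynomial.C (a k) * LaurentPolynomial.T (i k)) *
      (flexRoot : FlexAlgebra a i j l p q) ^ l k) = 0 := by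
  have h : (fun k => flexOf (LaurentPolynomial.C (a k) * LaurentPolynomial.T (i k)) *
      (flexRoot : FlexAlgebra a i j l p q) ^ l k) = fun k =>
      Ideal.Quotient.mk (Ideal.span {flexForm i j (torusTerm a i l p q)}) (torusTerm a i l p q k) :=
    funext fun k => (flexOf_torusTerm k).symm
  rw [h, flexForm_map, Ideal.Quotient.eq_zero_iff_mem]
  exact Ideal.mem_span_singleton_self _

/-- An algebra homomorphism gives a point of the flex set. -/
theorem mem_flexSet_of_algHom (s : ℕ) (hl : ∀ k, l k = s * i k + j k) (haq : a q ≠ 0)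
    (hap : a p ≠ 0)
    (hp : ∀ k, k ≠ p → l p < l k) (ψ : FlexAlgebra a i j l p q →ₐ[ℂ] ℂ) :
    (ψ (flexOf (LaurentPolynomial.T 1)) * ψ flexRoot ^ s, ψ flexRoot) ∈ flexSet a i j ∧
    ∀ k, a k * (ψ (flexOf (LaurentPolynomial.T 1)) * ψ flexRoot ^ s) ^ i k * ψ flexRoot ^ j k =
      ψ (flexOf (LaurentPolynomial.C (a k) * LaurentPolynomial.T (i k)) * flexRoot ^ l k) := by
  have hT : ψ (flexOf (LaurentPolynomial.T 1)) ≠ 0 :=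
    (((LaurentPolynomial.isUnit_T 1).map _).map ψ).ne_zero
  have hw : ψ flexRoot ≠ 0 := ((isUnit_flexRoot haq hap hp).map ψ).ne_zero
  have hp' : ∀ k, l p ≤ l k := fun k => (eq_or_ne k p).elim (fun h => h ▸ le_rfl) fun h =>
      (hp k h).le
  have hterm : ∀ k, a k * (ψ (flexOf (LaurentPolynomial.T 1)) * ψ flexRoot ^ s) ^ i k *
      ψ flexRoot ^ j k =
      ψ (flexOf (LaurentPolynomial.C (a k) * LaurentPolynomial.T (i k)) * flexRoot ^ l k) := by
    intro k
    rw [map_mul ψ, algHom_flexOf, map_pow, hl, pow_add, pow_mul]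
    ring
  refine ⟨⟨⟨mul_ne_zero hT (pow_ne_zero _ hw), hw⟩, ?_, ?_⟩, hterm⟩
  · simp only [hterm]
    rw [← map_sum, sum_flexOf haq hp', map_zero]
  · simp only [hterm]
    have := flexForm_map (ψ : FlexAlgebra a i j l p q →+* ℂ) i j (fun k => flexOf
      (LaurentPolynomial.C (a k) * LaurentPolynomial.T (i k)) * flexRoot ^ l k)
    simp only [RingHom.coe_coe] at this
    rw [this, flexForm_flexOf, map_zero]

/-- Two linear maps agreeing on monomials agree on the flex algebra. -/
theorem flexAlgebra_induction {Q : FlexAlgebra a i j l p q → Prop}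
    (hadd : ∀ x y, Q x → Q y → Q (x + y)) (hmul : ∀ x y, Q x → Q y → Q (x * y))
    (hC : ∀ c : ℂ, Q (algebraMap ℂ _ c)) (hT : ∀ n, Q (flexOf (LaurentPolynomial.T n)))
    (hw : Q flexRoot) (x) : Q x := by
  obtain ⟨x, rfl⟩ := Ideal.Quotient.mk_surjective x
  obtain ⟨f, rfl⟩ := AdjoinRoot.mk_surjective x
  have hof (r : LaurentPolynomial ℂ) : Q (flexOf r) := by
    induction r using LaurentPolynomial.induction_on' with
    | add f g hf hg => rw [map_add]; exact hadd _ _ hf hg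
    | C_mul_T n c =>
      rw [map_mul]
      refine hmul _ _ ?_ (hT n)
      have h2 : (LaurentPolynomial.C c : LaurentPolynomial ℂ) = algebraMap ℂ _ c := rfl
      rw [h2, AlgHom.commutes]
      exact hC c
  induction f using Polynomial.induction_on with
  | C r => exact hof r
  | add f g hf hg => rw [RingHom.map_add, RingHom.map_add]; exact hadd _ _ hf hg
  | monomial n r h =>
    rw [pow_succ, ← mul_assoc, RingHom.map_mul, RingHom.map_mul]
    exact hmul _ _ h hw

theorem isReduced_flexAlgebra (s : ℕ) (hl : ∀ k, l k = s * i k + j k) (haq : a q ≠ 0)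
    (hap : a p ≠ 0) (hp : ∀ k, k ≠ p → l p < l k)
    [Module.Finite ℂ (FlexAlgebra a i j l p q)]
    (hcontact : ∀ z ∈ flexSet a i j, contactForm i j (fun k => a k * z.1 ^ i k * z.2 ^ j k) ≠ 0) :
    IsReduced (FlexAlgebra a i j l p q) := by
  have hp' : ∀ k, l p ≤ l k := fun k => (eq_or_ne k p).elim (fun h => h ▸ le_rfl) fun h =>
      (hp k h).le
  set t : ι → FlexAlgebra a i j l p q := fun k =>
    flexOf (LaurentPolynomial.C (a k) * LaurentPolynomial.T (i k)) * flexRoot ^ l k with ht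
  have hunit : IsUnit (contactForm i j t) := by
    by_contra hn
    obtain ⟨P, hP, hxP⟩ := exists_max_ideal_of_mem_nonunits hn
    let _ : Field (FlexAlgebra a i j l p q ⧸ P) := Ideal.Quotient.field P
    have : Algebra.IsAlgebraic ℂ (FlexAlgebra a i j l p q ⧸ P) := Algebra.IsAlgebraic.of_finite ℂ _
    let ψ' : (FlexAlgebra a i j l p q ⧸ P) →ₐ[ℂ] ℂ := IsAlgClosed.lift
    let ψ := ψ'.comp (Ideal.Quotient.mkₐ ℂ P)
    obtain ⟨hz, hterm⟩ := mem_flexSet_of_algHom s hl haq hap hp ψ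
    refine hcontact _ hz ?_
    simp only [hterm]
    have := contactForm_map (ψ : FlexAlgebra a i j l p q →+* ℂ) i j t
    simp only [RingHom.coe_coe] at this
    rw [this]
    change ψ' (Ideal.Quotient.mk P (contactForm i j t)) = 0
    rw [Ideal.Quotient.eq_zero_iff_mem.2 hxP, map_zero]
  have hsub : Subsingleton (Ω[FlexAlgebra a i j l p q⁄ℂ]) := by
    set D := KaehlerDifferential.D ℂ (FlexAlgebra a i j l p q)
    obtain ⟨w, hw⟩ : IsUnit (flexRoot : FlexAlgebra a i j l p q) := isUnit_flexRoot haq hap hp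
    have hTinv (n : ℤ) : (flexOf (LaurentPolynomial.T n) : FlexAlgebra a i j l p q) *
        flexOf (LaurentPolynomial.T (-n)) = 1 := by
      rw [← map_mul, ← LaurentPolynomial.T_add, add_neg_cancel, LaurentPolynomial.T_zero, map_one]
    set θ := (flexOf (LaurentPolynomial.T (-1)) : FlexAlgebra a i j l p q) •
      D (flexOf (LaurentPolynomial.T 1) : FlexAlgebra a i j l p q) with hθ
    set η := (↑w⁻¹ : FlexAlgebra a i j l p q) • D (flexRoot : FlexAlgebra a i j l p q) with hη
    have hDw : D (flexRoot : FlexAlgebra a i j l p q) =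
        (flexRoot : FlexAlgebra a i j l p q) • η := by
      rw [hη, smul_smul, ← hw, Units.mul_inv, one_smul]
    have hDT : D (flexOf (LaurentPolynomial.T 1) : FlexAlgebra a i j l p q) =
        (flexOf (LaurentPolynomial.T 1) : FlexAlgebra a i j l p q) • θ := by
      rw [hθ, smul_smul, hTinv, one_smul]
    have hpow (x : FlexAlgebra a i j l p q) (y : Ω[FlexAlgebra a i j l p q⁄ℂ]) (h : D x = x • y)
        (n : ℕ) : D (x ^ n) = (n * x ^ n) • y := by
      induction n with
      | zero => simp
      | succ n ih =>
        rw [pow_succ, Derivation.leibniz, ih, h]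
        push_cast
        module
    have hDt (k : ι) : D (t k) =
        t k • ((i k : FlexAlgebra a i j l p q) • (θ + (s : FlexAlgebra a i j l p q) • η) +
        (j k : FlexAlgebra a i j l p q) • η) := by
      have h1 : (LaurentPolynomial.T (i k) : LaurentPolynomial ℂ) =
          LaurentPolynomial.T 1 ^ i k := by
        rw [LaurentPolynomial.T_pow, mul_one]
      have h2 : (LaurentPolynomial.C (a k) : LaurentPolynomial ℂ) = algebraMap ℂ _ (a k) := rfl
      simp only [ht]
      rw [map_mul (flexOf : _ →ₐ[ℂ] FlexAlgebra a i j l p q), h1, h2, AlgHom.commutes,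
        map_pow (flexOf : _ →ₐ[ℂ] FlexAlgebra a i j l p q), Derivation.leibniz,
        Derivation.leibniz, Derivation.map_algebraMap, hpow _ _ hDT, hpow _ _ hDw, hl]
      push_cast
      module
    obtain ⟨hξ, hη0⟩ := derivation_eq_zero_of_contactForm D i j t _ η hDt (sum_flexOf haq hp')
      flexForm_flexOf hunit
    rw [hη0, smul_zero, add_zero] at hξ
    have hT (n : ℕ) : D (flexOf (LaurentPolynomial.T n)) = 0 := by
      have h1 : (LaurentPolynomial.T n : LaurentPolynomial ℂ) = LaurentPolynomial.T 1 ^ n := by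
        rw [LaurentPolynomial.T_pow, mul_one]
      rw [h1, map_pow, hpow _ _ hDT, hξ, smul_zero]
    have hD (x) : D x = 0 := by
      refine flexAlgebra_induction (Q := fun x => D x = 0)
        (fun x y hx hy => by rw [map_add, hx, hy, add_zero])
        (fun x y hx hy => by rw [Derivation.leibniz, hx, hy, smul_zero, smul_zero, add_zero])
        (fun c => D.map_algebraMap c) (fun n => ?_) (by rw [hDw, hη0, smul_zero]) x
      obtain ⟨m, rfl | rfl⟩ := n.eq_nat_or_neg
      · exact hT m
      · have := congrArg D (hTinv m)
        rw [Derivation.leibniz, hT, smul_zero, add_zero, Derivation.map_one_eq_zero] at this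
        have h2 := congrArg (fun y =>
            (flexOf (LaurentPolynomial.T (-(m : ℤ))) : FlexAlgebra a i j l p q) • y) this
        simp only [smul_zero, smul_smul] at h2
        rwa [mul_comm, hTinv, one_smul] at h2
    have htop := KaehlerDifferential.span_range_derivation ℂ (FlexAlgebra a i j l p q)
    rw [Submodule.span_eq_bot.2 (by rintro _ ⟨x, rfl⟩; exact hD x)] at htop
    exact (Submodule.subsingleton_iff (FlexAlgebra a i j l p q)).1 (subsingleton_of_bot_eq_top htop)
  have : Algebra.FormallyUnramified ℂ (FlexAlgebra a i j l p q) := ⟨hsub⟩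
  exact Algebra.FormallyUnramified.isReduced_of_field ℂ _

/-- The number of flexes in the torus is the dimension of the flex algebra. -/
theorem ncard_flexSet (s : ℕ) (hl : ∀ k, l k = s * i k + j k) (haq : a q ≠ 0)
    (hap : a p ≠ 0) (hp : ∀ k, k ≠ p → l p < l k)
    (hfin : Module.Finite ℂ (FlexAlgebra a i j l p q))
    (hcontact : ∀ z ∈ flexSet a i j, contactForm i j (fun k => a k * z.1 ^ i k * z.2 ^ j k) ≠ 0) :
    (flexSet a i j).Finite ∧
      (flexSet a i j).ncard = Module.finrank ℂ (FlexAlgebra a i j l p q) := by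
  have hp' : ∀ k, l p ≤ l k := fun k => (eq_or_ne k p).elim (fun h => h ▸ le_rfl) fun h =>
      (hp k h).le
  have hred := isReduced_flexAlgebra s hl haq hap hp hcontact
  let Φ : (FlexAlgebra a i j l p q →ₐ[ℂ] ℂ) → flexSet a i j := fun ψ =>
    ⟨_, (mem_flexSet_of_algHom s hl haq hap hp ψ).1⟩
  have hΦ : Function.Bijective Φ := by
    constructor
    · intro ψ χ h
      have hw : ψ flexRoot = χ flexRoot := congrArg (fun z => z.1.2) h
      have h1 : ψ (flexOf (LaurentPolynomial.T 1)) * ψ flexRoot ^ s =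
        χ (flexOf (LaurentPolynomial.T 1)) * χ flexRoot ^ s := congrArg (fun z => z.1.1) h
      have hw0 : χ flexRoot ≠ 0 := ((isUnit_flexRoot haq hap hp).map χ).ne_zero
      rw [hw] at h1
      have hT1 := mul_right_cancel₀ (pow_ne_zero _ hw0) h1
      have hT (n : ℕ) : ψ (flexOf (LaurentPolynomial.T n)) =
          χ (flexOf (LaurentPolynomial.T n)) := by
        have h1 : (LaurentPolynomial.T n : LaurentPolynomial ℂ) = LaurentPolynomial.T 1 ^ n := by
          rw [LaurentPolynomial.T_pow, mul_one]
        rw [h1, map_pow, map_pow, map_pow, hT1]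
      ext x
      refine flexAlgebra_induction (Q := fun x => ψ x = χ x)
        (fun x y hx hy => by rw [map_add, map_add, hx, hy])
        (fun x y hx hy => by rw [map_mul, map_mul, hx, hy])
        (fun c => by rw [AlgHom.commutes, AlgHom.commutes]) (fun n => ?_) hw x
      obtain ⟨m, rfl | rfl⟩ := n.eq_nat_or_neg
      · exact hT m
      · have hinv (φ : FlexAlgebra a i j l p q →ₐ[ℂ] ℂ) :
          φ (flexOf (LaurentPolynomial.T (-(m : ℤ)))) =
            (φ (flexOf (LaurentPolynomial.T m)))⁻¹ := by
          refine eq_inv_of_mul_eq_one_left ?_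
          rw [← map_mul, ← map_mul, ← LaurentPolynomial.T_add, neg_add_cancel,
            LaurentPolynomial.T_zero, map_one, map_one]
        rw [hinv, hinv, hT]
    · rintro ⟨⟨x, y⟩, ⟨hx, hy⟩, h0, h1⟩
      simp only at hx hy h0 h1
      have hc : x * (y ^ s)⁻¹ ≠ 0 := mul_ne_zero hx (inv_ne_zero (pow_ne_zero _ hy))
      let φ : LaurentPolynomial ℂ →+* ℂ := LaurentPolynomial.eval₂ (RingHom.id ℂ) (Units.mk0 _ hc)
      have hφC (c : ℂ) : φ (LaurentPolynomial.C c) = c := LaurentPolynomial.eval₂_C _ _ _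
      have hφT (n : ℕ) : φ (LaurentPolynomial.T n) = (x * (y ^ s)⁻¹) ^ n :=
        LaurentPolynomial.eval₂_T_n _ _ _
      have hterm (k : ι) : φ (LaurentPolynomial.C (a k) * LaurentPolynomial.T (i k)) * y ^ l k =
          a k * x ^ i k * y ^ j k := by
        rw [map_mul, hφC, hφT, hl, pow_add, pow_mul, ← mul_assoc, mul_assoc (a k), ← mul_pow,
          inv_mul_cancel_right₀ (pow_ne_zero _ hy)]
      have hroot : (torusPoly a i l p q).eval₂ φ y = 0 := by
        have h := eval₂_torusPoly (i := i) φ y haq hp'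
        simp only [hterm] at h
        rw [h0] at h
        refine (mul_eq_zero.1 h).resolve_left (mul_ne_zero ?_ (pow_ne_zero _ hy))
        rw [map_mul, hφC, hφT]
        exact mul_ne_zero haq (pow_ne_zero _ hc)
      let e : AdjoinRoot (torusPoly a i l p q) →+* ℂ := AdjoinRoot.lift φ y hroot
      have he (k : ι) : e (torusTerm a i l p q k) = a k * x ^ i k * y ^ j k := by
        rw [torusTerm, RingHom.map_mul, map_pow, AdjoinRoot.lift_root, AdjoinRoot.lift_of, hterm]
      let ψ' : FlexAlgebra a i j l p q →+* ℂ := Ideal.Quotient.lift _ e (by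
        intro b hb
        obtain ⟨b, rfl⟩ := Ideal.mem_span_singleton.1 hb
        rw [RingHom.map_mul, ← flexForm_map]
        simp only [he]
        rw [h1, zero_mul])
      have hψ (x : AdjoinRoot (torusPoly a i l p q)) : ψ' (Ideal.Quotient.mk _ x) = e x := rfl
      let ψ : FlexAlgebra a i j l p q →ₐ[ℂ] ℂ := { ψ' with
        commutes' := fun c => by
          change e (AdjoinRoot.of _ (LaurentPolynomial.C c)) = c
          rw [AdjoinRoot.lift_of, hφC] }
      have hψw : ψ flexRoot = y := AdjoinRoot.lift_root hroot
      have hψT : ψ (flexOf (LaurentPolynomial.T 1)) = x * (y ^ s)⁻¹ := by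
        change e (AdjoinRoot.of _ (LaurentPolynomial.T 1)) = _
        rw [AdjoinRoot.lift_of]
        have := hφT 1
        rwa [pow_one, Nat.cast_one] at this
      refine ⟨ψ, Subtype.ext (Prod.ext ?_ hψw)⟩
      change ψ (flexOf (LaurentPolynomial.T 1)) * ψ flexRoot ^ s = x
      rw [hψT, hψw]
      field_simp
  obtain ⟨hfinite, hcard⟩ := natCard_algHom_eq_finrank (B := FlexAlgebra a i j l p q)
  refine ⟨?_, ?_⟩
  · have : Finite (flexSet a i j) := Finite.of_equiv _ (Equiv.ofBijective Φ hΦ)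
    exact Set.toFinite _
  · rw [← hcard, ← Nat.card_coe_set_eq]
    exact (Nat.card_congr (Equiv.ofBijective Φ hΦ)).symm

end

/-- A polynomial `∑ aₖ X ^ lₖ` with simple nonzero roots has `max l - min l` of them. -/
theorem exists_injOn_roots {ι : Type*} (F : Finset ι) (a : ι → ℂ) (l : ι → ℕ)
    (hl : Function.Injective l) (ha : ∀ k, a k ≠ 0)
    (hF : ∀ ζ ≠ 0, ∑ k ∈ F, a k * ζ ^ l k = 0 → ∑ k ∈ F, l k * (a k * ζ ^ l k) ≠ 0) :
    ∃ ρ : ℕ → ℂ, (∀ m, (∃ u ∈ F, ∃ v ∈ F, l u ≤ m ∧ m < l v) →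
      ρ m ≠ 0 ∧ ∑ k ∈ F, a k * ρ m ^ l k = 0) ∧
      ∀ m m', (∃ u ∈ F, ∃ v ∈ F, l u ≤ m ∧ m < l v) → (∃ u ∈ F, ∃ v ∈ F, l u ≤ m' ∧ m' < l v) →
        ρ m = ρ m' → m = m' := by
  classical
  rcases F.eq_empty_or_nonempty with rfl | hne
  · exact ⟨fun _ => 1, by simp, by simp⟩
  obtain ⟨p, hp, hpmin⟩ := F.exists_min_image l hne
  obtain ⟨q, hq, hqmax⟩ := F.exists_max_image l hne
  set Q : Polynomial ℂ := ∑ k ∈ F, Polynomial.monomial (l k - l p) (a k) with hQ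
  have heval (ζ : ℂ) : ζ ^ l p * Q.eval ζ = ∑ k ∈ F, a k * ζ ^ l k := by
    rw [hQ, Polynomial.eval_finsetSum, Finset.mul_sum]
    refine Finset.sum_congr rfl fun k hk => ?_
    rw [Polynomial.eval_monomial, mul_left_comm, ← pow_add, Nat.add_sub_cancel' (hpmin k hk)]
  have hder (ζ : ℂ) : ζ ^ (l p + 1) * Q.derivative.eval ζ =
      ∑ k ∈ F, l k * (a k * ζ ^ l k) - l p * ∑ k ∈ F, a k * ζ ^ l k := by
    rw [hQ, Polynomial.derivative_sum, Polynomial.eval_finsetSum, Finset.mul_sum, Finset.mul_sum,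
      ← Finset.sum_sub_distrib]
    refine Finset.sum_congr rfl fun k hk => ?_
    rw [Polynomial.derivative_monomial, Polynomial.eval_monomial]
    obtain ⟨r, hr⟩ := Nat.exists_eq_add_of_le (hpmin k hk)
    rw [hr, Nat.add_sub_cancel_left]
    rcases r with _ | r
    · simp
    · push_cast
      ring
  have hcoeff (k) (hk : k ∈ F) : Q.coeff (l k - l p) = a k := by
    rw [hQ, Polynomial.finsetSum_coeff, Finset.sum_eq_single k]
    · simp
    · intro b hb hbk
      rw [Polynomial.coeff_monomial, if_neg]
      intro h
      have := hpmin b hb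
      have := hpmin k hk
      exact hbk (hl (by omega))
    · exact fun h => absurd hk h
  have hQ0 : Q ≠ 0 := fun h => ha p (by rw [← hcoeff p hp, h, Polynomial.coeff_zero])
  have hdeg : Q.natDegree = l q - l p := by
    refine le_antisymm (Polynomial.natDegree_sum_le_of_forall_le _ _ fun k hk => ?_)
      (Polynomial.le_natDegree_of_ne_zero (by rw [hcoeff q hq]; exact ha q))
    exact (Polynomial.natDegree_monomial_le _).trans (Nat.sub_le_sub_right (hqmax k hk) _)
  have hzero (ζ : ℂ) (hζ : Q.eval ζ = 0) : ζ ≠ 0 := by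
    rintro rfl
    rw [← Polynomial.coeff_zero_eq_eval_zero] at hζ
    have := hcoeff p hp
    rw [Nat.sub_self, hζ] at this
    exact ha p this.symm
  have hnodup : Q.roots.Nodup := by
    rw [Multiset.nodup_iff_count_le_one]
    intro ζ
    rw [Polynomial.count_roots]
    by_contra! h
    obtain ⟨h1, h2⟩ := (Polynomial.one_lt_rootMultiplicity_iff_isRoot hQ0).1 h
    have h3 := heval ζ
    have h4 := hder ζ
    rw [Polynomial.IsRoot.def] at h1 h2
    rw [h1, mul_zero] at h3
    rw [h2, mul_zero, ← h3, mul_zero, sub_zero] at h4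
    exact hF ζ (hzero ζ h1) h3.symm h4.symm
  have hcard : Q.roots.toFinset.card = l q - l p := by
    rw [Multiset.toFinset_card_of_nodup hnodup, ← hdeg]
    exact (Polynomial.splits_iff_card_roots.1 (IsAlgClosed.splits Q))
  let e := Q.roots.toFinset.equivFinOfCardEq hcard
  have hlt {m : ℕ} (h : ∃ u ∈ F, ∃ v ∈ F, l u ≤ m ∧ m < l v) : l p ≤ m ∧ m - l p < l q - l p := by
    obtain ⟨u, hu, v, hv, h1, h2⟩ := h
    have := hpmin u hu
    have := hqmax v hv
    omega
  refine ⟨fun m => if h : m - l p < l q - l p then e.symm ⟨_, h⟩ else 0, fun m hm => ?_,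
    fun m m' hm hm' h => ?_⟩
  · simp only [dif_pos (hlt hm).2]
    have hmem := (e.symm ⟨_, (hlt hm).2⟩).2
    rw [Multiset.mem_toFinset, Polynomial.mem_roots hQ0] at hmem
    refine ⟨hzero _ hmem, ?_⟩
    rw [← heval, hmem, mul_zero]
  · simp only [dif_pos (hlt hm).2, dif_pos (hlt hm').2] at h
    have h1 := e.symm.injective (Subtype.ext h)
    rw [Fin.mk.injEq] at h1
    have := (hlt hm).1
    have := (hlt hm').1
    omega

/-- `B` is the slope of a supporting line `e i + B l = g` of the points `(i k, l k)` which touches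
them on both sides of the open interval `(m, m + 1)`. -/
def Supports {ι : Type*} (i l : ι → ℕ) (e : ℤ) (m : ℕ) (B g : ℤ) : Prop :=
  ∃ u v, l u ≤ m ∧ m < l v ∧ e * i u + B * l u = g ∧ e * i v + B * l v = g ∧
    ∀ k, g ≤ e * i k + B * l k

theorem exists_supports {ι : Type*} [Fintype ι] (i l : ι → ℕ) (e : ℤ) (m : ℕ) (p q : ι)
    (hp : l p ≤ m) (hq : m < l q)
    (he : ∀ u v, l u < l v → ((l v - l u : ℕ) : ℤ) ∣ e) : ∃ B g, Supports i l e m B g := by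
  classical
  have hβ (u v) (huv : l u < l v) : ∃ β : ℤ, e * i u + β * l u = e * i v + β * l v := by
    obtain ⟨c, hc⟩ := he u v huv
    refine ⟨c * (i u - i v), ?_⟩
    rw [hc]
    push_cast [huv.le]
    ring
  let L := Finset.univ.filter fun u => l u ≤ m
  let R := Finset.univ.filter fun v => m < l v
  have hlt {u v} (hu : u ∈ L) (hv : v ∈ R) : l u < l v :=
    (Finset.mem_filter.1 hu).2.trans_lt (Finset.mem_filter.1 hv).2
  choose! β hβ using hβ
  have hpL : p ∈ L := Finset.mem_filter.2 ⟨Finset.mem_univ _, hp⟩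
  have hqR : q ∈ R := Finset.mem_filter.2 ⟨Finset.mem_univ _, hq⟩
  choose u huL hu using fun v => L.exists_min_image (fun u => β u v) ⟨p, hpL⟩
  obtain ⟨v, hvR, hv⟩ := R.exists_max_image (fun v => β (u v) v) ⟨q, hqR⟩
  set B := β (u v) v with hB
  have hcmp {u' v'} (hu' : u' ∈ L) (hv' : v' ∈ R) (c : ℤ) :
      (c ≤ β u' v' → e * i v' + c * l v' ≤ e * i u' + c * l u') ∧
      (β u' v' ≤ c → e * i u' + c * l u' ≤ e * i v' + c * l v') := by
    have h1 := hβ u' v' (hlt hu' hv')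
    have h2 : (0 : ℤ) < l v' - l u' := by have := hlt hu' hv'; omega
    constructor <;> intro h
    · nlinarith
    · nlinarith
  have hL (u') (hu' : u' ∈ L) : e * i v + B * l v ≤ e * i u' + B * l u' :=
    (hcmp hu' hvR B).1 (hu v u' hu')
  have hR (v') (hv' : v' ∈ R) : e * i v + B * l v ≤ e * i v' + B * l v' :=
    (hL _ (huL v')).trans ((hcmp (huL v') hv' B).2 (hv v' hv'))
  refine ⟨B, e * i v + B * l v, u v, v, (Finset.mem_filter.1 (huL v)).2,
    (Finset.mem_filter.1 hvR).2, hβ _ _ (hlt (huL v) hvR), rfl, fun k => ?_⟩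
  rcases le_or_gt (l k) m with h | h
  · exact hL k (Finset.mem_filter.2 ⟨Finset.mem_univ _, h⟩)
  · exact hR k (Finset.mem_filter.2 ⟨Finset.mem_univ _, h⟩)

theorem Supports.unique {ι : Type*} {i l : ι → ℕ} {e : ℤ} {m : ℕ} {B g B' g' : ℤ}
    (h : Supports i l e m B g) (h' : Supports i l e m B' g') : B = B' ∧ g = g' := by
  obtain ⟨u, v, hu, hv, hug, hvg, hk⟩ := h
  obtain ⟨u', v', hu', hv', hug', hvg', hk'⟩ := h'
  have h1 := hk u'
  have h2 := hk v'
  have h3 := hk' u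
  have h4 := hk' v
  zify at hu hv hu' hv'
  have hB : B = B' := by
    rcases lt_trichotomy B B' with hlt | heq | hlt
    · nlinarith
    · exact heq
    · nlinarith
  subst hB
  exact ⟨rfl, by linarith⟩

theorem laurentSubst_mul_pow {ι : Type*} (a : ι → ℂ) (i l n : ι → ℕ) (e B g : ℤ)
    (hn : ∀ k, (n k : ℤ) = e * i k + B * l k - g) (U : PowerSeries ℂ) (k : ι) :
    laurentSubst e (LaurentPolynomial.C (a k) * LaurentPolynomial.T (i k)) *
      (HahnSeries.single B 1 * (U : LaurentSeries ℂ)) ^ l k =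
    HahnSeries.single g 1 * HahnSeries.ofPowerSeries ℤ ℂ (psTerm (a k) (n k) (l k) U) := by
  rw [RingHom.map_mul, laurentSubst_C, laurentSubst_T, mul_pow, HahnSeries.single_pow, psTerm,
    RingHom.map_mul, RingHom.map_mul, RingHom.map_pow (HahnSeries.ofPowerSeries ℤ ℂ) U,
      HahnSeries.ofPowerSeries_C,
    HahnSeries.ofPowerSeries_X_pow]
  have h1 : (HahnSeries.single (e * (i k : ℤ)) (1 : ℂ)) * HahnSeries.single (l k • B) (1 ^ l k) =
      HahnSeries.single g 1 * HahnSeries.single (n k : ℤ) 1 := by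
    rw [HahnSeries.single_mul_single, HahnSeries.single_mul_single, hn]
    congr 1
    · rw [nsmul_eq_mul]; ring_nf
    · simp
  calc _ = HahnSeries.C (a k) * ((HahnSeries.single (e * (i k : ℤ)) (1 : ℂ)) *
        HahnSeries.single (l k • B) (1 ^ l k)) * (HahnSeries.ofPowerSeries ℤ ℂ U) ^ l k := by ring
    _ = _ := by rw [h1]; ring

/-- All the Puiseux parametrizations of the curve at one end, with the order of the flex form. -/
theorem exists_puiseux {ι : Type*} [Fintype ι] (a : ι → ℂ) (i j l : ι → ℕ)
    (hl : Function.Injective l) (ha : ∀ k, a k ≠ 0)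
    (hF : ∀ F : Finset ι, 1 < F.card →
      ∀ ζ ≠ 0, ∑ k ∈ F, a k * ζ ^ l k = 0 → ∑ k ∈ F, l k * (a k * ζ ^ l k) ≠ 0)
    (e : ℤ) (p q : ι) (B g : Fin (l q - l p) → ℤ)
    (hBg : ∀ r : Fin (l q - l p), Supports i l e (l p + r) (B r) (g r)) (corr : ℤ → ℕ)
    (hcorr : ∀ m B g, Supports i l e m B g → ∀ n : ι → ℕ, (∀ k, (n k : ℤ) = e * i k + B * l k - g) →
      ∀ U : PowerSeries ℂ, PowerSeries.constantCoeff U ≠ 0 →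
      ∑ k, psTerm (a k) (n k) (l k) U = 0 →
      ∑ k, (if n k = 0 then a k * PowerSeries.constantCoeff U ^ l k else 0) = 0 →
      ∑ k, (if n k = 0 then (l k : ℂ) * (a k * PowerSeries.constantCoeff U ^ l k) else 0) ≠ 0 →
      ∃ W : PowerSeries ℂ, PowerSeries.constantCoeff W ≠ 0 ∧
        flexForm i j (fun k => psTerm (a k) (n k) (l k) U) = PowerSeries.X ^ corr B * W) :
    ∃ z : Fin (l q - l p) → LaurentSeries ℂ, Function.Injective z ∧ (∀ r, z r ≠ 0) ∧
      (∀ r, ∑ k, laurentSubst e (LaurentPolynomial.C (a k) * LaurentPolynomial.T (i k)) *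
        z r ^ l k = 0) ∧
      ∀ r, HasOrd (flexForm i j fun k =>
        laurentSubst e (LaurentPolynomial.C (a k) * LaurentPolynomial.T (i k)) * z r ^ l k)
        (3 * g r + corr (B r)) := by
  classical
  let F (B g : ℤ) : Finset ι := Finset.univ.filter fun k => e * i k + B * l k = g
  have hFcard {m : ℕ} {B g : ℤ} (h : Supports i l e m B g) : 1 < (F B g).card := by
    obtain ⟨u, v, hu, hv, hug, hvg, -⟩ := h
    refine Finset.one_lt_card.2 ⟨u, by simp [F, hug], v, by simp [F, hvg], ?_⟩
    rintro rfl
    omega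
  have hex (B g : ℤ) : ∃ ρ : ℕ → ℂ, 1 < (F B g).card →
      (∀ m, (∃ u ∈ F B g, ∃ v ∈ F B g, l u ≤ m ∧ m < l v) →
      ρ m ≠ 0 ∧ ∑ k ∈ F B g, a k * ρ m ^ l k = 0) ∧
      ∀ m m', (∃ u ∈ F B g, ∃ v ∈ F B g, l u ≤ m ∧ m < l v) →
        (∃ u ∈ F B g, ∃ v ∈ F B g, l u ≤ m' ∧ m' < l v) → ρ m = ρ m' → m = m' := by
    by_cases h : 1 < (F B g).card
    · obtain ⟨ρ, h1, h2⟩ := exists_injOn_roots (F B g) a l hl ha (hF _ h)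
      exact ⟨ρ, fun _ => ⟨h1, h2⟩⟩
    · exact ⟨fun _ => 0, fun h' => absurd h' h⟩
  choose ρ hρ using hex
  have hmem {m : ℕ} {B g : ℤ} (h : Supports i l e m B g) :
      ∃ u ∈ F B g, ∃ v ∈ F B g, l u ≤ m ∧ m < l v := by
    obtain ⟨u, v, hu, hv, hug, hvg, -⟩ := h
    exact ⟨u, by simp [F, hug], v, by simp [F, hvg], hu, hv⟩
  have hbranch (r : Fin (l q - l p)) : ∃ (n : ι → ℕ) (U : PowerSeries ℂ),
      (∀ k, (n k : ℤ) = e * i k + B r * l k - g r) ∧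
      PowerSeries.constantCoeff U = ρ (B r) (g r) (l p + r) ∧ PowerSeries.constantCoeff U ≠ 0 ∧
      ∑ k, psTerm (a k) (n k) (l k) U = 0 ∧
      ∑ k, (if n k = 0 then a k * PowerSeries.constantCoeff U ^ l k else 0) = 0 ∧
      ∑ k, (if n k = 0 then (l k : ℂ) * (a k * PowerSeries.constantCoeff U ^ l k) else 0) ≠ 0 := by
    have hS := hBg r
    obtain ⟨h1, h2⟩ := (hρ (B r) (g r) (hFcard hS)).1 _ (hmem hS)
    obtain ⟨-, -, -, -, -, -, hg⟩ := hS
    have hn (k) : ((e * i k + B r * l k - g r).toNat : ℤ) = e * i k + B r * l k - g r :=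
      Int.toNat_of_nonneg (by linarith [hg k])
    have hn0 (k) : (e * i k + B r * l k - g r).toNat = 0 ↔ e * i k + B r * l k = g r := by
      have := hn k
      omega
    have h3 := hF _ (hFcard (hBg r)) _ h1 h2
    simp only [F, Finset.sum_filter] at h2 h3
    simp only [← hn0] at h2 h3
    obtain ⟨U, hU, hU0⟩ := exists_branch a (fun k => (e * i k + B r * l k - g r).toNat) l _ h2 h3
    exact ⟨_, U, hn, hU, by rwa [hU], hU0, by rwa [hU], by rwa [hU]⟩
  choose n U hn hUρ hU0 hUt hUs hUs' using hbranch
  have hord (r) : HasOrd (HahnSeries.single (B r) 1 * (U r : LaurentSeries ℂ)) (B r) :=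
    ⟨U r, hU0 r, rfl⟩
  refine ⟨fun r => HahnSeries.single (B r) 1 * (U r : LaurentSeries ℂ), fun r r' h => ?_,
    fun r => (hord r).ne_zero, fun r => ?_, fun r => ?_⟩
  · simp only at h
    have hB : B r = B r' := (hord r).unique (h ▸ hord r')
    have hg : g r = g r' := by
      have h1 := hBg r
      have h2 := hBg r'
      rw [← hB] at h2
      obtain ⟨u, -, -, -, hu, -, hk⟩ := h1
      obtain ⟨u', -, -, -, hu', -, hk'⟩ := h2
      linarith [hk u', hk' u]
    rw [hB] at h
    have h1 := mul_left_cancel₀ (HahnSeries.single_ne_zero one_ne_zero) h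
    have h2 : U r = U r' := HahnSeries.ofPowerSeries_injective h1
    have h3 := hUρ r
    rw [h2, hUρ r', hB, hg] at h3
    have h4 := (hρ (B r') (g r') (hFcard (hBg r'))).2 _ _ (hmem (hBg r'))
      (hmem (by have := hBg r; rwa [hB, hg] at this)) h3
    exact Fin.ext (by omega)
  · simp only [laurentSubst_mul_pow a i l (n r) e (B r) (g r) (hn r)]
    rw [← Finset.mul_sum, ← map_sum, hUt, map_zero, mul_zero]
  · simp only [laurentSubst_mul_pow a i l (n r) e (B r) (g r) (hn r)]
    rw [flexForm_mul, flexForm_map]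
    obtain ⟨W, hW, hflex⟩ := hcorr _ _ _ (hBg r) _ (hn r) (U r) (hU0 r) (hUt r) (hUs r) (hUs' r)
    rw [hflex, map_mul, map_pow, HahnSeries.ofPowerSeries_X, HahnSeries.single_pow,
      HahnSeries.single_pow]
    have h1 := hasOrd_single (3 • g r) (one_ne_zero (α := ℂ))
    have h2 := hasOrd_single (corr (B r) • (1 : ℤ)) (one_ne_zero (α := ℂ))
    have h3 := h1.mul (h2.mul (hasOrd_coe hW))
    simpa using h3

section

variable {ι : Type*} [Fintype ι]

/-- Genericity of the second level of the weight `h`, next to its minimal level. -/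
def FirstOrderGeneric (a : ι → ℂ) (l : ι → ℕ) (h : ι → ℤ) : Prop :=
  ∀ u v, u ≠ v → h u = h v → (∀ k, h u ≤ h k) → ∀ ζ : ℂ, ζ ≠ 0 →
    ∑ k, (if h k = h u then a k * ζ ^ l k else 0) = 0 →
    ∑ k, (if h k = h u + 1 then a k * ζ ^ l k else 0) ≠ 0

/-- Genericity of the second and third levels of the weight `h`, next to its minimal level. -/
def SecondOrderGeneric (a : ι → ℂ) (l : ι → ℕ) (h : ι → ℤ) (c : ℂ) : Prop :=
  ∀ u v, u ≠ v → h u = h v → (∀ k, h u ≤ h k) → ∀ ζ : ℂ, ζ ≠ 0 →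
    ∑ k, (if h k = h u then a k * ζ ^ l k else 0) = 0 → ∀ α : ℂ,
    (∑ k, (if h k = h u then (l k : ℂ) * (a k * ζ ^ l k) else 0)) * α +
      (∑ k, (if h k = h u + 1 then a k * ζ ^ l k else 0)) = 0 →
    α * α * (∑ k, (if h k = h u then (l k : ℂ) * (l k : ℂ) * (a k * ζ ^ l k) else 0))
      - c * α * α * (∑ k, (if h k = h u then (l k : ℂ) * (a k * ζ ^ l k) else 0))
      + 2 * α * (∑ k, (if h k = h u + 1 then (l k : ℂ) * (a k * ζ ^ l k) else 0))
      + 2 * (∑ k, (if h k = h u + 2 then a k * ζ ^ l k else 0)) ≠ 0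

/-- The conclusion of the local analysis of a branch with slope `B`. -/
def BranchOrder (a : ι → ℂ) (i j l : ι → ℕ) (e B : ℤ) (c : ℕ) : Prop :=
  ∀ m g, Supports i l e m B g → ∀ n : ι → ℕ, (∀ k, (n k : ℤ) = e * i k + B * l k - g) →
    ∀ U : PowerSeries ℂ, PowerSeries.constantCoeff U ≠ 0 →
    ∑ k, psTerm (a k) (n k) (l k) U = 0 →
    ∑ k, (if n k = 0 then a k * PowerSeries.constantCoeff U ^ l k else 0) = 0 →
    ∑ k, (if n k = 0 then (l k : ℂ) * (a k * PowerSeries.constantCoeff U ^ l k) else 0) ≠ 0 →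
    ∃ W : PowerSeries ℂ, PowerSeries.constantCoeff W ≠ 0 ∧
      flexForm i j (fun k => psTerm (a k) (n k) (l k) U) = PowerSeries.X ^ c * W

theorem Supports.exists_levels {ι : Type*} {i l : ι → ℕ} {e B g : ℤ} {m' : ℕ}
    (hS : Supports i l e m' B g)
    (h : ι → ℤ) {m : ℕ} (hm : 0 < m) (hh : ∀ k, e * i k + B * l k = m * h k)
    {n : ι → ℕ} (hn : ∀ k, (n k : ℤ) = e * i k + B * l k - g) :
    ∃ u v, u ≠ v ∧ h u = h v ∧ (∀ k, h u ≤ h k) ∧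
      ∃ d : ι → ℕ, (∀ k, n k = m * d k) ∧ ∀ k (r : ℕ), d k = r ↔ h k = h u + r := by
  obtain ⟨u, v, hu, hv, hug, hvg, hk⟩ := hS
  have hm' : (0 : ℤ) < m := by exact_mod_cast hm
  have hle (k) : h u ≤ h k := by
    have := hk k
    rw [← hug, hh, hh] at this
    exact le_of_mul_le_mul_left this hm'
  refine ⟨u, v, ?_, ?_, hle, fun k => (h k - h u).toNat, fun k => ?_, fun k r => ?_⟩
  · rintro rfl
    omega
  · rw [← hvg, hh, hh] at hug
    exact mul_left_cancel₀ hm'.ne' hug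
  · zify
    rw [hn, ← hug, hh, hh, Int.toNat_of_nonneg (by linarith [hle k])]
    ring
  · change (h k - h u).toNat = r ↔ _
    have := hle k
    omega

variable {a : ι → ℂ} {i j : ι → ℕ} {s : ℕ} {e B : ℤ}

theorem branchOrder_ordinary (he : e ≠ 0) (h1 : B ≠ 0) (h2 : e + s * B ≠ 0)
    (h3 : e + s * B ≠ B) : BranchOrder a i j (fun k => s * i k + j k) e B 0 := by
  intro m g _ n hn U hU h0 _ hs
  obtain ⟨W, hW, h⟩ := flexForm_psTerm_ordinary a i j n s e B g he hn hU h0 hs h1 h2 h3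
  exact ⟨W, hW, by rw [h, pow_zero, one_mul]⟩

theorem branchOrder_first (h : ι → ℤ) (hgen : FirstOrderGeneric a (fun k => s * i k + j k) h)
    {m : ℕ} (hm : 0 < m) (he : e ≠ 0) (hh : ∀ k, e * i k + B * (s * i k + j k : ℕ) = m * h k)
    (N c c' : ℂ) (hN : N ≠ 0)
    (hω : ∀ u w : PowerSeries ℂ,
      (PowerSeries.C ((e + s * B : ℤ) : ℂ) + (s : PowerSeries ℂ) * u) *
          (PowerSeries.C (B : ℂ) + u) *
        (PowerSeries.C (B : ℂ) - PowerSeries.C ((e + s * B : ℤ) : ℂ) +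
            (1 - (s : PowerSeries ℂ)) * u) +
        PowerSeries.C (e : ℂ) * w =
      PowerSeries.C N * (w + PowerSeries.C (m : ℂ) * u + PowerSeries.C c * u ^ 2)
        + PowerSeries.C c' * u ^ 3) :
    BranchOrder a i j (fun k => s * i k + j k) e B m := by
  intro m' g hS n hn U hU h0 h0' hs
  obtain ⟨u, v, huv, hhuv, hle, d, hd, hlev⟩ := hS.exists_levels h hm hh hn
  obtain rfl : n = fun k => m * d k := funext hd
  have hd0 (k) : m * d k = 0 ↔ h k = h u := by
    rw [mul_eq_zero, or_iff_right hm.ne', hlev, Nat.cast_zero, add_zero]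
  have hd0' (k) : d k = 0 ↔ h k = h u := by rw [hlev, Nat.cast_zero, add_zero]
  simp only [hd0] at h0' hs
  refine flexForm_psTerm_first_order a i j d s m e B g he hm hn hU h0 ?_ N c c' hN hω ?_
  · simpa only [hd0'] using hs
  · simp only [hlev, Nat.cast_one]
    exact hgen u v huv hhuv hle _ hU h0'

theorem branchOrder_second (h : ι → ℤ) (N c c' : ℂ)
    (hgen : SecondOrderGeneric a (fun k => s * i k + j k) h c)
    {m : ℕ} (hm : 0 < m) (he : e ≠ 0) (hh : ∀ k, e * i k + B * (s * i k + j k : ℕ) = m * h k)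
    (hN : N ≠ 0)
    (hω : ∀ u w : PowerSeries ℂ,
      (PowerSeries.C ((e + s * B : ℤ) : ℂ) + (s : PowerSeries ℂ) * u) *
          (PowerSeries.C (B : ℂ) + u) *
        (PowerSeries.C (B : ℂ) - PowerSeries.C ((e + s * B : ℤ) : ℂ) +
            (1 - (s : PowerSeries ℂ)) * u) +
        PowerSeries.C (e : ℂ) * w =
      PowerSeries.C N * (w - PowerSeries.C (m : ℂ) * u + PowerSeries.C c * u ^ 2)
        + PowerSeries.C c' * u ^ 3) :
    BranchOrder a i j (fun k => s * i k + j k) e B (2 * m) := by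
  intro m' g hS n hn U hU h0 h0' hs
  obtain ⟨u, v, huv, hhuv, hle, d, hd, hlev⟩ := hS.exists_levels h hm hh hn
  obtain rfl : n = fun k => m * d k := funext hd
  have hd0 (k) : m * d k = 0 ↔ h k = h u := by
    rw [mul_eq_zero, or_iff_right hm.ne', hlev, Nat.cast_zero, add_zero]
  have hd0' (k) : d k = 0 ↔ h k = h u := by rw [hlev, Nat.cast_zero, add_zero]
  simp only [hd0] at h0' hs
  refine flexForm_psTerm_second_order a i j d s m e B g he hm hn hU h0 ?_ N c c' hN hω ?_
  · simpa only [hd0'] using hs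
  · simp only [hd0', hlev, Nat.cast_one, Nat.cast_ofNat]
    exact hgen u v huv hhuv hle _ hU h0'

end

section

variable {ι : Type*} [Fintype ι] {a : ι → ℂ} {i j : ι → ℕ} {s K : ℕ}

/-- The correction to the order of the flex form at the left end. -/
def leftCorr (s K : ℕ) (B : ℤ) : ℕ :=
  if B = 0 then 2 * (s * (s - 1) * K) else if B = -((s - 1) * K : ℕ) then (s - 1) * K
  else if B = -(s * K : ℕ) then 2 * (s * K) else 0

/-- The correction to the order of the flex form at the right end. -/
def rightCorr (s K : ℕ) (B : ℤ) : ℕ :=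
  if B = 0 then s * (s - 1) * K else if B = ((s - 1) * K : ℕ) then 2 * ((s - 1) * K)
  else if B = (s * K : ℕ) then s * K else 0

theorem branchOrder_left (hs : 2 ≤ s) (hK : 0 < K)
    (h1 : SecondOrderGeneric a (fun k => s * i k + j k) (fun k => i k) (1 - 2 * s))
    (h2 : FirstOrderGeneric a (fun k => s * i k + j k) (fun k => -j k))
    (h3 : SecondOrderGeneric a (fun k => s * i k + j k) (fun k => -(i k + j k)) (s + 1)) (B : ℤ) :
    BranchOrder a i j (fun k => s * i k + j k) (s * (s - 1) * K : ℕ) B (leftCorr s K B) := by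
  obtain ⟨r, rfl⟩ := Nat.exists_eq_add_of_le' (show 1 ≤ s by omega)
  have hr : 0 < r := by omega
  have hrC : (r : ℂ) ≠ 0 := by exact_mod_cast hr.ne'
  have hr1C : (r : ℂ) + 1 ≠ 0 := by exact_mod_cast r.succ_ne_zero
  have hKC : (K : ℂ) ≠ 0 := by exact_mod_cast hK.ne'
  have he : (((r + 1) * (r + 1 - 1) * K : ℕ) : ℤ) ≠ 0 := by
    rw [Nat.add_sub_cancel]; positivity
  rw [leftCorr]
  simp only [Nat.add_sub_cancel] at he ⊢
  split_ifs with hB1 hB2 hB3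
  · subst hB1
    refine branchOrder_second _ ((r + 1) * r * K) _ ((r + 1) * (-r)) h1 (by positivity) he
      (fun k => ?_) (by positivity)
      fun u w => ?_
    · push_cast; ring
    · push_cast
      simp only [map_mul, map_add, map_neg, map_sub, map_one, map_natCast, map_zero, map_ofNat]
      ring
  · subst hB2
    refine branchOrder_first _ h2 (by positivity) he (fun k => ?_) ((r + 1) * r * K) (r - 1)
      ((r + 1) * (-r)) (by positivity) fun u w => ?_
    · push_cast; ring
    · push_cast
      simp only [map_mul, map_add, map_neg, map_sub, map_one, map_natCast]
      ring
  · subst hB3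
    refine branchOrder_second _ ((r + 1) * r * K) _ ((r + 1) * (-r)) h3 (by positivity) he
      (fun k => ?_) (by positivity)
      fun u w => ?_
    · push_cast; ring
    · push_cast
      simp only [map_mul, map_add, map_neg, map_one, map_natCast]
      ring
  · refine branchOrder_ordinary he hB1 (fun h => hB2 ?_) (fun h => hB3 ?_)
    · have h' : ((r : ℤ) + 1) * (r * K + B) = 0 := by rw [← h]; push_cast; ring
      have := (mul_eq_zero.1 h').resolve_left (by positivity)
      push_cast; linarith
    · have h' : (r : ℤ) * ((r + 1) * K + B) = 0 := by
        rw [← sub_eq_zero] at h; rw [← h]; push_cast; ring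
      have := (mul_eq_zero.1 h').resolve_left (by positivity)
      push_cast; linarith

theorem branchOrder_right (hs : 2 ≤ s) (hK : 0 < K)
    (h1 : FirstOrderGeneric a (fun k => s * i k + j k) (fun k => -i k))
    (h2 : SecondOrderGeneric a (fun k => s * i k + j k) (fun k => j k) (s - 2))
    (h3 : FirstOrderGeneric a (fun k => s * i k + j k) (fun k => i k + j k)) (B : ℤ) :
    BranchOrder a i j (fun k => s * i k + j k) (-(s * (s - 1) * K : ℕ)) B (rightCorr s K B) := by
  obtain ⟨r, rfl⟩ := Nat.exists_eq_add_of_le' (show 1 ≤ s by omega)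
  have hr : 0 < r := by omega
  have hrC : (r : ℂ) ≠ 0 := by exact_mod_cast hr.ne'
  have hr1C : (r : ℂ) + 1 ≠ 0 := by exact_mod_cast r.succ_ne_zero
  have hKC : (K : ℂ) ≠ 0 := by exact_mod_cast hK.ne'
  have hN : -((r + 1) * r * K : ℂ) ≠ 0 := neg_ne_zero.2 (by positivity)
  have he : -(((r + 1) * (r + 1 - 1) * K : ℕ) : ℤ) ≠ 0 := by
    rw [Nat.add_sub_cancel, neg_ne_zero]; positivity
  rw [rightCorr]
  simp only [Nat.add_sub_cancel] at he ⊢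
  split_ifs with hB1 hB2 hB3
  · subst hB1
    refine branchOrder_first _ h1 (by positivity) he (fun k => ?_) (-((r + 1) * r * K)) (-1 - 2 * r)
      ((r + 1) * (-r)) hN fun u w => ?_
    · push_cast; ring
    · push_cast
      simp only [map_mul, map_add, map_neg, map_sub, map_one, map_natCast, map_zero, map_ofNat]
      ring
  · subst hB2
    refine branchOrder_second _ (-((r + 1) * r * K)) _ ((r + 1) * (-r)) h2 (by positivity) he
      (fun k => ?_) hN
      fun u w => ?_
    · push_cast; ring
    · push_cast
      simp only [map_mul, map_add, map_neg, map_sub, map_one, map_natCast, map_ofNat]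
      ring
  · subst hB3
    refine branchOrder_first _ h3 (by positivity) he (fun k => ?_) (-((r + 1) * r * K)) (r + 2)
      ((r + 1) * (-r)) hN fun u w => ?_
    · push_cast; ring
    · push_cast
      simp only [map_mul, map_add, map_neg, map_one, map_natCast, map_ofNat]
      ring
  · refine branchOrder_ordinary he hB1 (fun h => hB2 ?_) (fun h => hB3 ?_)
    · have h' : ((r : ℤ) + 1) * (r * K - B) = 0 := by rw [← neg_eq_zero, ← h]; push_cast; ring
      have := (mul_eq_zero.1 h').resolve_left (by positivity)
      push_cast; linarith
    · have h' : (r : ℤ) * ((r + 1) * K - B) = 0 := by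
        rw [← sub_eq_zero, ← neg_eq_zero] at h; rw [← h]; push_cast; ring
      have := (mul_eq_zero.1 h').resolve_left (by positivity)
      push_cast; linarith

end

section

variable {ι : Type*} [Fintype ι]

/-- The conditions on the coefficients under which the flexes can be counted. -/
structure FlexGeneric (a : ι → ℂ) (i j : ι → ℕ) (s : ℕ) : Prop where
  coeff_ne_zero : ∀ k, a k ≠ 0
  simple_roots : ∀ F : Finset ι, 1 < F.card → ∀ ζ ≠ 0, ∑ k ∈ F, a k * ζ ^ (s * i k + j k) = 0 →
    ∑ k ∈ F, ((s * i k + j k : ℕ) : ℂ) * (a k * ζ ^ (s * i k + j k)) ≠ 0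
  left : SecondOrderGeneric a (fun k => s * i k + j k) (fun k => i k) (1 - 2 * s)
  right : FirstOrderGeneric a (fun k => s * i k + j k) (fun k => -i k)
  bottom : SecondOrderGeneric a (fun k => s * i k + j k) (fun k => j k) (s - 2)
  top : FirstOrderGeneric a (fun k => s * i k + j k) (fun k => -j k)
  upper : SecondOrderGeneric a (fun k => s * i k + j k) (fun k => -(i k + j k)) (s + 1)
  lower : FirstOrderGeneric a (fun k => s * i k + j k) (fun k => i k + j k)
  contact : ∀ z ∈ flexSet a i j, contactForm i j (fun k => a k * z.1 ^ i k * z.2 ^ j k) ≠ 0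

/-- The number of flexes in terms of the supporting lines of the Newton polygon. -/
theorem FlexGeneric.ncard_flexSet {a : ι → ℂ} {i j l : ι → ℕ} {s K : ℕ} (h : FlexGeneric a i j s)
    (hs : 2 ≤ s) (hK : 0 < K) (hl : ∀ k, l k = s * i k + j k) (hinj : Function.Injective l)
        (p q : ι)
    (hp : ∀ k, l p ≤ l k) (hq : ∀ k, l k ≤ l q) (B₁ g₁ B₂ g₂ : ℕ → ℤ)
    (h₁ : ∀ m ∈ Finset.Ico (l p) (l q), Supports i l (s * (s - 1) * K : ℕ) m (B₁ m) (g₁ m))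
    (h₂ : ∀ m ∈ Finset.Ico (l p) (l q), Supports i l (-(s * (s - 1) * K : ℕ)) m (B₂ m) (g₂ m)) :
    (flexSet a i j).Finite ∧ ((s * (s - 1) * K : ℕ) : ℤ) * (flexSet a i j).ncard =
      -∑ m ∈ Finset.Ico (l p) (l q),
        (3 * (g₁ m + g₂ m) + leftCorr s K (B₁ m) + rightCorr s K (B₂ m)) := by
  obtain rfl : l = fun k => s * i k + j k := funext hl
  set l : ι → ℕ := fun k => s * i k + j k with hl'
  have hM : 0 < s * (s - 1) * K := by
    have : 0 < s - 1 := by omega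
    positivity
  have hmem (r : Fin (l q - l p)) : l p + r ∈ Finset.Ico (l p) (l q) := by
    have := r.2
    rw [Finset.mem_Ico]
    omega
  obtain ⟨z₁, hz₁, hz₁0, hz₁r, hz₁o⟩ := exists_puiseux a i j l hinj h.coeff_ne_zero h.simple_roots
    (s * (s - 1) * K : ℕ) p q (fun r => B₁ (l p + r)) (fun r => g₁ (l p + r))
    (fun r => h₁ _ (hmem r)) (leftCorr s K)
    (fun m B g => branchOrder_left hs hK h.left h.top h.upper B m g)
  obtain ⟨z₂, hz₂, hz₂0, hz₂r, hz₂o⟩ := exists_puiseux a i j l hinj h.coeff_ne_zero h.simple_roots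
    (-(s * (s - 1) * K : ℕ)) p q (fun r => B₂ (l p + r)) (fun r => g₂ (l p + r))
    (fun r => h₂ _ (hmem r)) (rightCorr s K)
    (fun m B g => branchOrder_right hs hK h.right h.bottom h.lower B m g)
  obtain ⟨hfin, hcard⟩ := finrank_flexAlgebra (h.coeff_ne_zero q) hp
    (fun k hk => (hq k).lt_of_ne fun h' => hk (hinj h')) _ hM z₁ z₂ hz₁ hz₂ hz₁0 hz₂0 hz₁r hz₂r
    _ _ hz₁o hz₂o
  obtain ⟨hf, hn⟩ := _root_.ncard_flexSet s hl (h.coeff_ne_zero q) (h.coeff_ne_zero p)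
    (fun k hk => (hp k).lt_of_ne fun h' => hk (hinj h').symm) hfin h.contact
  refine ⟨hf, ?_⟩
  rw [hn, hcard, Finset.sum_Ico_eq_sum_range, ← Fin.sum_univ_eq_sum_range
    (fun m => 3 * (g₁ (l p + m) + g₂ (l p + m)) + (leftCorr s K (B₁ (l p + m)) : ℤ) +
      rightCorr s K (B₂ (l p + m))), ← Finset.sum_add_distrib]
  congr 1
  exact Finset.sum_congr rfl fun r _ => by ring

end

section

variable {ι : Type*} [Fintype ι]

theorem genericTuple_simple_roots (l : ι → ℕ) (hl : Function.Injective l) (F : Finset ι)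
    (hF : 1 < F.card) : GenericTuple fun a : ι → ℂ => ∀ ζ ≠ 0, ∑ k ∈ F, a k * ζ ^ l k = 0 →
      ∑ k ∈ F, (l k : ℂ) * (a k * ζ ^ l k) ≠ 0 := by
  classical
  obtain ⟨p, hp, q, hq, hpq⟩ := Finset.one_lt_card.1 hF
  have hinj : Function.Injective ![p, q] := by
    intro r r'
    fin_cases r <;> fin_cases r' <;> simp [hpq, hpq.symm]
  refine (GenericTuple.linear (τ := Fin 1) (ρ := Fin 2) (by simp) (fun r k => if k ∈ F then
    ![1, MvPolynomial.C (l k : ℂ)] r * MvPolynomial.X 0 ^ l k else 0) ⟨_, hinj⟩).mono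
    fun a ha ζ hζ h0 h1 => ?_
  have := ha (fun _ => ζ) (fun r => ?_)
  · have hpq' : (l q : ℂ) - l p ≠ 0 := by
      rw [sub_ne_zero]
      exact_mod_cast fun h : l q = l p => hpq (hl h.symm)
    simp [Matrix.det_fin_two, hp, hq] at this
    have h2 : ζ ^ l p * ζ ^ l q * ((l q : ℂ) - l p) = 0 := by linear_combination this
    simp [hζ, hpq'] at h2
  · fin_cases r
    · rw [← h0, ← Finset.sum_subset (Finset.subset_univ F) fun k _ hk => by simp [hk]]
      exact Finset.sum_congr rfl fun k hk => by simp [hk, mul_comm]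
    · rw [← h1, ← Finset.sum_subset (Finset.subset_univ F) fun k _ hk => by simp [hk]]
      exact Finset.sum_congr rfl fun k hk => by simp [hk]; ring

theorem genericTuple_firstOrder (l : ι → ℕ) (h : ι → ℤ)
    (hlev : ∀ u v, u ≠ v → h u = h v → (∀ k, h u ≤ h k) → ∃ k, h k = h u + 1) :
    GenericTuple fun a : ι → ℂ => FirstOrderGeneric a l h := by
  classical
  refine GenericTuple.forall fun u => GenericTuple.forall fun v => ?_
  by_cases huv : u ≠ v ∧ h u = h v ∧ ∀ k, h u ≤ h k
  swap
  · exact GenericTuple.of_forall fun a h1 h2 h3 => absurd ⟨h1, h2, h3⟩ huv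
  obtain ⟨k₁, hk₁⟩ := hlev u v huv.1 huv.2.1 huv.2.2
  have hinj : Function.Injective ![u, k₁] := by
    refine Function.Injective.of_comp (f := h) fun r r' => ?_
    fin_cases r <;> fin_cases r' <;> simp [hk₁]
  refine (GenericTuple.linear (τ := Fin 1) (ρ := Fin 2) (by simp) (fun r k =>
    if h k = h u + ((r : ℕ) : ℤ) then MvPolynomial.X 0 ^ l k else 0) ⟨_, hinj⟩).mono
    fun a ha _ _ _ ζ hζ h0 h1 => ?_
  have := ha (fun _ => ζ) (fun r => ?_)
  · simp [Matrix.det_fin_two, hk₁, hζ] at this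
  · fin_cases r
    · rw [← h0]
      exact Finset.sum_congr rfl fun k _ => by by_cases hk : h k = h u <;> simp [hk, mul_comm]
    · rw [← h1]
      exact Finset.sum_congr rfl fun k _ => by
        by_cases hk : h k = h u + 1 <;> simp [hk, mul_comm]

theorem genericTuple_secondOrder (l : ι → ℕ) (h : ι → ℤ) (c : ℂ)
    (hlev : ∀ u v, u ≠ v → h u = h v → (∀ k, h u ≤ h k) →
      (∃ k, h k = h u + 1) ∧ ∃ k, h k = h u + 2) :
    GenericTuple fun a : ι → ℂ => SecondOrderGeneric a l h c := by
  classical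
  refine GenericTuple.forall fun u => GenericTuple.forall fun v => ?_
  by_cases huv : u ≠ v ∧ h u = h v ∧ ∀ k, h u ≤ h k
  swap
  · exact GenericTuple.of_forall fun a h1 h2 h3 => absurd ⟨h1, h2, h3⟩ huv
  obtain ⟨⟨k₁, hk₁⟩, k₂, hk₂⟩ := hlev u v huv.1 huv.2.1 huv.2.2
  have hinj : Function.Injective ![u, k₁, k₂] := by
    refine Function.Injective.of_comp (f := h) fun r r' => ?_
    fin_cases r <;> fin_cases r' <;> simp [hk₁, hk₂]
  refine (GenericTuple.linear (τ := Fin 2) (ρ := Fin 3) (by simp) (fun r k =>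
    ((if h k = h u then
        ![1, MvPolynomial.C (l k : ℂ) * MvPolynomial.X 1,
          MvPolynomial.C ((l k : ℂ) * l k - c * l k) * MvPolynomial.X 1 ^ 2] r else 0) +
      (if h k = h u + 1 then
        ![0, 1, MvPolynomial.C (2 * l k : ℂ) * MvPolynomial.X 1] r else 0) +
      (if h k = h u + 2 then ![0, 0, MvPolynomial.C 2] r else 0)) *
      MvPolynomial.X 0 ^ l k) ⟨_, hinj⟩).mono
    fun a ha _ _ _ ζ hζ h0 α h1 h2 => ?_
  have := ha ![ζ, α] (fun r => ?_)
  · simp [Matrix.det_fin_three, hk₁, hk₂, hζ] at this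
  · fin_cases r
    · rw [← h0]
      refine Finset.sum_congr rfl fun k _ => ?_
      by_cases hk : h k = h u <;> simp [hk, mul_comm]
    · rw [← h1, Finset.sum_mul, ← Finset.sum_add_distrib]
      refine Finset.sum_congr rfl fun k _ => ?_
      simp only [map_mul, map_add, apply_ite (MvPolynomial.eval _)]
      simp
      split_ifs <;> ring
    · rw [← h2, Finset.mul_sum, Finset.mul_sum, Finset.mul_sum, Finset.mul_sum,
        ← Finset.sum_sub_distrib, ← Finset.sum_add_distrib, ← Finset.sum_add_distrib]
      refine Finset.sum_congr rfl fun k _ => ?_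
      simp only [map_mul, map_add, apply_ite (MvPolynomial.eval _)]
      simp
      split_ifs <;> ring

variable (i j : ι → ℕ) (i₀ j₀ : ℕ) (x y : ℕ → ι)

theorem genericTuple_smooth (hx : ∀ c < 4, i (x c) = i₀ + c ∧ j (x c) = j₀)
    (hy : ∀ c < 4, i (y c) = i₀ ∧ j (y c) = j₀ + c) :
    GenericTuple fun a : ι → ℂ => ∀ z w : ℂ, z ≠ 0 → w ≠ 0 → ∑ k, a k * z ^ i k * w ^ j k = 0 →
      ∑ k, (i k : ℂ) * (a k * z ^ i k * w ^ j k) = 0 →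
      ∑ k, (j k : ℂ) * (a k * z ^ i k * w ^ j k) ≠ 0 := by
  classical
  have hx0 := hx 0 (by norm_num)
  have hx1 := hx 1 (by norm_num)
  have hy1 := hy 1 (by norm_num)
  have hinj : Function.Injective ![x 0, x 1, y 1] := by
    refine Function.Injective.of_comp (f := fun k => (i k, j k)) fun r r' => ?_
    fin_cases r <;> fin_cases r' <;> simp [hx0, hx1, hy1]
  refine (GenericTuple.linear (τ := Fin 2) (ρ := Fin 3) (by simp) (fun r k =>
    ![1, MvPolynomial.C (i k : ℂ), MvPolynomial.C (j k : ℂ)] r *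
      (MvPolynomial.X 0 ^ i k * MvPolynomial.X 1 ^ j k)) ⟨_, hinj⟩).mono
    fun a ha z w hz hw h0 h1 h2 => ?_
  have := ha ![z, w] (fun r => ?_)
  · simp [Matrix.det_fin_three, hx0, hx1, hy1] at this
    have h3 : z ^ (3 * i₀ + 1) * w ^ (3 * j₀ + 1) = 0 := by linear_combination this
    simp [hz, hw] at h3
  · fin_cases r
    · rw [← h0]
      exact Finset.sum_congr rfl fun k _ => by simp; ring
    · rw [← h1]
      exact Finset.sum_congr rfl fun k _ => by simp; ring
    · rw [← h2]
      exact Finset.sum_congr rfl fun k _ => by simp; ring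

theorem genericTuple_contact_vertical (hy : ∀ c < 4, i (y c) = i₀ ∧ j (y c) = j₀ + c) :
    GenericTuple fun a : ι → ℂ => ∀ z w : ℂ, z ≠ 0 → w ≠ 0 → ∑ k, a k * z ^ i k * w ^ j k = 0 →
      ∑ k, (j k : ℂ) * (a k * z ^ i k * w ^ j k) = 0 →
      ∑ k, (j k : ℂ) * (j k - 1) * (a k * z ^ i k * w ^ j k) = 0 →
      ∑ k, (j k : ℂ) * (j k - 1) * (j k - 2) * (a k * z ^ i k * w ^ j k) ≠ 0 := by
  classical
  have hinj : Function.Injective fun c : Fin 4 => y c := by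
    refine Function.Injective.of_comp (f := j) fun r r' hr => ?_
    simp only [Function.comp, hy _ r.2, hy _ r'.2] at hr
    exact Fin.ext (by omega)
  refine (GenericTuple.linear (τ := Fin 2) (ρ := Fin 4) (by simp) (fun r k =>
    ![1, MvPolynomial.C (j k : ℂ), MvPolynomial.C ((j k : ℂ) * (j k - 1)),
      MvPolynomial.C ((j k : ℂ) * (j k - 1) * (j k - 2))] r *
      (MvPolynomial.X 0 ^ i k * MvPolynomial.X 1 ^ j k)) ⟨_, hinj⟩).mono
    fun a ha z w hz hw h0 h1 h2 h3 => ?_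
  have := ha ![z, w] (fun r => ?_)
  · have hy0 := hy 0 (by norm_num)
    have hy1 := hy 1 (by norm_num)
    have hy2 := hy 2 (by norm_num)
    have hy3 := hy 3 (by norm_num)
    simp [Matrix.det_succ_row_zero, Fin.sum_univ_succ, Fin.succAbove, hy0, hy1, hy2, hy3] at this
    have h3 : 12 * (z ^ (4 * i₀) * w ^ (4 * j₀ + 6)) = 0 := by linear_combination this
    simp [hz, hw] at h3
  · fin_cases r
    · rw [← h0]
      exact Finset.sum_congr rfl fun k _ => by simp; ring
    · rw [← h1]
      exact Finset.sum_congr rfl fun k _ => by simp; ring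
    · rw [← h2]
      exact Finset.sum_congr rfl fun k _ => by simp; ring
    · rw [← h3]
      exact Finset.sum_congr rfl fun k _ => by simp; ring

theorem genericTuple_contact_slope (hx : ∀ c < 4, i (x c) = i₀ + c ∧ j (x c) = j₀) :
    GenericTuple fun a : ι → ℂ => ∀ z w m : ℂ, z ≠ 0 → w ≠ 0 → ∑ k, a k * z ^ i k * w ^ j k = 0 →
      ∑ k, ((i k : ℂ) + m * j k) * (a k * z ^ i k * w ^ j k) = 0 →
      ∑ k, ((i k : ℂ) * (i k - 1) + 2 * m * i k * j k + m ^ 2 * (j k * (j k - 1))) *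
        (a k * z ^ i k * w ^ j k) = 0 →
      ∑ k, ((i k : ℂ) * (i k - 1) * (i k - 2) + 3 * m * (i k * (i k - 1) * j k) +
        3 * m ^ 2 * (i k * (j k * (j k - 1))) + m ^ 3 * (j k * (j k - 1) * (j k - 2))) *
        (a k * z ^ i k * w ^ j k) ≠ 0 := by
  classical
  have hinj : Function.Injective fun c : Fin 4 => x c := by
    refine Function.Injective.of_comp (f := i) fun r r' hr => ?_
    simp only [Function.comp, hx _ r.2, hx _ r'.2] at hr
    exact Fin.ext (by omega)
  refine (GenericTuple.linear (τ := Fin 3) (ρ := Fin 4) (by simp) (fun r k =>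
    ![1, MvPolynomial.C (i k : ℂ) + MvPolynomial.X 2 * MvPolynomial.C (j k : ℂ),
      MvPolynomial.C ((i k : ℂ) * (i k - 1)) +
        2 * MvPolynomial.X 2 * MvPolynomial.C ((i k : ℂ) * j k) +
        MvPolynomial.X 2 ^ 2 * MvPolynomial.C ((j k : ℂ) * (j k - 1)),
      MvPolynomial.C ((i k : ℂ) * (i k - 1) * (i k - 2)) +
        3 * MvPolynomial.X 2 * MvPolynomial.C ((i k : ℂ) * (i k - 1) * j k) +
        3 * MvPolynomial.X 2 ^ 2 * MvPolynomial.C ((i k : ℂ) * (j k * (j k - 1))) +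
        MvPolynomial.X 2 ^ 3 * MvPolynomial.C ((j k : ℂ) * (j k - 1) * (j k - 2))] r *
      (MvPolynomial.X 0 ^ i k * MvPolynomial.X 1 ^ j k)) ⟨_, hinj⟩).mono
    fun a ha z w m hz hw h0 h1 h2 h3 => ?_
  have := ha ![z, w, m] (fun r => ?_)
  · have hx0 := hx 0 (by norm_num)
    have hx1 := hx 1 (by norm_num)
    have hx2 := hx 2 (by norm_num)
    have hx3 := hx 3 (by norm_num)
    simp [Matrix.det_succ_row_zero, Fin.sum_univ_succ, Fin.succAbove, hx0, hx1, hx2, hx3] at this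
    have h3 : 12 * (z ^ (4 * i₀ + 6) * w ^ (4 * j₀)) = 0 := by linear_combination this
    simp [hz, hw] at h3
  · fin_cases r
    · rw [← h0]
      exact Finset.sum_congr rfl fun k _ => by simp; ring
    · rw [← h1]
      exact Finset.sum_congr rfl fun k _ => by simp; ring
    · rw [← h2]
      exact Finset.sum_congr rfl fun k _ => by simp; ring
    · rw [← h3]
      exact Finset.sum_congr rfl fun k _ => by simp; ring

theorem genericTuple_contact (hx : ∀ c < 4, i (x c) = i₀ + c ∧ j (x c) = j₀)
    (hy : ∀ c < 4, i (y c) = i₀ ∧ j (y c) = j₀ + c) :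
    GenericTuple fun a : ι → ℂ => ∀ z ∈ flexSet a i j,
      contactForm i j (fun k => a k * z.1 ^ i k * z.2 ^ j k) ≠ 0 := by
  refine (((genericTuple_smooth i j i₀ j₀ x y hx hy).and
    (genericTuple_contact_vertical i j i₀ j₀ y hy)).and
    (genericTuple_contact_slope i j i₀ j₀ x hx)).mono ?_
  rintro a ⟨⟨hs, hv⟩, hm⟩ ⟨z, w⟩ ⟨⟨hz, hw⟩, h0, hf⟩ hc
  replace hs := hs z w hz hw h0
  replace hv := hv z w hz hw h0
  simp only [flexForm, contactForm] at hf hc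
  set t : ι → ℂ := fun k => a k * z ^ i k * w ^ j k with ht
  by_cases h01 : ∑ k, (j k : ℂ) * t k = 0
  · have h10 : ∑ k, (i k : ℂ) * t k ≠ 0 := fun h => hs h h01
    rw [h01] at hf hc
    refine hv h01 ?_ ?_
    · exact (by simpa using hf : _ ∨ _).resolve_right h10
    · exact (by simpa using hc : _ ∨ _).resolve_right h10
  · set m := -(∑ k, (i k : ℂ) * t k) / ∑ k, (j k : ℂ) * t k with hm'
    have h10 : ∑ k, (i k : ℂ) * t k = -m * ∑ k, (j k : ℂ) * t k := by
      rw [hm']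
      field_simp
    refine hm z w m hz hw h0 ?_ ?_ ?_
    · have : ∑ k, ((i k : ℂ) + m * j k) * t k =
          ∑ k, (i k : ℂ) * t k + m * ∑ k, (j k : ℂ) * t k := by
        rw [Finset.mul_sum, ← Finset.sum_add_distrib]
        exact Finset.sum_congr rfl fun k _ => by ring
      rw [this, h10]
      ring
    · rw [← mul_left_inj' (pow_ne_zero 2 h01), zero_mul, ← hf, h10]
      have : ∑ k, ((i k : ℂ) * (i k - 1) + 2 * m * i k * j k + m ^ 2 * (j k * (j k - 1))) * t k =
          ∑ k, (i k : ℂ) * (i k - 1) * t k + 2 * m * ∑ k, (i k : ℂ) * j k * t k +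
          m ^ 2 * ∑ k, (j k : ℂ) * (j k - 1) * t k := by
        simp only [Finset.mul_sum, ← Finset.sum_add_distrib]
        exact Finset.sum_congr rfl fun k _ => by ring
      rw [this]
      ring
    · rw [← mul_left_inj' (pow_ne_zero 3 h01), zero_mul, ← hc, h10]
      have : ∑ k, ((i k : ℂ) * (i k - 1) * (i k - 2) + 3 * m * (i k * (i k - 1) * j k) +
          3 * m ^ 2 * (i k * (j k * (j k - 1))) + m ^ 3 * (j k * (j k - 1) * (j k - 2))) * t k =
          ∑ k, (i k : ℂ) * (i k - 1) * (i k - 2) * t k +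
          3 * m * ∑ k, (i k : ℂ) * (i k - 1) * j k * t k +
          3 * m ^ 2 * ∑ k, (i k : ℂ) * (j k * (j k - 1)) * t k +
          m ^ 3 * ∑ k, (j k : ℂ) * (j k - 1) * (j k - 2) * t k := by
        simp only [Finset.mul_sum, ← Finset.sum_add_distrib]
        exact Finset.sum_congr rfl fun k _ => by ring
      rw [this]
      ring

/-- The condition on exponents under which all levels used in `FlexGeneric` are populated. -/
def HasLevels (h : ι → ℤ) : Prop :=
  ∀ u v, u ≠ v → h u = h v → (∀ k, h u ≤ h k) → (∃ k, h k = h u + 1) ∧ ∃ k, h k = h u + 2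

theorem genericTuple_flexGeneric {s : ℕ} (hl : Function.Injective fun k => s * i k + j k)
    (hx : ∀ c < 4, i (x c) = i₀ + c ∧ j (x c) = j₀)
    (hy : ∀ c < 4, i (y c) = i₀ ∧ j (y c) = j₀ + c)
    (hleft : HasLevels fun k => (i k : ℤ)) (hright : HasLevels fun k => -(i k : ℤ))
    (hbottom : HasLevels fun k => (j k : ℤ)) (htop : HasLevels fun k => -(j k : ℤ))
    (hupper : HasLevels fun k => -((i k : ℤ) + j k)) (hlower : HasLevels fun k => (i k : ℤ) + j k) :
    GenericTuple fun a : ι → ℂ => FlexGeneric a i j s := by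
  have hfirst {h : ι → ℤ} (hh : HasLevels h) :=
    genericTuple_firstOrder (fun k => s * i k + j k) h fun u v h1 h2 h3 => (hh u v h1 h2 h3).1
  have hsecond {h : ι → ℤ} (hh : HasLevels h) (c : ℂ) :=
    genericTuple_secondOrder (fun k => s * i k + j k) h c hh
  have hroots : GenericTuple fun a : ι → ℂ => ∀ F : Finset ι, 1 < F.card → ∀ ζ ≠ 0,
      ∑ k ∈ F, a k * ζ ^ (s * i k + j k) = 0 →
      ∑ k ∈ F, ((s * i k + j k : ℕ) : ℂ) * (a k * ζ ^ (s * i k + j k)) ≠ 0 := by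
    refine GenericTuple.forall fun F => ?_
    by_cases hF : 1 < F.card
    · exact (genericTuple_simple_roots _ hl F hF).mono fun a ha _ => ha
    · exact GenericTuple.of_forall fun a h => absurd h hF
  refine ((((((((GenericTuple.forall fun k => GenericTuple.coord_ne_zero k).and hroots).and
    (hsecond hleft (1 - 2 * s))).and (hfirst hright)).and (hsecond hbottom (s - 2))).and
    (hfirst htop)).and (hsecond hupper (s + 1))).and (hfirst hlower)).and
    (genericTuple_contact i j i₀ j₀ x y hx hy) |>.mono ?_
  rintro a ⟨⟨⟨⟨⟨⟨⟨⟨h1, h2⟩, h3⟩, h4⟩, h5⟩, h6⟩, h7⟩, h8⟩, h9⟩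
  exact ⟨h1, h2, h3, h4, h5, h6, h7, h8, h9⟩

end

/-- The exponents of a set of nonnegative lattice points. -/
theorem eq_sum_monomial {f : MvPolynomial (Fin 2) ℂ} {S : Set (ℤ × ℤ)} [Fintype S]
    (hS : ∀ k ∈ S, 0 ≤ k.1 ∧ 0 ≤ k.2) (hf : SuppIn f S) :
    f = ∑ k : S, monomial (Finsupp.single (0 : Fin 2) k.1.1.toNat + Finsupp.single 1 k.1.2.toNat)
      (coeffAt f k.1) := by
  classical
  have hexp (k : S) (m : Fin 2 →₀ ℕ) :
      Finsupp.single (0 : Fin 2) k.1.1.toNat + Finsupp.single 1 k.1.2.toNat = m ↔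
        k.1 = ((m 0 : ℤ), (m 1 : ℤ)) := by
    have := hS k.1 k.2
    rw [Finsupp.ext_iff, Fin.forall_fin_two, Prod.ext_iff]
    simp
    omega
  ext m
  rw [MvPolynomial.coeff_sum]
  simp only [MvPolynomial.coeff_monomial]
  by_cases hm : ((m 0 : ℤ), (m 1 : ℤ)) ∈ S
  · rw [Finset.sum_eq_single ⟨_, hm⟩]
    · have := (hexp ⟨_, hm⟩ m).2 rfl
      rw [if_pos this, coeffAt, if_pos (hS _ hm), this]
    · intro k _ hk
      exact if_neg fun h => hk (Subtype.ext ((hexp k m).1 h))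
    · simp
  · rw [Finset.sum_eq_zero fun k _ => if_neg fun h => hm ((hexp k m).1 h ▸ k.2)]
    by_contra h
    exact hm (hf m (MvPolynomial.mem_support_iff.2 h))

theorem Polynomial.mul_coeff_two {R : Type*} [Semiring R] (p q : Polynomial R) :
    (p * q).coeff 2 = p.coeff 0 * q.coeff 2 + (p.coeff 1 * q.coeff 1 + p.coeff 2 * q.coeff 0) := by
  rw [Polynomial.coeff_mul]
  simp [Finset.Nat.antidiagonal_succ]

theorem coeff_linear_pow (x α : ℂ) (n : ℕ) :
    let p := (Polynomial.C x + Polynomial.C (x * α) * Polynomial.X) ^ n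
    p.coeff 0 = x ^ n ∧ p.coeff 1 = n * α * x ^ n ∧
      p.coeff 2 = n * (n - 1) / 2 * α ^ 2 * x ^ n := by
  induction n with
  | zero => simp [Polynomial.coeff_one]
  | succ n ih =>
    obtain ⟨h0, h1, h2⟩ := ih
    simp only [pow_succ _ n, Polynomial.mul_coeff_zero, Polynomial.mul_coeff_one,
      Polynomial.mul_coeff_two, h0, h1, h2]
    simp [Polynomial.coeff_C, Polynomial.coeff_X]
    constructor <;> ring

theorem coeff_monomial_line (x y α β c : ℂ) (n m : ℕ) :
    let p := Polynomial.C c * ((Polynomial.C x + Polynomial.C (x * α) * Polynomial.X) ^ n *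
      (Polynomial.C y + Polynomial.C (y * β) * Polynomial.X) ^ m)
    let t := c * x ^ n * y ^ m
    p.coeff 0 = t ∧ p.coeff 1 = α * (n * t) + β * (m * t) ∧ 2 * p.coeff 2 =
      α ^ 2 * (n * (n - 1) * t) + 2 * α * β * (n * m * t) + β ^ 2 * (m * (m - 1) * t) := by
  obtain ⟨h0, h1, h2⟩ := coeff_linear_pow x α n
  obtain ⟨k0, k1, k2⟩ := coeff_linear_pow y β m
  simp only [Polynomial.coeff_C_mul]
  simp only [Polynomial.mul_coeff_zero, Polynomial.mul_coeff_one, Polynomial.mul_coeff_two, h0, h1,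
    h2, k0, k1, k2]
  refine ⟨?_, ?_, ?_⟩ <;> ring

theorem three_le_interMult_iff (f : MvPolynomial (Fin 2) ℂ) (p w : ℂ × ℂ) :
    3 ≤ interMult f p w ↔ (lineRestrict f p w).coeff 0 = 0 ∧ (lineRestrict f p w).coeff 1 = 0 ∧
      (lineRestrict f p w).coeff 2 = 0 := by
  rw [interMult]
  split_ifs with h
  · simp [h]
  · rw [show (3 : ℕ∞) = ((3 : ℕ) : ℕ∞) from rfl, Nat.cast_le,
      Polynomial.le_rootMultiplicity_iff h, Polynomial.C_0, sub_zero, Polynomial.X_pow_dvd_iff]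
    exact ⟨fun h => ⟨h 0 (by norm_num), h 1 (by norm_num), h 2 (by norm_num)⟩,
      fun ⟨h0, h1, h2⟩ d hd => by interval_cases d <;> assumption⟩

section

variable {S : Set (ℤ × ℤ)} [Fintype S] {f : MvPolynomial (Fin 2) ℂ}

theorem evalP_eq_sum (hS : ∀ k ∈ S, 0 ≤ k.1 ∧ 0 ≤ k.2) (hf : SuppIn f S) (p : ℂ × ℂ) :
    evalP f p = ∑ k : S, coeffAt f k.1 * p.1 ^ k.1.1.toNat * p.2 ^ k.1.2.toNat := by
  conv_lhs => rw [eq_sum_monomial hS hf]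
  simp [evalP, MvPolynomial.eval_monomial, Finsupp.prod_add_index', pow_add, mul_assoc]

theorem lineRestrict_eq_sum (hS : ∀ k ∈ S, 0 ≤ k.1 ∧ 0 ≤ k.2) (hf : SuppIn f S) (p w : ℂ × ℂ) :
    lineRestrict f p w = ∑ k : S, Polynomial.C (coeffAt f k.1) *
      ((Polynomial.C p.1 + Polynomial.C w.1 * Polynomial.X) ^ k.1.1.toNat *
        (Polynomial.C p.2 + Polynomial.C w.2 * Polynomial.X) ^ k.1.2.toNat) := by
  conv_lhs => rw [eq_sum_monomial hS hf]
  simp [lineRestrict, MvPolynomial.aeval_monomial, Finsupp.prod_add_index', pow_add]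

/-- Away from singular points, the inflection points in the torus are the zeros of `flexForm`. -/
theorem inflPts_eq_flexSet (hS : ∀ k ∈ S, 0 ≤ k.1 ∧ 0 ≤ k.2) (hf : SuppIn f S)
    (hc : ∀ z ∈ flexSet (fun k : S => coeffAt f k.1) (fun k => k.1.1.toNat) (fun k => k.1.2.toNat),
      contactForm (fun k : S => k.1.1.toNat) (fun k => k.1.2.toNat)
        (fun k => coeffAt f k.1 * z.1 ^ k.1.1.toNat * z.2 ^ k.1.2.toNat) ≠ 0) :
    inflPts f =
      flexSet (fun k : S => coeffAt f k.1) (fun k => k.1.1.toNat) (fun k => k.1.2.toNat) := by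
  have key (p : ℂ × ℂ) (hp : p.1 ≠ 0 ∧ p.2 ≠ 0) (w : ℂ × ℂ) :
      let t : S → ℂ := fun k => coeffAt f k.1 * p.1 ^ k.1.1.toNat * p.2 ^ k.1.2.toNat
      3 ≤ interMult f p (p.1 * w.1, p.2 * w.2) ↔ ∑ k, t k = 0 ∧
        w.1 * ∑ k, (k.1.1.toNat : ℂ) * t k + w.2 * ∑ k, (k.1.2.toNat : ℂ) * t k = 0 ∧
        w.1 ^ 2 * ∑ k, (k.1.1.toNat : ℂ) * (k.1.1.toNat - 1) * t k +
          2 * w.1 * w.2 * ∑ k, (k.1.1.toNat : ℂ) * k.1.2.toNat * t k +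
          w.2 ^ 2 * ∑ k, (k.1.2.toNat : ℂ) * (k.1.2.toNat - 1) * t k = 0 := by
    intro t
    have h (k : S) := coeff_monomial_line p.1 p.2 w.1 w.2 (coeffAt f k.1) k.1.1.toNat k.1.2.toNat
    rw [three_le_interMult_iff, lineRestrict_eq_sum hS hf]
    simp only [Polynomial.finsetSum_coeff, Finset.mul_sum, ← Finset.sum_add_distrib]
    refine and_congr (by simp only [(h _).1, t]) (and_congr (by simp only [(h _).2.1, t]) ?_)
    rw [← mul_right_inj' (two_ne_zero (α := ℂ)), mul_zero, Finset.mul_sum]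
    simp only [(h _).2.2, t]
  ext p
  simp only [inflPts, Torus, flexSet, Set.mem_ofPred_eq, evalP_eq_sum hS hf]
  refine and_congr_right fun hp => and_congr_right fun h0 => ?_
  set t : S → ℂ := fun k => coeffAt f k.1 * p.1 ^ k.1.1.toNat * p.2 ^ k.1.2.toNat
  constructor
  · rintro ⟨w, hw, hm⟩
    have hw' : w = (p.1 * (w.1 / p.1), p.2 * (w.2 / p.2)) := by
      ext
      · exact (mul_div_cancel₀ _ hp.1).symm
      · exact (mul_div_cancel₀ _ hp.2).symm
    rw [hw'] at hm
    obtain ⟨-, h1, h2⟩ := (key p hp (w.1 / p.1, w.2 / p.2)).1 hm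
    have hne : w.1 / p.1 ≠ 0 ∨ w.2 / p.2 ≠ 0 := by
      by_contra! h
      rw [h.1, h.2] at hw'
      exact hw (hw'.trans (by ext <;> simp))
    rw [flexForm]
    simp only at h1 h2
    generalize w.1 / p.1 = α at h1 h2 hne
    generalize w.2 / p.2 = β at h1 h2 hne
    rcases hne with h | h
    · rw [← mul_right_inj' (pow_ne_zero 2 h), mul_zero]
      linear_combination (∑ k, (k.1.2.toNat : ℂ) * t k) ^ 2 * h2 +
        (-2 * α * (∑ k, (k.1.1.toNat : ℂ) * k.1.2.toNat * t k) * (∑ k, (k.1.2.toNat : ℂ) * t k) +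
          (∑ k, (k.1.2.toNat : ℂ) * (k.1.2.toNat - 1) * t k) * (α * (∑ k, (k.1.1.toNat : ℂ) * t k) -
            β * (∑ k, (k.1.2.toNat : ℂ) * t k))) * h1
    · rw [← mul_right_inj' (pow_ne_zero 2 h), mul_zero]
      linear_combination (∑ k, (k.1.1.toNat : ℂ) * t k) ^ 2 * h2 +
        (-2 * β * (∑ k, (k.1.1.toNat : ℂ) * k.1.2.toNat * t k) * (∑ k, (k.1.1.toNat : ℂ) * t k) +
          (∑ k, (k.1.1.toNat : ℂ) * (k.1.1.toNat - 1) * t k) * (β * (∑ k, (k.1.2.toNat : ℂ) * t k) -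
            α * (∑ k, (k.1.1.toNat : ℂ) * t k))) * h1
  · intro hff
    refine ⟨(p.1 * ∑ k, (k.1.2.toNat : ℂ) * t k, p.2 * -∑ k, (k.1.1.toNat : ℂ) * t k), ?_, ?_⟩
    · intro h
      have h1 := congrArg Prod.fst h
      have h2 := congrArg Prod.snd h
      simp only [Prod.fst_zero, Prod.snd_zero, mul_eq_zero, hp.1, hp.2, false_or, neg_eq_zero]
        at h1 h2
      refine hc p ⟨hp, h0, hff⟩ ?_
      rw [contactForm]
      simp only [t] at h1 h2
      rw [h1, h2]
      ring
    · refine (key p hp (∑ k, (k.1.2.toNat : ℂ) * t k, -∑ k, (k.1.1.toNat : ℂ) * t k)).2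
        ⟨h0, by simp only; ring, ?_⟩
      rw [flexForm] at hff
      linear_combination hff

end

section

variable {ι : Type*} {i l : ι → ℕ} {e : ℤ}

theorem Supports.height_le {m m' : ℕ} {B g B' g' N : ℤ} (h : Supports i l e m B g)
    (h' : Supports i l e m' B' g') (h1 : (m' : ℤ) ≤ N) (h2 : N ≤ m' + 1) :
    g - B * N ≤ g' - B' * N := by
  obtain ⟨-, -, -, -, -, -, h⟩ := h
  obtain ⟨u, v, hu, hv, hug, hvg, -⟩ := h'
  have hu' : (l u : ℤ) ≤ m' := by exact_mod_cast hu
  have hv' : (m' : ℤ) + 1 ≤ l v := by exact_mod_cast hv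
  have hD : (0 : ℤ) < l v - l u := by linarith
  have e1 := mul_le_mul_of_nonneg_left (h u) (show 0 ≤ (l v : ℤ) - N by linarith)
  have e2 := mul_le_mul_of_nonneg_left (h v) (show 0 ≤ N - (l u : ℤ) by linarith)
  refine le_of_mul_le_mul_left ?_ hD
  linear_combination e1 + e2 + (l v - N) * hug + (N - l u) * hvg

/-- A summation by parts along the lower hull. -/
theorem sum_supports (hinj : Function.Injective l) (p q : ι) (hpq : l p < l q)
    (hp : ∀ k, l p ≤ l k) (hq : ∀ k, l k ≤ l q) {B g : ℕ → ℤ}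
    (h : ∀ m ∈ Finset.Ico (l p) (l q), Supports i l e m (B m) (g m)) :
    ∑ m ∈ Finset.Ico (l p) (l q), (g m - B m * (2 * m + 1)) =
      e * (l q * i q - l p * i p) := by
  set G : ℕ → ℤ := fun N => if N < l q then g N - B N * N else e * i q with hG
  have hstep : ∀ m ∈ Finset.Ico (l p) (l q), G (m + 1) = g m - B m * (m + 1) := by
    intro m hm
    obtain ⟨hm1, hm2⟩ := Finset.mem_Ico.1 hm
    by_cases hlt : m + 1 < l q
    · have h' := h (m + 1) (Finset.mem_Ico.2 ⟨by omega, hlt⟩)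
      have e1 := (h m hm).height_le h' (N := m + 1) (by push_cast; rfl) (by push_cast; linarith)
      have e2 := h'.height_le (h m hm) (N := m + 1) (by linarith) le_rfl
      simp only [hG, if_pos hlt]
      push_cast
      linarith
    · obtain ⟨u, v, hu, hv, hug, hvg, -⟩ := h m hm
      have := hq v
      obtain rfl : v = q := hinj (by omega)
      have hm' : (l v : ℤ) = m + 1 := by
        have : l v = m + 1 := by omega
        exact_mod_cast this
      simp only [hG, if_neg hlt]
      rw [← hvg, hm']
      ring
  have h0 : G (l p) = e * i p := by
    obtain ⟨u, v, hu, hv, hug, hvg, -⟩ := h (l p) (Finset.left_mem_Ico.2 hpq)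
    obtain rfl : u = p := hinj (le_antisymm hu (hp u))
    simp only [hG, if_pos hpq]
    linarith
  have h1 : G (l q) = e * i q := by simp [hG]
  have : ∀ m ∈ Finset.Ico (l p) (l q), g m - B m * (2 * m + 1) =
      ((m + 1 : ℕ) : ℤ) * G (m + 1) - (m : ℤ) * G m := by
    intro m hm
    have : G m = g m - B m * m := by simp only [hG, if_pos (Finset.mem_Ico.1 hm).2]
    rw [hstep m hm, this]
    push_cast
    ring
  rw [Finset.sum_congr rfl this, Finset.sum_Ico_sub (fun m : ℕ => (m : ℤ) * G m) hpq.le, h0, h1]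
  ring

/-- The slopes equal to `B` are those over the face where `e * i + B * l` is minimal. -/
theorem filter_slope_eq {u v : ι} {p q : ι} (hp : ∀ k, l p ≤ l k) (hq : ∀ k, l k ≤ l q)
    {B : ℕ → ℤ} {g : ℕ → ℤ}
    (h : ∀ m ∈ Finset.Ico (l p) (l q), Supports i l e m (B m) (g m)) (B₀ : ℤ)
    (hu : ∀ k, e * i u + B₀ * l u ≤ e * i k + B₀ * l k)
    (hv : e * i v + B₀ * l v = e * i u + B₀ * l u)
    (hF : ∀ k, e * i k + B₀ * l k = e * i u + B₀ * l u → l u ≤ l k ∧ l k ≤ l v) :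
    (Finset.Ico (l p) (l q)).filter (fun m => B m = B₀) = Finset.Ico (l u) (l v) := by
  ext m
  rw [Finset.mem_filter, Finset.mem_Ico, Finset.mem_Ico]
  constructor
  · rintro ⟨hm, rfl⟩
    obtain ⟨u', v', hu', hv', hug, hvg, hk⟩ := h m (Finset.mem_Ico.2 hm)
    have e1 := hF u' (le_antisymm (by rw [hug]; exact hk u) (hu u'))
    have e2 := hF v' (le_antisymm (by rw [hvg]; exact hk u) (hu v'))
    omega
  · rintro ⟨h1, h2⟩
    have hm : l p ≤ m ∧ m < l q := ⟨(hp u).trans h1, h2.trans_le (hq v)⟩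
    exact ⟨hm, ((h m (Finset.mem_Ico.2 hm)).unique ⟨u, v, h1, h2, rfl, hv, hu⟩).1⟩

end

section

variable {P : Set (ℝ × ℝ)}

theorem IsLatticePolygon.convex (hP : IsLatticePolygon P) : Convex ℝ P := by
  obtain ⟨V, -, rfl⟩ := hP
  exact convex_convexHull ℝ _

theorem IsLatticePolygon.le_of_forall (hP : IsLatticePolygon P) {a b c : ℝ}
    (h : ∀ k ∈ latticePts P, c ≤ a * k.1 + b * k.2) : ∀ p ∈ P, c ≤ a * p.1 + b * p.2 := by
  obtain ⟨V, -, rfl⟩ := hP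
  have hconv : Convex ℝ {p : ℝ × ℝ | c ≤ a * p.1 + b * p.2} := by
    intro x hx y hy t r ht hr htr
    simp only [Set.mem_ofPred_eq, Prod.fst_add, Prod.snd_add, Prod.smul_fst, Prod.smul_snd,
      smul_eq_mul] at hx hy ⊢
    have e1 := mul_le_mul_of_nonneg_left hx ht
    have e2 := mul_le_mul_of_nonneg_left hy hr
    linear_combination e1 + e2 - c * htr
  refine fun p hp => convexHull_min ?_ hconv hp
  rintro _ ⟨k, hk, rfl⟩
  exact h k (subset_convexHull ℝ _ ⟨k, hk, rfl⟩)

theorem IsLatticePolygon.finite_latticePts (hP : IsLatticePolygon P) :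
    (latticePts P).Finite := by
  obtain ⟨V, -, rfl⟩ := hP
  have hb : Bornology.IsBounded (convexHull ℝ (rpt '' (V : Set (ℤ × ℤ)))) :=
    isBounded_convexHull.2 (V.finite_toSet.image _).isBounded
  obtain ⟨R, hR⟩ := hb.subset_closedBall 0
  refine (((Set.finite_Icc (-⌈R⌉) ⌈R⌉).prod (Set.finite_Icc (-⌈R⌉) ⌈R⌉))).subset fun k hk => ?_
  have h := hR hk
  rw [mem_closedBall_zero_iff, Prod.norm_def, max_le_iff, Real.norm_eq_abs, Real.norm_eq_abs,
    abs_le, abs_le] at h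
  obtain ⟨⟨h1, h2⟩, h3, h4⟩ := h
  have hR' := Int.le_ceil R
  simp only [rpt] at h1 h2 h3 h4
  have cast {x y : ℤ} (h : (x : ℝ) ≤ y) : x ≤ y := by exact_mod_cast h
  exact ⟨⟨cast (by push_cast; linarith), cast (by linarith)⟩,
    ⟨cast (by push_cast; linarith), cast (by linarith)⟩⟩

theorem IsLatticePolygon.mem_latticePts_face (hP : IsLatticePolygon P) {γ k : ℤ × ℤ} :
    k ∈ latticePts (face P γ) ↔ k ∈ latticePts P ∧
      ∀ k' ∈ latticePts P, γ.1 * k'.1 + γ.2 * k'.2 ≤ γ.1 * k.1 + γ.2 * k.2 := by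
  refine and_congr_right fun hk => ⟨fun h k' hk' => ?_, fun h q hq => ?_⟩
  · have := h _ hk'
    simp only [rpt] at this
    exact_mod_cast this
  · have := hP.le_of_forall (a := -γ.1) (b := -γ.2) (c := -(γ.1 * k.1 + γ.2 * k.2))
      (fun k' hk' => ?_) q hq
    · simp only [rpt]
      linarith
    · have := h k' hk'
      have : ((γ.1 * k'.1 + γ.2 * k'.2 : ℤ) : ℝ) ≤ ((γ.1 * k.1 + γ.2 * k.2 : ℤ) : ℝ) := by
        exact_mod_cast this
      push_cast at this
      linarith

theorem Convex.add_smul_mem_latticePts (hc : Convex ℝ P) {u d : ℤ × ℤ} {T t : ℕ}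
    (hu : u ∈ latticePts P) (hv : (u.1 + T * d.1, u.2 + T * d.2) ∈ latticePts P) (ht : t ≤ T) :
    (u.1 + t * d.1, u.2 + t * d.2) ∈ latticePts P := by
  rcases Nat.eq_zero_or_pos T with rfl | hT
  · obtain rfl : t = 0 := by omega
    exact hv
  · have hT' : (0 : ℝ) < T := by exact_mod_cast hT
    have ht' : (t : ℝ) ≤ T := by exact_mod_cast ht
    have hmem := hc hu hv (a := 1 - t / T) (b := t / T)
      (by rw [sub_nonneg, div_le_one hT']; exact ht') (by positivity) (by ring)
    have heq : rpt (u.1 + t * d.1, u.2 + t * d.2) =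
        (1 - t / T : ℝ) • rpt u + (t / T : ℝ) • rpt (u.1 + T * d.1, u.2 + T * d.2) := by
      simp only [rpt, Prod.smul_mk, Prod.mk_add_mk, smul_eq_mul]
      push_cast
      ext <;> (simp only; field_simp; ring)
    rw [← heq] at hmem
    exact hmem

/-- A face whose lattice points are equally spaced is measured by the number of steps. -/
theorem IsLatticePolygon.lenFace_eq (hP : IsLatticePolygon P) {γ d u : ℤ × ℤ} {T : ℕ}
    (hγd : γ.1 * d.1 + γ.2 * d.2 = 0) (hd : d ≠ 0) (hu : u ∈ latticePts (face P γ))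
    (hv : (u.1 + T * d.1, u.2 + T * d.2) ∈ latticePts P)
    (h : ∀ k ∈ latticePts (face P γ), ∃ t : ℕ, t ≤ T ∧ k = (u.1 + t * d.1, u.2 + t * d.2)) :
    lenFace P γ = T := by
  have : latticePts (face P γ) =
      (fun t : ℕ => (u.1 + t * d.1, u.2 + t * d.2)) '' (Finset.range (T + 1) : Set ℕ) := by
    ext k
    constructor
    · intro hk
      obtain ⟨t, ht, rfl⟩ := h k hk
      exact ⟨t, by simpa using Nat.lt_succ_of_le ht, rfl⟩
    · rintro ⟨t, ht, rfl⟩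
      rw [hP.mem_latticePts_face] at hu ⊢
      refine ⟨hP.convex.add_smul_mem_latticePts hu.1 hv
        (by simpa [Nat.lt_succ_iff] using ht), fun k' hk' => (hu.2 k' hk').trans_eq ?_⟩
      linear_combination -(t : ℤ) * hγd
  rw [lenFace, this, Set.ncard_image_of_injective, Set.ncard_coe_finset, Finset.card_range,
    Nat.add_sub_cancel]
  intro t t' htt
  simp only [Prod.mk.injEq, add_right_inj, mul_eq_mul_right_iff, Nat.cast_inj] at htt
  by_contra hne
  exact hd (Prod.ext (htt.1.resolve_left hne) (htt.2.resolve_left hne))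

variable [Fintype (latticePts P)] {i l : latticePts P → ℕ} {s : ℕ} {e : ℤ}

theorem IsLatticePolygon.card_filter_slope (hP : IsLatticePolygon P)
    (hl : ∀ k, (l k : ℤ) = s * k.1.1 + k.1.2) {p q : latticePts P} (hp : ∀ k, l p ≤ l k)
    (hq : ∀ k, l k ≤ l q) {B g : ℕ → ℤ}
    (h : ∀ m ∈ Finset.Ico (l p) (l q), Supports i l e m (B m) (g m)) (B₀ c : ℤ) (γ d : ℤ × ℤ)
    (hc : 0 < c) (hγ : ∀ k, e * i k + B₀ * l k = -(c * (γ.1 * k.1.1 + γ.2 * k.1.2)))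
    (hγd : γ.1 * d.1 + γ.2 * d.2 = 0)
    (hd : ∀ v : ℤ × ℤ, γ.1 * v.1 + γ.2 * v.2 = 0 → ∃ t : ℤ, v = (t * d.1, t * d.2))
    (r : ℕ) (hr : 0 < r) (hsr : s * d.1 + d.2 = r) :
    ((Finset.Ico (l p) (l q)).filter (fun m => B m = B₀)).card = r * lenFace P γ := by
  classical
  have hd0 : d ≠ 0 := by
    rintro rfl
    simp at hsr
    omega
  have hr' : (0 : ℤ) < r := by exact_mod_cast hr
  set w : latticePts P → ℤ := fun k => γ.1 * k.1.1 + γ.2 * k.1.2 with hw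
  obtain ⟨k₀, -, hk₀⟩ := Finset.exists_max_image Finset.univ w ⟨p, Finset.mem_univ p⟩
  set F := Finset.univ.filter fun k => w k = w k₀ with hF
  have hFne : F.Nonempty := ⟨k₀, by simp [hF]⟩
  obtain ⟨u, hu, hu'⟩ := Finset.exists_min_image F l hFne
  obtain ⟨v, hv, hv'⟩ := Finset.exists_max_image F l hFne
  have hwu : w u = w k₀ := (Finset.mem_filter.1 hu).2
  have hwv : w v = w k₀ := (Finset.mem_filter.1 hv).2
  have hmem {k : latticePts P} (hk : w k = w k₀) : k ∈ F := by simp [hF, hk]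
  have hstep (k : latticePts P) (hk : w k = w k₀) :
      ∃ t : ℕ, k.1 = (u.1.1 + t * d.1, u.1.2 + t * d.2) ∧ l k = l u + r * t := by
    obtain ⟨t, ht⟩ := hd (k.1.1 - u.1.1, k.1.2 - u.1.2) (by
      simp only [hw] at hwu hk ⊢
      linear_combination hk - hwu)
    simp only [Prod.mk.injEq] at ht
    have hlk : (l k : ℤ) = l u + r * t := by
      rw [hl, hl, ← hsr]
      linear_combination s * ht.1 + ht.2
    have h0 : (l u : ℤ) ≤ l k := by exact_mod_cast hu' k (hmem hk)
    have ht0 : 0 ≤ t := by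
      by_contra! hneg
      have := mul_neg_of_pos_of_neg hr' hneg
      linarith
    lift t to ℕ using ht0
    refine ⟨t, Prod.ext ?_ ?_, by exact_mod_cast hlk⟩
    · simp only
      linarith [ht.1]
    · simp only
      linarith [ht.2]
  obtain ⟨T, hT, hlT⟩ := hstep v hwv
  have hlen : lenFace P γ = T := by
    refine hP.lenFace_eq hγd hd0 (u := u.1) ?_ (hT ▸ v.2) fun k hk => ?_
    · rw [hP.mem_latticePts_face]
      exact ⟨u.2, fun k' hk' => hwu.ge.trans' (hk₀ ⟨k', hk'⟩ (Finset.mem_univ _))⟩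
    · rw [hP.mem_latticePts_face] at hk
      have hwk : w ⟨k, hk.1⟩ = w k₀ :=
        le_antisymm (hk₀ _ (Finset.mem_univ _)) (hk.2 k₀.1 k₀.2)
      obtain ⟨t, ht, hlt⟩ := hstep ⟨k, hk.1⟩ hwk
      refine ⟨t, ?_, ht⟩
      have := hv' _ (hmem hwk)
      rw [hlt, hlT] at this
      exact Nat.le_of_mul_le_mul_left (by omega) hr
  rw [filter_slope_eq (u := u) (v := v) hp hq h B₀, Nat.card_Ico, hlen, hlT]
  · omega
  · intro k
    rw [hγ, hγ]
    have := hwu.ge.trans' (hk₀ k (Finset.mem_univ _))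
    have := mul_le_mul_of_nonneg_left this hc.le
    simp only [hw] at this
    linarith
  · rw [hγ, hγ]
    have := hwv.trans hwu.symm
    simp only [hw] at this
    rw [this]
  · intro k hk
    rw [hγ, hγ] at hk
    have : w k = w u := by
      have := mul_left_cancel₀ hc.ne' (neg_injective hk)
      exact this
    have := hmem (this.trans hwu)
    exact ⟨hu' k this, hv' k this⟩

end

section

variable {P : Set (ℝ × ℝ)}

theorem Contains5Delta.exists_mem (h5 : Contains5Delta P) : ∃ t : ℤ × ℤ, ∀ x y : ℤ,
    0 ≤ x → 0 ≤ y → x + y ≤ 5 → (t.1 + x, t.2 + y) ∈ latticePts P := by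
  obtain ⟨t, ht⟩ := h5
  refine ⟨t, fun x y hx hy hxy => ht ?_⟩
  have hx' : (0 : ℝ) ≤ x := by exact_mod_cast hx
  have hy' : (0 : ℝ) ≤ y := by exact_mod_cast hy
  have hxy' : (x + y : ℝ) ≤ 5 := by exact_mod_cast hxy
  refine ⟨(x, y), ⟨(x / 5, y / 5), ?_, by ext <;> simp <;> ring⟩, by
    ext <;> simp [rpt]⟩
  have hc : Convex ℝ stdTriangle := convex_convexHull ℝ _
  have h0 : ((0, 0) : ℝ × ℝ) ∈ stdTriangle := subset_convexHull ℝ _ (by simp)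
  have h1 : ((1, 0) : ℝ × ℝ) ∈ stdTriangle := subset_convexHull ℝ _ (by simp)
  have h2 : ((0, 1) : ℝ × ℝ) ∈ stdTriangle := subset_convexHull ℝ _ (by simp)
  have hsum := hc.sum_mem (t := Finset.univ)
      (w := ![(1 - x / 5 - y / 5 : ℝ), (x / 5 : ℝ), (y / 5 : ℝ)])
    (z := ![(0, 0), (1, 0), (0, 1)])
    (by
      intro c _
      fin_cases c <;> simp <;> linarith)
    (by simp [Fin.sum_univ_three]; ring)
    (by
      intro c _
      fin_cases c <;> simp <;> assumption)
  simpa [Fin.sum_univ_three] using hsum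

/-- The slice at height `r` between two parallel lattice segments contains a lattice point. -/
theorem Convex.exists_mem_level (hc : Convex ℝ P) {u d e : ℤ × ℤ} {N c r : ℤ} (hN : 0 < N)
    (hr : 0 ≤ r) (hrN : r ≤ N) (h1 : u ∈ latticePts P) (h2 : u + d ∈ latticePts P)
    (h3 : u + N • e + c • d ∈ latticePts P) (h4 : u + N • e + c • d + d ∈ latticePts P) :
    ∃ t : ℤ, u + r • e + t • d ∈ latticePts P := by
  have hN' : (0 : ℝ) < N := by exact_mod_cast hN
  have hr' : (0 : ℝ) ≤ r := by exact_mod_cast hr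
  have hrN' : (r : ℝ) ≤ N := by exact_mod_cast hrN
  refine ⟨⌈(r * c / N : ℝ)⌉, ?_⟩
  set t := ⌈(r * c / N : ℝ)⌉
  have ht1 : (r * c / N : ℝ) ≤ t := Int.le_ceil _
  have ht2 : (t : ℝ) < r * c / N + 1 := Int.ceil_lt_add_one _
  have hl1 : (0 : ℝ) ≤ r / N := by positivity
  have hl2 : (0 : ℝ) ≤ 1 - r / N := by rw [sub_nonneg, div_le_one hN']; exact hrN'
  have e1 := hc h1 h3 hl2 hl1 (by ring)
  have e2 := hc h2 h4 hl2 hl1 (by ring)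
  have e3 := hc e1 e2 (a := 1 - (t - r * c / N)) (b := t - r * c / N) (by linarith) (by linarith)
    (by ring)
  have heq : rpt (u + r • e + t • d) =
      (1 - (t - r * c / N) : ℝ) •
          ((1 - r / N : ℝ) • rpt u + (r / N : ℝ) • rpt (u + N • e + c • d)) +
      (t - r * c / N : ℝ) • ((1 - r / N : ℝ) • rpt (u + d) +
        (r / N : ℝ) • rpt (u + N • e + c • d + d)) := by
    simp only [rpt, Prod.smul_mk, Prod.mk_add_mk, smul_eq_mul, Prod.fst_add, Prod.snd_add,
      Prod.smul_fst, Prod.smul_snd]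
    push_cast
    ext <;> (simp only; field_simp; ring)
  rw [← heq] at e3
  exact e3

theorem IsLatticePolygon.hasLevels (hP : IsLatticePolygon P) {t : ℤ × ℤ}
    (ht : ∀ x y : ℤ, 0 ≤ x → 0 ≤ y → x + y ≤ 5 → (t.1 + x, t.2 + y) ∈ latticePts P)
    (η d e a b : ℤ × ℤ) (hηd : η.1 * d.1 + η.2 * d.2 = 0) (hηe : η.1 * e.1 + η.2 * e.2 = 1)
    (hd : ∀ v : ℤ × ℤ, η.1 * v.1 + η.2 * v.2 = 0 → ∃ t : ℤ, v = t • d)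
    (ha : 0 ≤ a.1 ∧ 0 ≤ a.2 ∧ a.1 + a.2 ≤ 5) (hb : 0 ≤ b.1 ∧ 0 ≤ b.2 ∧ b.1 + b.2 ≤ 5)
    (hbd : 0 ≤ b.1 + d.1 ∧ 0 ≤ b.2 + d.2 ∧ b.1 + d.1 + (b.2 + d.2) ≤ 5)
    (hab : η.1 * b.1 + η.2 * b.2 = η.1 * a.1 + η.2 * a.2 + 2) (h : latticePts P → ℤ)
    (hh : ∀ k, h k = η.1 * k.1.1 + η.2 * k.1.2) : HasLevels h := by
  intro u v huv hhuv hmin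
  obtain ⟨w, hw1, hw2, hhw⟩ : ∃ w, w ∈ latticePts P ∧ w + d ∈ latticePts P ∧
      η.1 * w.1 + η.2 * w.2 = h u := by
    have key : ∀ u v : latticePts P, h u = h v → ∀ c : ℕ, 0 < c → v.1 - u.1 = (c : ℤ) • d →
        u.1 + d ∈ latticePts P := by
      intro u v _ c hc hcd
      have hv : v.1 = (u.1.1 + c * d.1, u.1.2 + c * d.2) := by
        rw [eq_add_of_sub_eq' hcd]
        rfl
      have := hP.convex.add_smul_mem_latticePts (t := 1) u.2 (hv ▸ v.2) hc
      simp only [Nat.cast_one, one_mul] at this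
      exact this
    obtain ⟨c, hc⟩ := hd (v.1 - u.1) (by
      rw [hh, hh] at hhuv
      simp only [Prod.fst_sub, Prod.snd_sub]
      linear_combination -hhuv)
    rcases lt_trichotomy c 0 with hc0 | rfl | hc0
    · refine ⟨v.1, v.2, key v u hhuv.symm (-c).toNat (by omega) ?_, by rw [hhuv, hh]⟩
      rw [Int.toNat_of_nonneg (by omega), neg_smul, ← hc, neg_sub]
    · rw [zero_smul, sub_eq_zero] at hc
      exact absurd (Subtype.ext hc.symm) huv
    · refine ⟨u.1, u.2, key u v hhuv c.toNat (by omega) ?_, by rw [hh]⟩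
      rw [Int.toNat_of_nonneg hc0.le, hc]
  have hta := hmin ⟨_, ht a.1 a.2 ha.1 ha.2.1 ha.2.2⟩
  have hha := hh ⟨_, ht a.1 a.2 ha.1 ha.2.1 ha.2.2⟩
  simp only at hha
  set N := η.1 * (t.1 + b.1) + η.2 * (t.2 + b.2) - h u with hN
  have hN2 : 2 ≤ N := by linarith
  obtain ⟨c, hc⟩ := hd ((t.1 + b.1, t.2 + b.2) - w - N • e) (by
    simp only [Prod.fst_sub, Prod.snd_sub, Prod.smul_fst, Prod.smul_snd, smul_eq_mul]
    linear_combination -hhw - N * hηe - hN)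
  have hB : ((t.1 + b.1, t.2 + b.2) : ℤ × ℤ) = w + N • e + c • d := by
    rw [← hc]
    abel
  have key (r : ℤ) (hr : 0 ≤ r) (hr2 : r ≤ 2) : ∃ k, h k = h u + r := by
    obtain ⟨t', ht'⟩ := hP.convex.exists_mem_level (N := N) (c := c) (e := e) (by linarith) hr
      (by linarith) hw1 hw2 (hB ▸ ht b.1 b.2 hb.1 hb.2.1 hb.2.2) (by
        rw [← hB]
        have := ht _ _ hbd.1 hbd.2.1 hbd.2.2
        rwa [← add_assoc, ← add_assoc] at this)
    refine ⟨⟨_, ht'⟩, ?_⟩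
    rw [hh]
    simp only [Prod.fst_add, Prod.snd_add, Prod.smul_fst, Prod.smul_snd, smul_eq_mul]
    linear_combination hhw + r * hηe + t' * hηd
  exact ⟨key 1 (by norm_num) (by norm_num), key 2 (by norm_num) (by norm_num)⟩

end

section

variable {P : Set (ℝ × ℝ)}

theorem areaOf_eq_integral (hP : MeasurableSet P) (hfin : MeasureTheory.volume P ≠ ⊤) (s : ℝ) :
    areaOf P = ∫ ℓ : ℝ, (MeasureTheory.volume {x : ℝ | (x, ℓ - s * x) ∈ P}).toReal := by
  have hskew : MeasureTheory.MeasurePreserving (fun p : ℝ × ℝ => (p.1, p.2 - s * p.1))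
      MeasureTheory.volume MeasureTheory.volume :=
    (MeasureTheory.MeasurePreserving.id _).skew_product (g := fun x y => y - s * x)
      (by fun_prop) (Filter.Eventually.of_forall fun x =>
        (MeasureTheory.measurePreserving_sub_right MeasureTheory.volume (s * x)).map_eq)
  have hφ := hskew.comp (MeasureTheory.Measure.measurePreserving_swap
    (μ := (MeasureTheory.volume : MeasureTheory.Measure ℝ))
    (ν := (MeasureTheory.volume : MeasureTheory.Measure ℝ)))
  have hvol := hφ.measure_preimage hP.nullMeasurableSet
  have hmeas := hφ.measurable hP
  rw [areaOf, ← hvol, MeasureTheory.Measure.prod_apply hmeas, ← MeasureTheory.integral_toReal]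
  · rfl
  · exact (measurable_measure_prodMk_left hmeas).aemeasurable
  · refine MeasureTheory.Measure.ae_measure_lt_top hmeas ?_
    rw [← hvol] at hfin
    exact hfin

variable {i l : latticePts P → ℕ} {s : ℕ}

theorem Supports.mem_polygon (hP : IsLatticePolygon P) (hi : ∀ k, (i k : ℤ) = k.1.1)
    (hl : ∀ k, (l k : ℤ) = s * k.1.1 + k.1.2) {e B g : ℤ} {m : ℕ} (h : Supports i l e m B g)
    (he : e ≠ 0) {ℓ : ℝ} (h1 : m ≤ ℓ) (h2 : ℓ ≤ m + 1) :
    ((g - B * ℓ) / e, ℓ - s * ((g - B * ℓ) / e)) ∈ P := by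
  obtain ⟨u, v, hu, hv, hug, hvg, -⟩ := h
  have hu' : (l u : ℝ) ≤ m := by exact_mod_cast hu
  have hv' : (m + 1 : ℝ) ≤ l v := by exact_mod_cast hv
  have hD : (0 : ℝ) < l v - l u := by linarith
  have he' : (e : ℝ) ≠ 0 := by exact_mod_cast he
  have hug' : (e * i u + B * l u : ℝ) = g := by exact_mod_cast hug
  have hvg' : (e * i v + B * l v : ℝ) = g := by exact_mod_cast hvg
  have hx (k : latticePts P) : (k.1.1 : ℝ) = i k := by exact_mod_cast (hi k).symm
  have hy (k : latticePts P) : (k.1.2 : ℝ) = l k - s * i k := by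
    have : (l k : ℝ) = s * k.1.1 + k.1.2 := by exact_mod_cast hl k
    rw [this, hx]
    ring
  have hmem := hP.convex u.2 v.2 (a := (l v - ℓ) / (l v - l u)) (b := (ℓ - l u) / (l v - l u))
    (div_nonneg (by linarith) hD.le) (div_nonneg (by linarith) hD.le) (by field_simp; ring)
  have hxe : (g - B * ℓ) / e = (l v - ℓ) / (l v - l u) * i u + (ℓ - l u) / (l v - l u) * i v := by
    field_simp
    linear_combination (ℓ - l v) * hug' + (l u - ℓ) * hvg'
  convert hmem using 1
  simp only [rpt, Prod.smul_mk, Prod.mk_add_mk, smul_eq_mul, hx, hy, hxe]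
  ext
  · rfl
  · simp only
    field_simp
    ring

theorem Supports.le_of_mem (hP : IsLatticePolygon P) (hi : ∀ k, (i k : ℤ) = k.1.1)
    (hl : ∀ k, (l k : ℤ) = s * k.1.1 + k.1.2) {e B g : ℤ} {m : ℕ} (h : Supports i l e m B g)
    {x ℓ : ℝ} (hx : (x, ℓ - s * x) ∈ P) : g ≤ e * x + B * ℓ := by
  have := hP.le_of_forall (a := e + B * s) (b := B) (c := g) (fun k hk => ?_) _ hx
  · linear_combination this
  · obtain ⟨-, -, -, -, -, -, h⟩ := h
    have := h ⟨k, hk⟩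
    rw [hi, hl] at this
    have : (g : ℝ) ≤ e * k.1 + B * (s * k.1 + k.2) := by exact_mod_cast this
    linear_combination this

/-- The area of a lattice polygon in terms of the supporting lines of its slabs. -/
theorem IsLatticePolygon.areaOf_eq (hP : IsLatticePolygon P) (hi : ∀ k, (i k : ℤ) = k.1.1)
    (hl : ∀ k, (l k : ℤ) = s * k.1.1 + k.1.2) {p q : latticePts P} (hp : ∀ k, l p ≤ l k)
    (hq : ∀ k, l k ≤ l q) {M : ℕ} (hM : 0 < M) {B₁ g₁ B₂ g₂ : ℕ → ℤ}
    (h₁ : ∀ m ∈ Finset.Ico (l p) (l q), Supports i l M m (B₁ m) (g₁ m))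
    (h₂ : ∀ m ∈ Finset.Ico (l p) (l q), Supports i l (-M) m (B₂ m) (g₂ m)) :
    2 * M * areaOf P = -∑ m ∈ Finset.Ico (l p) (l q),
      (2 * (g₁ m + g₂ m : ℝ) - (B₁ m + B₂ m) * (2 * m + 1)) := by
  have hM' : (0 : ℝ) < M := by exact_mod_cast hM
  have hcomp : IsCompact P := by
    obtain ⟨V, -, rfl⟩ := hP
    exact Set.Finite.isCompact_convexHull (𝕜 := ℝ) (V.finite_toSet.image _)
  set F : ℝ → ℝ := fun ℓ => (MeasureTheory.volume {x : ℝ | (x, ℓ - s * x) ∈ P}).toReal with hF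
  have hslab : ∀ m ∈ Finset.Ico (l p) (l q), ∀ ℓ ∈ Set.Icc (m : ℝ) (m + 1),
      F ℓ = -((g₁ m + g₂ m) - (B₁ m + B₂ m) * ℓ) / M := by
    rintro m hm ℓ ⟨hℓ1, hℓ2⟩
    have ha := (h₁ m hm).mem_polygon hP hi hl (by exact_mod_cast hM.ne') hℓ1 hℓ2
    have hb := (h₂ m hm).mem_polygon hP hi hl (by
      rw [neg_ne_zero]
      exact_mod_cast hM.ne') hℓ1 hℓ2
    push_cast at ha hb
    set a : ℝ := (g₁ m - B₁ m * ℓ) / M with ha'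
    set b : ℝ := (g₂ m - B₂ m * ℓ) / -M with hb'
    have hsub : ∀ x : ℝ, (x, ℓ - s * x) ∈ P → a ≤ x ∧ x ≤ b := by
      intro x hx
      have e1 := (h₁ m hm).le_of_mem hP hi hl hx
      have e2 := (h₂ m hm).le_of_mem hP hi hl hx
      push_cast at e1 e2
      rw [ha', hb', div_le_iff₀ hM', div_neg, ← neg_div, le_div_iff₀ hM']
      constructor <;> linarith
    have hset : {x : ℝ | (x, ℓ - s * x) ∈ P} = Set.Icc a b := by
      refine Set.Subset.antisymm (fun x hx => hsub x hx) ?_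
      have hconv : Convex ℝ {x : ℝ | (x, ℓ - s * x) ∈ P} := by
        intro x hx y hy t r ht hr htr
        have := hP.convex hx hy ht hr htr
        simp only [Prod.smul_mk, Prod.mk_add_mk, smul_eq_mul] at this
        rw [show t * (ℓ - s * x) + r * (ℓ - s * y) = ℓ - s * (t * x + r * y) by
          linear_combination ℓ * htr] at this
        exact this
      exact hconv.ordConnected.out ha hb
    have hab := (hsub a ha).2
    simp only [hF, hset]
    rw [Real.volume_Icc, ENNReal.toReal_ofReal (by linarith), ha', hb']
    field_simp
    ring
  have hout : ∀ ℓ, ℓ ∉ Set.Icc (l p : ℝ) (l q) → F ℓ = 0 := by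
    intro ℓ hℓ
    have : {x : ℝ | (x, ℓ - s * x) ∈ P} = ∅ := by
      rw [Set.eq_empty_iff_forall_notMem]
      intro x hx
      have hlk (k : ℤ × ℤ) (hk : k ∈ latticePts P) : (l ⟨k, hk⟩ : ℝ) = s * k.1 + k.2 := by
        exact_mod_cast hl ⟨k, hk⟩
      have e1 := hP.le_of_forall (a := s) (b := 1) (c := l p) (fun k hk => by
        rw [one_mul, ← hlk k hk]
        exact_mod_cast hp _) _ hx
      have e2 := hP.le_of_forall (a := -s) (b := -1) (c := -l q) (fun k hk => by
        have := hlk k hk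
        have h3 : (l ⟨k, hk⟩ : ℝ) ≤ l q := by exact_mod_cast hq _
        linarith) _ hx
      exact hℓ ⟨by linarith, by linarith⟩
    simp only [hF, this]
    simp
  have hle : (l p : ℝ) ≤ l q := by exact_mod_cast hp q
  have hslab' : ∀ m ∈ Finset.Ico (l p) (l q), Set.EqOn F
      (fun ℓ => -((g₁ m + g₂ m) - (B₁ m + B₂ m) * ℓ) / M)
      (Set.uIcc (m : ℝ) ((m + 1 : ℕ) : ℝ)) := by
    intro m hm
    rw [Nat.cast_succ, Set.uIcc_of_le (by linarith)]
    exact hslab m hm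
  have hint : ∀ m ∈ Finset.Ico (l p) (l q), ∫ ℓ in (m : ℝ)..((m + 1 : ℕ) : ℝ), F ℓ =
      -((g₁ m + g₂ m) - (B₁ m + B₂ m) * (2 * m + 1) / 2) / M := by
    intro m hm
    rw [intervalIntegral.integral_congr (hslab' m hm), intervalIntegral.integral_div,
      intervalIntegral.integral_neg, intervalIntegral.integral_sub (by simp)
        (Continuous.intervalIntegrable (by fun_prop) _ _),
      intervalIntegral.integral_const_mul, integral_id, intervalIntegral.integral_const]
    push_cast
    rw [smul_eq_mul]
    ring
  have hii : ∀ m ∈ Set.Ico (l p) (l q),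
      IntervalIntegrable F MeasureTheory.volume (m : ℝ) ((m + 1 : ℕ) : ℝ) := by
    intro m hm
    have hcont : Continuous fun ℓ : ℝ => -((g₁ m + g₂ m : ℝ) - (B₁ m + B₂ m) * ℓ) / M := by
      fun_prop
    exact (hcont.intervalIntegrable _ _).congr_uIoo fun ℓ hℓ =>
      (hslab' m (by simpa using hm) (Set.uIoo_subset_uIcc_self hℓ)).symm
  have harea : areaOf P = ∑ m ∈ Finset.Ico (l p) (l q), ∫ ℓ in (m : ℝ)..((m + 1 : ℕ) : ℝ), F ℓ := by
    rw [intervalIntegral.sum_integral_adjacent_intervals_Ico (hp q) hii,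
      intervalIntegral.integral_of_le hle, ← MeasureTheory.integral_Icc_eq_integral_Ioc,
      MeasureTheory.setIntegral_eq_integral_of_forall_compl_eq_zero hout]
    exact areaOf_eq_integral hcomp.measurableSet hcomp.measure_lt_top.ne s
  rw [harea, Finset.mul_sum, ← Finset.sum_neg_distrib]
  refine Finset.sum_congr rfl fun m hm => ?_
  rw [hint m hm]
  field_simp

end

section

theorem Finset.sum_ite_ite_ite {α β : Type*} [DecidableEq β] (I : Finset α) (B : α → β)
    {b₀ b₁ b₂ : β} (h₁ : b₀ ≠ b₁) (h₂ : b₀ ≠ b₂) (h₃ : b₁ ≠ b₂) (x y z : ℕ) :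
    ∑ m ∈ I, ((if B m = b₀ then x else if B m = b₁ then y else if B m = b₂ then z else 0 : ℕ) : ℤ)
      = x * (I.filter fun m => B m = b₀).card + y * (I.filter fun m => B m = b₁).card +
        z * (I.filter fun m => B m = b₂).card := by
  simp only [Finset.card_filter, Nat.cast_sum, Finset.mul_sum, ← Finset.sum_add_distrib]
  refine Finset.sum_congr rfl fun m _ => ?_
  grind

variable {P : Set (ℝ × ℝ)} [Fintype (latticePts P)] {i l : latticePts P → ℕ} {s K : ℕ}
  {p q : latticePts P}

theorem IsLatticePolygon.sum_leftCorr (hP : IsLatticePolygon P) (hs : 2 ≤ s) (hK : 0 < K)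
    (hi : ∀ k, (i k : ℤ) = k.1.1) (hl : ∀ k, (l k : ℤ) = s * k.1.1 + k.1.2)
    (hp : ∀ k, l p ≤ l k) (hq : ∀ k, l k ≤ l q) {B g : ℕ → ℤ}
    (h : ∀ m ∈ Finset.Ico (l p) (l q), Supports i l (s * (s - 1) * K : ℕ) m (B m) (g m)) :
    ∑ m ∈ Finset.Ico (l p) (l q), (leftCorr s K (B m) : ℤ) = ((s * (s - 1) * K : ℕ) : ℤ) *
      (2 * lenFace P (-1, 0) + lenFace P (0, 1) + 2 * lenFace P (1, 1)) := by
  obtain ⟨r, rfl⟩ : ∃ r, s = r + 1 := ⟨s - 1, by omega⟩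
  have hr : 0 < r := by omega
  have hrK : 0 < r * K := by positivity
  simp only [leftCorr, Nat.add_sub_cancel] at h ⊢
  rw [Finset.sum_ite_ite_ite _ _ (by omega) (by rw [add_mul]; omega) (by rw [add_mul]; omega),
    hP.card_filter_slope hl hp hq h 0 (((r + 1) * r * K : ℕ) : ℤ) (-1, 0) (0, 1)
      (by positivity) (fun k => by rw [hi]; ring) (by simp)
      (fun v hv => ⟨v.2, by ext <;> simp at hv ⊢; omega⟩) 1 one_pos (by simp),
    hP.card_filter_slope hl hp hq h (-(r * K : ℕ)) ((r * K : ℕ) : ℤ) (0, 1) (1, 0)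
      (by positivity) (fun k => by rw [hi, hl]; push_cast; ring) (by simp)
      (fun v hv => ⟨v.1, by ext <;> simp at hv ⊢; omega⟩) (r + 1) (by omega) (by simp),
    hP.card_filter_slope hl hp hq h (-((r + 1) * K : ℕ)) (((r + 1) * K : ℕ) : ℤ) (1, 1)
      (1, -1) (by positivity) (fun k => by rw [hi, hl]; push_cast; ring) (by simp)
      (fun v hv => ⟨v.1, by ext <;> simp at hv ⊢; omega⟩) r hr (by simp)]
  push_cast
  ring

theorem IsLatticePolygon.sum_rightCorr (hP : IsLatticePolygon P) (hs : 2 ≤ s) (hK : 0 < K)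
    (hi : ∀ k, (i k : ℤ) = k.1.1) (hl : ∀ k, (l k : ℤ) = s * k.1.1 + k.1.2)
    (hp : ∀ k, l p ≤ l k) (hq : ∀ k, l k ≤ l q) {B g : ℕ → ℤ}
    (h : ∀ m ∈ Finset.Ico (l p) (l q), Supports i l (-(s * (s - 1) * K : ℕ)) m (B m) (g m)) :
    ∑ m ∈ Finset.Ico (l p) (l q), (rightCorr s K (B m) : ℤ) = ((s * (s - 1) * K : ℕ) : ℤ) *
      (lenFace P (1, 0) + 2 * lenFace P (0, -1) + lenFace P (-1, -1)) := by
  obtain ⟨r, rfl⟩ : ∃ r, s = r + 1 := ⟨s - 1, by omega⟩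
  have hr : 0 < r := by omega
  have hrK : 0 < r * K := by positivity
  simp only [rightCorr, Nat.add_sub_cancel] at h ⊢
  rw [Finset.sum_ite_ite_ite _ _ (by omega) (by rw [add_mul]; omega) (by rw [add_mul]; omega),
    hP.card_filter_slope hl hp hq h 0 (((r + 1) * r * K : ℕ) : ℤ) (1, 0) (0, 1)
      (by positivity) (fun k => by rw [hi]; ring) (by simp)
      (fun v hv => ⟨v.2, by ext <;> simp at hv ⊢; omega⟩) 1 one_pos (by simp),
    hP.card_filter_slope hl hp hq h (r * K : ℕ) ((r * K : ℕ) : ℤ) (0, -1) (1, 0)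
      (by positivity) (fun k => by rw [hi, hl]; push_cast; ring) (by simp)
      (fun v hv => ⟨v.1, by ext <;> simp at hv ⊢; omega⟩) (r + 1) (by omega) (by simp),
    hP.card_filter_slope hl hp hq h ((r + 1) * K : ℕ) (((r + 1) * K : ℕ) : ℤ) (-1, -1)
      (1, -1) (by positivity) (fun k => by rw [hi, hl]; push_cast; ring) (by simp)
      (fun v hv => ⟨v.1, by ext <;> simp at hv ⊢; omega⟩) r hr (by simp)]
  push_cast
  ring

theorem FlexGeneric.ncard_flexSet_eq {a : latticePts P → ℂ} {j : latticePts P → ℕ}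
    (hP : IsLatticePolygon P) (h : FlexGeneric a i j s)
    (hs : 2 ≤ s) (hi : ∀ k, (i k : ℤ) = k.1.1) (hj : ∀ k, (j k : ℤ) = k.1.2)
    (hinj : Function.Injective fun k => s * i k + j k) (p₀ q₀ : latticePts P) (hpq : p₀ ≠ q₀) :
    (flexSet a i j).Finite ∧ ((flexSet a i j).ncard : ℝ) = 6 * areaOf P
      - 2 * ((lenFace P (0, -1) : ℝ) + (lenFace P (1, 1) : ℝ) + (lenFace P (-1, 0) : ℝ))
      - ((lenFace P (0, 1) : ℝ) + (lenFace P (-1, -1) : ℝ) + (lenFace P (1, 0) : ℝ)) := by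
  classical
  have : Nonempty (latticePts P) := ⟨p₀⟩
  set l : latticePts P → ℕ := fun k => s * i k + j k with hldef
  have hl (k) : (l k : ℤ) = s * k.1.1 + k.1.2 := by
    rw [← hi, ← hj]
    simp [hldef]
  obtain ⟨p, hp⟩ := Finite.exists_min l
  obtain ⟨q, hq⟩ := Finite.exists_max l
  have hlpq : l p < l q := by
    by_contra! hle
    exact hpq (hinj (((hq p₀).trans (hle.trans (hp q₀))).antisymm
      ((hq q₀).trans (hle.trans (hp p₀)))))
  set K := (l q).factorial
  have hK : 0 < K := Nat.factorial_pos _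
  set M := s * (s - 1) * K with hM
  have hM0 : 0 < M := by
    have : 0 < s - 1 := by omega
    positivity
  have hdvd (u v) (huv : l u < l v) : ((l v - l u : ℕ) : ℤ) ∣ (M : ℤ) :=
    Int.natCast_dvd_natCast.2 ((Nat.dvd_factorial (by omega)
      ((Nat.sub_le _ _).trans (hq v))).trans (dvd_mul_left _ _))
  have hex (e : ℤ) (he : (M : ℤ) ∣ e) : ∃ B g : ℕ → ℤ, ∀ m ∈ Finset.Ico (l p) (l q),
      Supports i l e m (B m) (g m) := by
    have (m : ℕ) : ∃ Bg : ℤ × ℤ, m ∈ Finset.Ico (l p) (l q) → Supports i l e m Bg.1 Bg.2 := by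
      by_cases hm : m ∈ Finset.Ico (l p) (l q)
      · obtain ⟨B, g, hBg⟩ := exists_supports i l e m p q (Finset.mem_Ico.1 hm).1
          (Finset.mem_Ico.1 hm).2 fun u v huv => (hdvd u v huv).trans he
        exact ⟨(B, g), fun _ => hBg⟩
      · exact ⟨0, fun h => absurd h hm⟩
    choose Bg hBg using this
    exact ⟨fun m => (Bg m).1, fun m => (Bg m).2, hBg⟩
  obtain ⟨B₁, g₁, h₁⟩ := hex M dvd_rfl
  obtain ⟨B₂, g₂, h₂⟩ := hex (-M) ((dvd_neg).2 dvd_rfl)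
  obtain ⟨hfin, hcard⟩ : (flexSet a i j).Finite ∧ (M : ℤ) * (flexSet a i j).ncard =
      -∑ m ∈ Finset.Ico (l p) (l q),
        (3 * (g₁ m + g₂ m) + leftCorr s K (B₁ m) + rightCorr s K (B₂ m)) :=
    h.ncard_flexSet hs hK (fun _ => rfl) hinj p q hp hq B₁ g₁ B₂ g₂ h₁ h₂
  refine ⟨hfin, ?_⟩
  have hsum₁ := sum_supports hinj p q hlpq hp hq h₁
  have hsum₂ := sum_supports hinj p q hlpq hp hq h₂
  have hL := hP.sum_leftCorr hs hK hi hl hp hq h₁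
  have hR := hP.sum_rightCorr hs hK hi hl hp hq h₂
  have harea := hP.areaOf_eq hi hl hp hq hM0 h₁ h₂
  rw [Finset.sum_add_distrib, Finset.sum_add_distrib, hL, hR, ← hM, ← Finset.mul_sum,
    Finset.sum_add_distrib] at hcard
  rw [Finset.sum_sub_distrib] at hsum₁ hsum₂
  have hcard' := congrArg (Int.cast (R := ℝ)) hcard
  have hsum₁' := congrArg (Int.cast (R := ℝ)) hsum₁
  have hsum₂' := congrArg (Int.cast (R := ℝ)) hsum₂
  simp only [add_mul (B₁ _ : ℝ), Finset.sum_sub_distrib, Finset.sum_add_distrib,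
    ← Finset.mul_sum] at harea
  push_cast at hcard' hsum₁' hsum₂'
  have hM' : (M : ℝ) ≠ 0 := by exact_mod_cast hM0.ne'
  refine mul_left_cancel₀ hM' ?_
  linear_combination hcard' - 3 * harea + 3 * hsum₁' + 3 * hsum₂'

end

theorem count_inflection_points (P : Set (ℝ × ℝ)) (hP : IsLatticePolygon P)
    (hpos : P ⊆ {p : ℝ × ℝ | 0 ≤ p.1 ∧ 0 ≤ p.2}) (h5 : Contains5Delta P) :
    GenericOn (latticePts P) (fun f =>
      (inflPts f).Finite ∧
      ((inflPts f).ncard : ℝ) =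
        6 * areaOf P
          - 2 * ((lenFace P (0, -1) : ℝ) + (lenFace P (1, 1) : ℝ) + (lenFace P (-1, 0) : ℝ))
          - ((lenFace P (0, 1) : ℝ) + (lenFace P (-1, -1) : ℝ) + (lenFace P (1, 0) : ℝ))) := by
  classical
  have : Fintype (latticePts P) := hP.finite_latticePts.fintype
  obtain ⟨t, ht⟩ := h5.exists_mem
  have hnn : ∀ k ∈ latticePts P, 0 ≤ k.1 ∧ 0 ≤ k.2 := fun k hk => by
    have := hpos hk
    simpa [rpt] using this
  set i : latticePts P → ℕ := fun k => k.1.1.toNat with hidef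
  set j : latticePts P → ℕ := fun k => k.1.2.toNat with hjdef
  have hi (k) : (i k : ℤ) = k.1.1 := Int.toNat_of_nonneg (hnn k.1 k.2).1
  have hj (k) : (j k : ℤ) = k.1.2 := Int.toNat_of_nonneg (hnn k.1 k.2).2
  set s := ∑ k, j k + 3 with hs
  have hjs (k) : j k < s := by
    have := Finset.single_le_sum (f := j) (fun _ _ => Nat.zero_le _) (Finset.mem_univ k)
    omega
  have hinj : Function.Injective fun k => s * i k + j k := by
    intro u v huv
    simp only at huv
    have h2 : j u = j v := by
      have := congrArg (· % s) huv
      simpa [Nat.mul_add_mod, Nat.mod_eq_of_lt (hjs _)] using this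
    have h1 : i u = i v := by
      rw [h2] at huv
      exact Nat.eq_of_mul_eq_mul_left (by omega) (Nat.add_right_cancel huv)
    refine Subtype.ext (Prod.ext ?_ ?_)
    · rw [← hi, ← hi, h1]
    · rw [← hj, ← hj, h2]
  have ht0 := hnn _ (ht 0 0 le_rfl le_rfl (by norm_num))
  simp only [add_zero] at ht0
  have hgen : GenericTuple fun a : latticePts P → ℂ => FlexGeneric a i j s := by
    refine genericTuple_flexGeneric i j t.1.toNat t.2.toNat
      (fun c => ⟨_, ht (min c 3 : ℕ) 0 (by positivity) le_rfl (by omega)⟩)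
      (fun c => ⟨_, ht 0 (min c 3 : ℕ) le_rfl (by positivity) (by omega)⟩) hinj ?_ ?_
      ?_ ?_ ?_ ?_ ?_ ?_
    · intro c hc
      simp only [hidef, hjdef]
      omega
    · intro c hc
      simp only [hidef, hjdef]
      omega
    · exact hP.hasLevels ht (1, 0) (0, 1) (1, 0) (0, 0) (2, 0) (by simp) (by simp)
        (fun v hv => ⟨v.2, by ext <;> simp at hv ⊢; omega⟩) (by simp) (by simp) (by simp)
        (by simp) _ fun k => by rw [hi]; ring
    · exact hP.hasLevels ht (-1, 0) (0, 1) (-1, 0) (5, 0) (3, 0) (by simp) (by simp)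
        (fun v hv => ⟨v.2, by ext <;> simp at hv ⊢; omega⟩) (by simp) (by simp) (by simp)
        (by simp) _ fun k => by rw [hi]; ring
    · exact hP.hasLevels ht (0, 1) (1, 0) (0, 1) (0, 0) (0, 2) (by simp) (by simp)
        (fun v hv => ⟨v.1, by ext <;> simp at hv ⊢; omega⟩) (by simp) (by simp) (by simp)
        (by simp) _ fun k => by rw [hj]; ring
    · exact hP.hasLevels ht (0, -1) (1, 0) (0, -1) (0, 5) (0, 3) (by simp) (by simp)
        (fun v hv => ⟨v.1, by ext <;> simp at hv ⊢; omega⟩) (by simp) (by simp) (by simp)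
        (by simp) _ fun k => by rw [hj]; ring
    · exact hP.hasLevels ht (-1, -1) (1, -1) (-1, 0) (5, 0) (2, 1) (by simp) (by simp)
        (fun v hv => ⟨v.1, by ext <;> simp at hv ⊢; omega⟩) (by simp) (by simp) (by simp)
        (by simp) _ fun k => by rw [hi, hj]; ring
    · exact hP.hasLevels ht (1, 1) (1, -1) (1, 0) (0, 0) (0, 2) (by simp) (by simp)
        (fun v hv => ⟨v.1, by ext <;> simp at hv ⊢; omega⟩) (by simp) (by simp) (by simp)
        (by simp) _ fun k => by rw [hi, hj]; ring
  obtain ⟨D, hD, hDQ⟩ := hgen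
  refine ⟨D, hD, fun f hf hfD => ?_⟩
  have hfg := hDQ _ hfD
  beta_reduce
  rw [inflPts_eq_flexSet hnn hf hfg.contact]
  refine hfg.ncard_flexSet_eq hP (by omega) hi hj hinj
    ⟨_, ht 0 0 le_rfl le_rfl (by norm_num)⟩ ⟨_, ht 1 0 (by norm_num) le_rfl (by norm_num)⟩
    fun h => ?_
  simpa using congrArg (·.1.1) h

end
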